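/- arXiv:2309.01785 — 4 statements merged into one kernel-verified Lean document; each statement's English description precedes it below -/
import Mathlib

section
/- Let F be an infinite field of characteristic not 2 and let m be a positive even integer. Then every element M of the symplectic group Sp_{2m}(F) is a product of four involutions of Sp_{2m}(F); that is, there exist matrices A1, A2, A3, A4 in Sp_{2m}(F) with Ai^2 = 1 for each i and M = A1*A2*A3*A4. -/
namespace SympFour

section
variable {F V : Type*} [Field F] [AddCommGroup V] [Module F V]

structure Symp (s : V →ₗ[F] V →ₗ[F] F) : Prop where
  alt : ∀ x, s x x = 0
  nd : ∀ x, (∀ y, s x y = 0) → x = 0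

def SIso (s : V →ₗ[F] V →ₗ[F] F) (g : V →ₗ[F] V) : Prop := ∀ x y, s (g x) (g y) = s x y

theorem Symp.anti {s : V →ₗ[F] V →ₗ[F] F} (hs : Symp s) (x y : V) : s x y = - s y x := by
  have h := hs.alt (x + y)
  simp only [map_add, LinearMap.add_apply, hs.alt] at h
  linear_combination h

theorem sep [FiniteDimensional F V] {s : V →ₗ[F] V →ₗ[F] F} (hs : Symp s) (S : Submodule F V) (v : V)
    (hv : v ∉ S) : ∃ f, s v f = 1 ∧ ∀ u ∈ S, s u f = 0 := by
  obtain ⟨φ, h1, h2⟩ := Submodule.exists_le_ker_of_notMem hv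
  have hinj : Function.Injective s.flip := by
    rw [injective_iff_map_eq_zero]
    intro a ha
    apply hs.nd
    intro y
    rw [hs.anti]
    have := LinearMap.congr_fun ha y
    simpa using this
  have hsurj : Function.Surjective s.flip :=
    (LinearMap.injective_iff_surjective_of_finrank_eq_finrank
      (Subspace.dual_finrank_eq (K := F) (V := V)).symm).1 hinj
  obtain ⟨g, hg⟩ := hsurj φ
  have hg' : ∀ u, s u g = φ u := fun u => LinearMap.congr_fun hg u
  refine ⟨(φ v)⁻¹ • g, ?_, ?_⟩
  · simp [hg', h1]
  · intro u hu
    have : φ u = 0 := h2 hu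
    simp [hg', this]

theorem iso_inv [FiniteDimensional F V] {s : V →ₗ[F] V →ₗ[F] F} (hs : Symp s) {g : V →ₗ[F] V}
    (hg : SIso s g) : ∃ g' : V →ₗ[F] V, SIso s g' ∧ (∀ x, g (g' x) = x) ∧ (∀ x, g' (g x) = x) := by
  have hinj : Function.Injective g := by
    rw [injective_iff_map_eq_zero]
    intro a ha
    apply hs.nd
    intro y
    rw [← hg, ha]; simp
  let e := LinearEquiv.ofInjectiveEndo g hinj
  have h1 : ∀ x, g (e.symm x) = x := fun x => e.apply_symm_apply x
  refine ⟨e.symm, ?_, h1, fun x => e.symm_apply_apply x⟩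
  intro x y
  rw [← hg]
  show s (g (e.symm x)) (g (e.symm y)) = _
  rw [h1, h1]

theorem exists_f [FiniteDimensional F V] {s : V →ₗ[F] V →ₗ[F] F} (hs : Symp s) (e1 e2 u1 u2 : V)
    (hu : s u1 u2 = 0)
    (hPQ : ∀ x y z w : F, x • e1 + y • e2 = z • u1 + w • u2 → x = 0 ∧ y = 0) (he : s e1 e2 = 0) :
    ∃ f1 f2, s e1 f1 = 1 ∧ s e1 f2 = 0 ∧ s e2 f1 = 0 ∧ s e2 f2 = 1 ∧ s f1 f2 = 0 ∧
      s u1 f1 = 0 ∧ s u1 f2 = 0 ∧ s u2 f1 = 0 ∧ s u2 f2 = 0 := by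
  have hu' : s u2 u1 = 0 := by rw [hs.anti, hu, neg_zero]
  have he' : s e2 e1 = 0 := by rw [hs.anti, he, neg_zero]
  obtain ⟨f1, h11, h1S⟩ := sep hs (Submodule.span F {e2, u1, u2}) e1 (by
    rw [Submodule.mem_span_triple]
    rintro ⟨a, b, c, h⟩
    have := (hPQ 1 (-a) b c (by rw [← h]; module)).1
    exact one_ne_zero this)
  obtain ⟨f2, h22, h2S⟩ := sep hs (Submodule.span F {e1, u1, u2}) e2 (by
    rw [Submodule.mem_span_triple]
    rintro ⟨a, b, c, h⟩
    have := (hPQ (-a) 1 b c (by rw [← h]; module)).2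
    exact one_ne_zero this)
  have a21 : s e2 f1 = 0 := h1S _ (Submodule.subset_span (by simp))
  have b1 : s u1 f1 = 0 := h1S _ (Submodule.subset_span (by simp))
  have b2 : s u2 f1 = 0 := h1S _ (Submodule.subset_span (by simp))
  have a12 : s e1 f2 = 0 := h2S _ (Submodule.subset_span (by simp))
  have c1 : s u1 f2 = 0 := h2S _ (Submodule.subset_span (by simp))
  have c2 : s u2 f2 = 0 := h2S _ (Submodule.subset_span (by simp))
  by_cases hg : ∃ g, s e1 g = 0 ∧ s e2 g = 0 ∧ s u1 g = 0 ∧ s u2 g = 0 ∧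
      g ∉ Submodule.span F {u1, u2}
  · obtain ⟨g, g1, g2, g3, g4, g5⟩ := hg
    by_cases k1 : s f1 g = 0
    swap
    · refine ⟨f1, f2 - (s f1 f2 / s f1 g) • g, h11, ?_, a21, ?_, ?_, b1, ?_, b2, ?_⟩ <;>
        simp [a12, h22, c1, c2, g1, g2, g3, g4, k1]
    by_cases k2 : s g f2 = 0
    swap
    · refine ⟨f1 - (s f1 f2 / s g f2) • g, f2, ?_, a12, ?_, h22, ?_, ?_, c1, ?_, c2⟩ <;>
        simp [h11, a21, b1, b2, g1, g2, g3, g4, k2]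
    obtain ⟨h, h1, h2⟩ := sep hs _ g g5
    have d1 : s u1 h = 0 := h2 _ (Submodule.subset_span (by simp))
    have d2 : s u2 h = 0 := h2 _ (Submodule.subset_span (by simp))
    have k1' : s g f1 = 0 := by rw [hs.anti, k1, neg_zero]
    refine ⟨f1 - (s f1 f2 + s f1 (h - s e1 h • f1 - s e2 h • f2)) • g,
      f2 + (h - s e1 h • f1 - s e2 h • f2), ?_, ?_, ?_, ?_, ?_, ?_, ?_, ?_, ?_⟩ <;>
        simp [h11, a12, a21, h22, b1, b2, c1, c2, g1, g2, g3, g4, d1, d2, k1, k2, k1', h1]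
  · push Not at hg
    have hmem : ∀ f, s u1 f = 0 → s u2 f = 0 → ∃ x y z w : F, f = x • e1 + y • e2 + (z • u1 + w • u2) := by
      intro f hf1 hf2
      by_contra hcon
      obtain ⟨g, gg, gS⟩ := sep hs (Submodule.span F {e1, e2} ⊔ Submodule.span F {u1, u2}) f (by
        rw [Submodule.mem_sup]
        rintro ⟨p, hp, q, hq, hpq⟩
        obtain ⟨x, y, rfl⟩ := Submodule.mem_span_pair.1 hp
        obtain ⟨z, w, rfl⟩ := Submodule.mem_span_pair.1 hq
        exact hcon ⟨x, y, z, w, hpq.symm⟩)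
      have := hg g (gS _ (Submodule.mem_sup_left (Submodule.subset_span (by simp))))
        (gS _ (Submodule.mem_sup_left (Submodule.subset_span (by simp))))
        (gS _ (Submodule.mem_sup_right (Submodule.subset_span (by simp))))
        (gS _ (Submodule.mem_sup_right (Submodule.subset_span (by simp))))
      obtain ⟨z, w, rfl⟩ := Submodule.mem_span_pair.1 this
      rw [hs.anti] at gg
      simp [hf1, hf2] at gg
    refine ⟨f1, f2, h11, a12, a21, h22, ?_, b1, c1, b2, c2⟩
    obtain ⟨x1, y1, z1, w1, r1⟩ := hmem f1 b1 b2
    obtain ⟨x2, y2, z2, w2, r2⟩ := hmem f2 c1 c2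
    have q1 : s (z1 • u1 + w1 • u2) f2 = 0 := by simp [c1, c2]
    have q2 : s f1 (z2 • u1 + w2 • u2) = 0 := by rw [hs.anti]; simp [b1, b2]
    have t1 : s f1 f2 = y1 := by
      conv_lhs => rw [r1]
      simp [a12, h22, c1, c2]
    have t2 : s f1 f2 = - x2 := by
      rw [hs.anti]
      conv_lhs => rw [r2]
      simp [a21, h11, b1, b2]
    have t3 : s f1 f2 = s (x1 • e1 + y1 • e2) (x2 • e1 + y2 • e2) +
       s (z1 • u1 + w1 • u2) (x2 • e1 + y2 • e2) := by
      conv_lhs => rw [r2, map_add, q2, add_zero, r1, map_add s, LinearMap.add_apply]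
    have t4 : s (z1 • u1 + w1 • u2) (x2 • e1 + y2 • e2) = 0 := by
      have : x2 • e1 + y2 • e2 = f2 - (z2 • u1 + w2 • u2) := by
        conv_rhs => rw [r2]
        abel
      rw [this, map_sub, q1]
      simp [hs.alt, hu, hu']
    rw [t3, t4]
    simp [hs.alt, he, he']

theorem exists_perp [FiniteDimensional F V] (s : V →ₗ[F] V →ₗ[F] F)
    (hd : 4 ≤ Module.finrank F V) (x a b : V) : ∃ y, s x y = 0 ∧ y ∉ Submodule.span F {a, b} := by
  by_contra hcon
  push Not at hcon
  have hle : LinearMap.ker (s x) ≤ Submodule.span F {a, b} := fun y hy => hcon y hy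
  have h1 := Submodule.finrank_mono hle
  have h2 := (s x).finrank_range_add_finrank_ker
  have h3 : Module.finrank F (LinearMap.range (s x)) ≤ 1 := by
    simpa using Submodule.finrank_le (LinearMap.range (s x))
  have h4 : Module.finrank F (Submodule.span F ({a, b} : Set V)) ≤ 2 := by
    classical
    have h6 := finrank_span_finset_le_card (R := F) ({a, b} : Finset V)
    have h5 : ({a, b} : Finset V).card ≤ 2 := Finset.card_le_two
    have h7 : ((({a, b} : Finset V) : Set V)) = {a, b} := by simp
    rw [h7] at h6
    exact h6.trans h5
  omega

theorem lemL [FiniteDimensional F V] {s : V →ₗ[F] V →ₗ[F] F} (hs : Symp s)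
    (hd : 4 ≤ Module.finrank F V) {M : V →ₗ[F] V} (hM : SIso s M) {p : V} {μ : F}
    (hp : p ≠ 0) (hMp : M p = μ • p)
    (H : ∀ y, s p y = 0 → ∃ α β : F, M y = α • p + β • y) :
    ∃ ν : F, ν * ν = 1 ∧ (∀ y, s p y = 0 → ∃ α : F, M y = ν • y + α • p) ∧
      ∃ y z, s p y = 0 ∧ s p z = 0 ∧ s y z = 1 := by
  obtain ⟨y, hy, hyp⟩ := exists_perp s hd p p p
  have hyp' : ∀ c : F, y ≠ c • p := by
    intro c hc
    apply hyp
    rw [Submodule.mem_span_pair]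
    exact ⟨c, 0, by rw [hc]; simp⟩
  obtain ⟨z, hz, hzS⟩ := sep hs _ y hyp
  have hpz : s p z = 0 := hzS _ (Submodule.subset_span (by simp))
  obtain ⟨α, β, hMy⟩ := H y hy
  have key : ∀ w, s p w = 0 → ∃ γ : F, M w = β • w + γ • p := by
    intro w hw
    by_cases hmem : ∃ c k : F, w = c • p + k • y
    · obtain ⟨c, k, rfl⟩ := hmem
      refine ⟨c * μ + k * α - β * c, ?_⟩
      simp only [map_add, map_smul, hMp, hMy]
      module
    · push Not at hmem
      obtain ⟨a1, b1, h1⟩ := H w hw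
      obtain ⟨a2, b2, h2⟩ := H (w + y) (by simp [hw, hy])
      rw [map_add, h1, hMy] at h2
      have e1 : b2 = b1 := by
        by_contra hne
        have hne' : b2 - b1 ≠ 0 := sub_ne_zero.2 hne
        apply hmem ((b2 - b1)⁻¹ * (a1 + α - a2)) ((b2 - b1)⁻¹ * (β - b2))
        have : (b2 - b1) • w = (a1 + α - a2) • p + (β - b2) • y := by
          linear_combination (norm := module) -h2
        rw [← inv_smul_smul₀ hne' w, this]
        module
      have e2 : b2 = β := by
        by_contra hne
        have hne' : b2 - β ≠ 0 := sub_ne_zero.2 hne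
        apply hyp' ((b2 - β)⁻¹ * (a1 + α - a2))
        have : (b2 - β) • y = (a1 + α - a2) • p := by
          subst e1
          linear_combination (norm := module) -h2
        rw [← inv_smul_smul₀ hne' y, this]
        module
      refine ⟨a1, ?_⟩
      rw [h1, ← e1, e2]; abel
  refine ⟨β, ?_, key, y, z, hy, hpz, hz⟩
  obtain ⟨γ, hMz⟩ := key z hpz
  have := hM y z
  rw [hMy, hMz] at this
  have hyp0 : s y p = 0 := by rw [hs.anti, hy, neg_zero]
  simp only [map_add, map_smul, LinearMap.add_apply, LinearMap.smul_apply, hs.alt, hpz, hz, hyp0,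
    smul_eq_mul] at this
  linear_combination this

structure Hyp (s : V →ₗ[F] V →ₗ[F] F) (e1 e2 f1 f2 : V) : Prop where
  e12 : s e1 e2 = 0
  f12 : s f1 f2 = 0
  h11 : s e1 f1 = 1
  h12 : s e1 f2 = 0
  h21 : s e2 f1 = 0
  h22 : s e2 f2 = 1

def Good (s : V →ₗ[F] V →ₗ[F] F) (M : V →ₗ[F] V) : Prop :=
  ∃ e1 e2 f1 f2 : V, ∃ d : F, d ≠ 0 ∧ Hyp s e1 e2 f1 f2 ∧
    s (M e1) f1 = d ∧ s (M e1) f2 = 0 ∧ s (M e2) f1 = 0 ∧ s (M e2) f2 = d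

theorem good_of [FiniteDimensional F V] {s : V →ₗ[F] V →ₗ[F] F} (hs : Symp s)
    {M : V →ₗ[F] V} (e1 e2 : V) (d : F) (hd : d ≠ 0) (he : s e1 e2 = 0)
    (hu : s (M e1 - d • e1) (M e2 - d • e2) = 0)
    (hPQ : ∀ x y z w : F, x • e1 + y • e2 = z • (M e1 - d • e1) + w • (M e2 - d • e2) →
      x = 0 ∧ y = 0) : Good s M := by
  obtain ⟨f1, f2, h1, h2, h3, h4, h5, h6, h7, h8, h9⟩ := exists_f hs e1 e2 _ _ hu hPQ he
  refine ⟨e1, e2, f1, f2, d, hd, ⟨he, h5, h1, h2, h3, h4⟩, ?_, ?_, ?_, ?_⟩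
  · simp [h1] at h6; linear_combination h6
  · simp [h2] at h7; linear_combination h7
  · simp [h3] at h8; linear_combination h8
  · simp [h4] at h9; linear_combination h9

/-- eigenvector case -/
theorem good_eig1 [FiniteDimensional F V] {s : V →ₗ[F] V →ₗ[F] F} (hs : Symp s)
    {M : V →ₗ[F] V} (hM : SIso s M) {p : V} {μ : F}
    (hp : p ≠ 0) (hMp : M p = μ • p)
    (H : ¬ ∀ y, s p y = 0 → ∃ α β : F, M y = α • p + β • y) : Good s M := by
  have hμ : μ ≠ 0 := by
    rintro rfl
    apply hp
    apply hs.nd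
    intro y
    rw [← hM, hMp]; simp
  push Not at H
  obtain ⟨y, hy, hH⟩ := H
  refine good_of hs p y μ hμ hy (by rw [hMp]; simp) ?_
  intro a b z w h
  rw [hMp] at h
  have hw : w = 0 := by
    by_contra hw
    apply hH (w⁻¹ * a) (w⁻¹ * b + μ)
    have : w • M y = a • p + (b + w * μ) • y := by
      linear_combination (norm := module) -h
    rw [← inv_smul_smul₀ hw (M y), this]
    match_scalars <;> field_simp
  subst hw
  simp at h
  have hb : b = 0 := by
    by_contra hb
    apply hH (-b⁻¹ * a * μ) 0
    have : y = (-b⁻¹ * a) • p := by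
      have : b • y = - (a • p) := by linear_combination (norm := module) h
      rw [← inv_smul_smul₀ hb y, this]; module
    rw [this, map_smul, hMp]; module
  subst hb
  simp [hp] at h
  exact ⟨h, rfl⟩

theorem good_eig2 [FiniteDimensional F V] {s : V →ₗ[F] V →ₗ[F] F} (hs : Symp s)
    {M : V →ₗ[F] V} {p q : V} {μ : F} (hμ : μ ≠ 0)
    (hMp : M p = μ • p) (hMq : M q = μ • q) (hpq : s p q = 0)
    (hi : ∀ x y : F, x • p + y • q = 0 → x = 0 ∧ y = 0) : Good s M := by
  refine good_of hs p q μ hμ hpq (by simp [hMp]) ?_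
  intro x y z w h
  apply hi
  simpa [hMp, hMq] using h

theorem good_eig [FiniteDimensional F V] {s : V →ₗ[F] V →ₗ[F] F} (hs : Symp s)
    (hd : 4 ≤ Module.finrank F V)
    {M : V →ₗ[F] V} (hM : SIso s M) (hM2 : ¬ ∀ x, M (M x) = x) {p : V} {μ : F}
    (hp : p ≠ 0) (hMp : M p = μ • p) : Good s M := by
  by_cases H : ∀ y, s p y = 0 → ∃ α β : F, M y = α • p + β • y
  swap
  · exact good_eig1 hs hM hp hMp H
  obtain ⟨ν, hν, hall, y, z, hy, hz, hyz⟩ := lemL hs hd hM hp hMp H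
  obtain ⟨α, hMy⟩ := hall y hy
  obtain ⟨β, hMz⟩ := hall z hz
  have hν0 : ν ≠ 0 := by rintro rfl; simp at hν
  have hyp0 : s y p = 0 := by rw [hs.anti, hy, neg_zero]
  have hzy : s z y = -1 := by rw [hs.anti, hyz]
  by_cases hμν : μ = ν
  · subst hμν
    by_cases hα : α = 0
    · subst hα
      refine good_eig2 hs hν0 hMp (q := y) (by rw [hMy]; simp) hy ?_
      intro a b hab
      have hb : b = 0 := by
        have := congrArg (fun v => s v z) hab
        simpa [hz, hyz] using this
      subst hb
      simp [hp] at hab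
      exact ⟨hab, rfl⟩
    · refine good_eig2 hs hν0 hMp (q := β • y - α • z) ?_ (by simp [hy, hz]) ?_
      · simp only [map_sub, map_smul, hMy, hMz]; module
      intro a b hab
      have hb : b = 0 := by
        have := congrArg (fun v => s v y) hab
        simpa [hy, hzy, hs.alt, hα] using this
      subst hb
      simp [hp] at hab
      exact ⟨hab, rfl⟩
  · have hne : ν - μ ≠ 0 := fun h => hμν (sub_eq_zero.1 h).symm
    obtain ⟨y', hy'⟩ : ∃ y', y' = y + (α / (ν - μ)) • p := ⟨_, rfl⟩
    have hMy' : M y' = ν • y' := by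
      rw [hy', map_add, map_smul, hMy, hMp]
      match_scalars
      · ring
      · field_simp; ring
    have hy'z : s y' z = 1 := by simp [hy', hyz, hz]
    have hy'0 : y' ≠ 0 := by rintro h; simp [h] at hy'z
    by_cases H' : ∀ w, s y' w = 0 → ∃ α β : F, M w = α • y' + β • w
    swap
    · exact good_eig1 hs hM hy'0 hMy' H'
    obtain ⟨ν2, hν2, hall2, -⟩ := lemL hs hd hM hy'0 hMy' H'
    obtain ⟨γ, hγ⟩ := hall2 p (by simp [hy', hyp0, hs.alt])
    rw [hMp] at hγ
    have hγ0 : γ = 0 := by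
      have := congrArg (fun v => s v z) hγ
      simpa [hz, hy'z, eq_comm] using this
    have hμ2 : μ = ν2 := by
      subst hγ0
      simp at hγ
      have : (μ - ν2) • p = 0 := by rw [sub_smul, hγ, sub_self]
      simpa [hp, sub_eq_zero] using this
    subst hμ2
    have hsum : μ + ν = 0 := by
      have : (μ - ν) * (μ + ν) = 0 := by linear_combination hν2 - hν
      rcases mul_eq_zero.1 this with h | h
      · exact absurd (sub_eq_zero.1 h) hμν
      · exact h
    exfalso
    apply hM2
    have k1 : ∀ w, s p w = 0 → M (M w) = w := by
      intro w hw
      obtain ⟨c, hc⟩ := hall w hw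
      rw [hc, map_add, map_smul, map_smul, hc, hMp]
      have : ν • (ν • w + c • p) + c • μ • p = (ν * ν) • w + (c * (μ + ν)) • p := by module
      rw [this, hν, hsum]; simp
    have k2 : ∀ w, s y' w = 0 → M (M w) = w := by
      intro w hw
      obtain ⟨c, hc⟩ := hall2 w hw
      rw [hc, map_add, map_smul, map_smul, hc, hMy']
      have : μ • (μ • w + c • y') + c • ν • y' = (μ * μ) • w + (c * (μ + ν)) • y' := by module
      rw [this, hν2, hsum]; simp
    intro x
    have h1 := k2 (x - s y' x • z) (by simp [hy'z])
    have h2 := k1 z hz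
    simp only [map_sub, map_smul, h2] at h1
    linear_combination (norm := module) h1

theorem good [FiniteDimensional F V] {s : V →ₗ[F] V →ₗ[F] F} (hs : Symp s)
    (hd : 4 ≤ Module.finrank F V)
    {M : V →ₗ[F] V} (hM : SIso s M) (hM2 : ¬ ∀ x, M (M x) = x) : Good s M := by
  by_cases hE : ∃ p : V, ∃ μ : F, p ≠ 0 ∧ M p = μ • p
  · obtain ⟨p, μ, hp, hMp⟩ := hE
    exact good_eig hs hd hM hM2 hp hMp
  push Not at hE
  obtain ⟨Mi, hMi, hi1, hi2⟩ := iso_inv hs hM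
  have adj : ∀ x y, s (Mi x) y = s x (M y) := fun x y => by rw [← hM, hi1]
  have adj' : ∀ x y, s (M x) y = s x (Mi y) := fun x y => by rw [← hMi, hi2]
  obtain ⟨x, hx⟩ : ∃ x, s x (M x) ≠ 0 := by
    by_contra hcon
    push Not at hcon
    apply hM2
    intro x
    have : M x = Mi x := by
      rw [← sub_eq_zero]
      apply hs.nd
      intro y
      have := hcon (x + y)
      simp only [map_add, LinearMap.add_apply, hcon] at this
      rw [map_sub, LinearMap.sub_apply, adj, hs.anti]
      linear_combination -this
    rw [this, hi1]
  have hx0 : x ≠ 0 := by rintro rfl; simp at hx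
  obtain ⟨τ, hτ⟩ : ∃ τ : F, s (M x + Mi x - τ • x) (M x) = 0 := by
    refine ⟨s (M x + Mi x) (M x) / s x (M x), ?_⟩
    simp [hx]
  obtain ⟨g, hg⟩ : ∃ g, g = M x + Mi x - τ • x := ⟨_, rfl⟩
  rw [← hg] at hτ
  have hgx : s g x = 0 := by
    rw [hg]
    simp only [map_sub, map_add, map_smul, LinearMap.sub_apply, LinearMap.add_apply,
      LinearMap.smul_apply, hs.alt, adj]
    rw [hs.anti (M x) x]; simp
  have hxg : s x g = 0 := by rw [hs.anti, hgx, neg_zero]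
  by_cases hg0 : g = 0
  · have hMMx : M (M x) = τ • M x - x := by
      have : Mi x = τ • x - M x := by
        rw [hg0] at hg
        linear_combination (norm := module) -hg
      have h2 := hi1 x
      rw [this, map_sub, map_smul] at h2
      linear_combination (norm := module) -h2
    have hT : M x + Mi x = τ • x := by
        rw [hg0] at hg
        linear_combination (norm := module) -hg
    obtain ⟨y, hy, hyS⟩ := exists_perp s hd x x (M x)
    have hyS' : ∀ a b : F, y ≠ a • x + b • M x := by
      intro a b h
      exact hyS (Submodule.mem_span_pair.2 ⟨a, b, h.symm⟩)
    refine good_of hs x y 1 one_ne_zero hy ?_ ?_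
    · have h1 : s x (M y) = s (Mi x) y := (adj x y).symm
      have h2 := congrArg (fun v => s v y) hT
      simp only [map_add, map_smul, LinearMap.add_apply, LinearMap.smul_apply, hy] at h2
      simp only [one_smul, map_sub, LinearMap.sub_apply, hM x y, hy, h1]
      simp only [smul_zero] at h2
      linear_combination -h2
    · intro a b z w h
      by_cases hw : w = 0
      · subst hw
        have hb : b = 0 := by
          by_contra hb
          apply hyS' (b⁻¹ * (- z - a)) (b⁻¹ * z)
          have : b • y = (- z - a) • x + z • M x := by linear_combination (norm := module) h
          rw [← inv_smul_smul₀ hb y, this]; module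
        subst hb
        refine ⟨?_, rfl⟩
        have hz : z = 0 := by
          by_contra hz
          apply hE x (z⁻¹ * (a + z)) hx0
          have : z • M x = (a + z) • x := by linear_combination (norm := module) -h
          rw [← inv_smul_smul₀ hz (M x), this]; module
        subst hz
        simpa [hx0] using h
      · exfalso
        obtain ⟨t, c1, c2, hMy⟩ : ∃ t c1 c2 : F, M y = t • y + (c1 • x + c2 • M x) := by
          refine ⟨w⁻¹ * (b + w), w⁻¹ * (a + z), w⁻¹ * (-z), ?_⟩
          have : w • M y = (b + w) • y + (a + z) • x + (-z) • M x := by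
            linear_combination (norm := module) -h
          rw [← inv_smul_smul₀ hw (M y), this]; module
        have hc : t * (τ - t) - 1 ≠ 0 := by
          intro hc
          apply hE (M x - t • x) (τ - t)
          · intro h0
            exact hE x t hx0 (sub_eq_zero.1 h0)
          · rw [map_sub, map_smul, hMMx]
            have : (τ - t) • (M x - t • x) = τ • M x - x - t • M x - (t * (τ - t) - 1) • x := by
              module
            rw [this, hc]; simp
        obtain ⟨w0, hw0⟩ : ∃ w0, w0 = c1 • x + c2 • M x := ⟨_, rfl⟩
        have hMw0 : M (M w0) - τ • M w0 + w0 = 0 := by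
          rw [hw0]
          simp only [map_add, map_smul, hMMx, map_sub]
          module
        obtain ⟨w', hw'⟩ : ∃ w', w' = (t * (τ - t) - 1)⁻¹ • (M w0 - (τ - t) • w0) := ⟨_, rfl⟩
        have h1 : M w' - t • w' = w0 := by
          rw [hw', map_smul, map_sub, map_smul]
          have : M (M w0) = τ • M w0 - w0 := by linear_combination (norm := module) hMw0
          rw [this]
          match_scalars
          · ring
          · field_simp; ring
        have h2 : M (y - w') = t • (y - w') := by
          rw [map_sub, hMy, ← hw0, ← h1]; module
        by_cases h3 : y - w' = 0
        · have h4 : y = w' := sub_eq_zero.1 h3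
          rw [hw', hw0] at h4
          simp only [map_add, map_smul, hMMx] at h4
          refine hyS' ((t * (τ - t) - 1)⁻¹ * (- c2 - (τ - t) * c1))
            ((t * (τ - t) - 1)⁻¹ * (c1 + c2 * τ - (τ - t) * c2)) ?_
          refine h4.trans ?_
          module
        · exact hE _ _ h3 h2
  · have hgMi : s g (Mi x) = 0 := by
      have : Mi x = g - M x + τ • x := by rw [hg]; abel
      rw [this]
      simp [hs.alt, hτ, hgx]
    refine good_of hs x g 1 one_ne_zero hxg ?_ ?_
    · have h1 : s (M x) g = 0 := by rw [hs.anti, hτ, neg_zero]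
      have h2 : s x (M g) = 0 := by rw [← adj, hs.anti, hgMi, neg_zero]
      simp [hM x g, hxg, h1, h2]
    · intro a b z w h
      have h' : (a + z) • x + (b + w) • g = z • M x + w • M g := by
        linear_combination (norm := module) h
      have hz : z = 0 := by
        have := congrArg (fun v => s v x) h'
        simp only [map_add, map_smul, LinearMap.add_apply, LinearMap.smul_apply, hs.alt, hgx,
          adj' g x, hgMi, hs.anti (M x) x] at this
        simpa [hx] using this
      subst hz
      have ha : a = 0 := by
        have := congrArg (fun v => s v (M x)) h'
        simp only [map_add, map_smul, LinearMap.add_apply, LinearMap.smul_apply, hs.alt, hgx,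
          hM g x, hτ] at this
        simpa [hx] using this
      subst ha
      refine ⟨rfl, ?_⟩
      by_cases hw : w = 0
      · subst hw; simpa [hg0] using h'
      · exfalso
        apply hE g (w⁻¹ * (b + w)) hg0
        have : w • M g = (b + w) • g := by
          linear_combination (norm := module) -h'
        rw [← inv_smul_smul₀ hw (M g), this]; module

end
end SympFour

namespace SympFour
section
variable {F V : Type*} [Field F] [AddCommGroup V] [Module F V]

structure InW (s : V →ₗ[F] V →ₗ[F] F) (e1 e2 f1 f2 : V) (v : V) : Prop where
  e1 : s v e1 = 0
  e2 : s v e2 = 0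
  f1 : s v f1 = 0
  f2 : s v f2 = 0

def prj (s : V →ₗ[F] V →ₗ[F] F) (e1 e2 f1 f2 : V) : V →ₗ[F] V :=
  LinearMap.id - (s.flip f1).smulRight e1 - (s.flip f2).smulRight e2
    + (s.flip e1).smulRight f1 + (s.flip e2).smulRight f2

theorem prj_apply (s : V →ₗ[F] V →ₗ[F] F) (e1 e2 f1 f2 v : V) : prj s e1 e2 f1 f2 v =
    v - s v f1 • e1 - s v f2 • e2 + s v e1 • f1 + s v e2 • f2 := by
  simp [prj]

theorem Hyp.e21 {s : V →ₗ[F] V →ₗ[F] F} (hs : Symp s) {e1 e2 f1 f2 : V} (h : Hyp s e1 e2 f1 f2) :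
    s e2 e1 = 0 := by rw [hs.anti, h.e12, neg_zero]
theorem Hyp.f21 {s : V →ₗ[F] V →ₗ[F] F} (hs : Symp s) {e1 e2 f1 f2 : V} (h : Hyp s e1 e2 f1 f2) :
    s f2 f1 = 0 := by rw [hs.anti, h.f12, neg_zero]
theorem Hyp.k11 {s : V →ₗ[F] V →ₗ[F] F} (hs : Symp s) {e1 e2 f1 f2 : V} (h : Hyp s e1 e2 f1 f2) :
    s f1 e1 = -1 := by rw [hs.anti, h.h11]
theorem Hyp.k12 {s : V →ₗ[F] V →ₗ[F] F} (hs : Symp s) {e1 e2 f1 f2 : V} (h : Hyp s e1 e2 f1 f2) :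
    s f1 e2 = 0 := by rw [hs.anti, h.h21, neg_zero]
theorem Hyp.k21 {s : V →ₗ[F] V →ₗ[F] F} (hs : Symp s) {e1 e2 f1 f2 : V} (h : Hyp s e1 e2 f1 f2) :
    s f2 e1 = 0 := by rw [hs.anti, h.h12, neg_zero]
theorem Hyp.k22 {s : V →ₗ[F] V →ₗ[F] F} (hs : Symp s) {e1 e2 f1 f2 : V} (h : Hyp s e1 e2 f1 f2) :
    s f2 e2 = -1 := by rw [hs.anti, h.h22]

theorem prj_inW {s : V →ₗ[F] V →ₗ[F] F} (hs : Symp s) {e1 e2 f1 f2 : V} (h : Hyp s e1 e2 f1 f2)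
    (v : V) : InW s e1 e2 f1 f2 (prj s e1 e2 f1 f2 v) := by
  constructor <;> rw [prj_apply] <;>
    simp [hs.alt, h.e12, h.f12, h.h11, h.h12, h.h21, h.h22, h.e21 hs, h.f21 hs, h.k11 hs, h.k12 hs,
      h.k21 hs, h.k22 hs]

theorem prj_of_inW {s : V →ₗ[F] V →ₗ[F] F} {e1 e2 f1 f2 : V} {v : V}
    (h : InW s e1 e2 f1 f2 v) : prj s e1 e2 f1 f2 v = v := by
  rw [prj_apply, h.e1, h.e2, h.f1, h.f2]; simp

theorem decomp (s : V →ₗ[F] V →ₗ[F] F) (e1 e2 f1 f2 v : V) :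
    v = s v f1 • e1 + s v f2 • e2 - s v e1 • f1 - s v e2 • f2 + prj s e1 e2 f1 f2 v := by
  rw [prj_apply]; module

theorem ext_hyp {s : V →ₗ[F] V →ₗ[F] F} (hs : Symp s) {e1 e2 f1 f2 : V} (h : Hyp s e1 e2 f1 f2)
    {S T : V →ₗ[F] V} (h1 : S e1 = T e1) (h2 : S e2 = T e2) (h3 : S f1 = T f1) (h4 : S f2 = T f2)
    (h5 : ∀ w, InW s e1 e2 f1 f2 w → S w = T w) (v : V) : S v = T v := by
  rw [decomp s e1 e2 f1 f2 v]
  simp only [map_add, map_sub, map_smul, h1, h2, h3, h4, h5 _ (prj_inW hs h v)]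

theorem inW_zero {s : V →ₗ[F] V →ₗ[F] F} (hs : Symp s) {e1 e2 f1 f2 : V} (h : Hyp s e1 e2 f1 f2)
    {u : V} (hu : InW s e1 e2 f1 f2 u) {x y : F} (hx : u = x • f1 + y • f2) : u = 0 := by
  have h1 := hu.e1
  have h2 := hu.e2
  rw [hx] at h1 h2
  simp [h.k11 hs, h.k21 hs, h.k12 hs, h.k22 hs] at h1 h2
  rw [hx, h1, h2]; simp

theorem inW_add {s : V →ₗ[F] V →ₗ[F] F} {e1 e2 f1 f2 : V}
    {u v : V} (hu : InW s e1 e2 f1 f2 u) (hv : InW s e1 e2 f1 f2 v) (c : F) :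
    InW s e1 e2 f1 f2 (u - c • v) := by
  constructor <;> simp [hu.e1, hu.e2, hu.f1, hu.f2, hv.e1, hv.e2, hv.f1, hv.f2]

theorem exists_L {s : V →ₗ[F] V →ₗ[F] F} (hs : Symp s) {e1 e2 f1 f2 e1' e2' : V}
    (h : Hyp s e1 e2 f1 f2) (h' : Hyp s e1' e2' f1 f2) :
    ∃ L : V →ₗ[F] V, SIso s L ∧ L e1 = e1' ∧ L e2 = e2' ∧ L f1 = f1 ∧ L f2 = f2 ∧
      ∀ w, InW s e1 e2 f1 f2 w → ∃ x y : F, L w = w + x • f1 + y • f2 := by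
  let L : V →ₗ[F] V := LinearMap.id + (s.flip f1).smulRight (e1' - e1)
    + (s.flip f2).smulRight (e2' - e2)
    + (s.flip (e1' - e1) - s e1 e1' • s.flip f1 - s e2 e1' • s.flip f2).smulRight f1
    + (s.flip (e2' - e2) - s e1 e2' • s.flip f1 - s e2 e2' • s.flip f2).smulRight f2
  have hL : ∀ v, L v = v + s v f1 • (e1' - e1) + s v f2 • (e2' - e2)
      + (s v e1' - s v e1 - s e1 e1' * s v f1 - s e2 e1' * s v f2) • f1
      + (s v e2' - s v e2 - s e1 e2' * s v f1 - s e2 e2' * s v f2) • f2 := by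
    intro v; simp [L]
  refine ⟨L, ?_, ?_, ?_, ?_, ?_, ?_⟩
  · intro v w
    rw [hL, hL]
    simp only [map_add, map_sub, map_smul, LinearMap.add_apply, LinearMap.sub_apply,
      LinearMap.smul_apply, smul_eq_mul, hs.alt, h.e12, h.f12, h.h11, h.h12, h.h21, h.h22, h.e21 hs,
      h.f21 hs, h.k11 hs, h.k12 hs, h.k21 hs, h.k22 hs, h'.e12, h'.h11, h'.h12, h'.h21,
      h'.h22, h'.e21 hs, h'.k11 hs, h'.k12 hs, h'.k21 hs, h'.k22 hs,
      hs.anti e1 w, hs.anti e2 w, hs.anti e1' w, hs.anti e2' w, hs.anti f1 w, hs.anti f2 w,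
      hs.anti e1' e1, hs.anti e1' e2, hs.anti e2' e1, hs.anti e2' e2]
    ring
  · rw [hL]
    simp [hs.alt, h.e12, h.h11, h.h12]
  · rw [hL]
    simp [hs.alt, h.e21 hs, h.h21, h.h22]
  · rw [hL]
    simp [hs.alt, h.f12, h.k11 hs, h.k12 hs, h'.k11 hs, h'.k12 hs]
  · rw [hL]
    simp [hs.alt, h.f21 hs, h.k21 hs, h.k22 hs, h'.k21 hs, h'.k22 hs]
  · intro w hw
    refine ⟨s w e1', s w e2', ?_⟩
    · rw [hL]
      simp [hw.e1, hw.e2, hw.f1, hw.f2]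

structure WInv (s : V →ₗ[F] V →ₗ[F] F) (e1 e2 f1 f2 : V) (A : V →ₗ[F] V) : Prop where
  ke1 : A e1 = 0
  ke2 : A e2 = 0
  kf1 : A f1 = 0
  kf2 : A f2 = 0
  r : ∀ v, InW s e1 e2 f1 f2 (A v)
  iso : ∀ v w, InW s e1 e2 f1 f2 v → InW s e1 e2 f1 f2 w → s (A v) (A w) = s v w
  sq : ∀ v, InW s e1 e2 f1 f2 v → A (A v) = v

theorem exists_swap {s : V →ₗ[F] V →ₗ[F] F} (hs : Symp s) {e1 e2 f1 f2 : V}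
    (h : Hyp s e1 e2 f1 f2) {A : V →ₗ[F] V} (hA : WInv s e1 e2 f1 f2 A) (c : F) (hc : c ≠ 0) :
    ∃ B : V →ₗ[F] V, SIso s B ∧ (∀ v, B (B v) = v) ∧ B e1 = c • f2 ∧ B e2 = -(c • f1) ∧
      B f1 = -(c⁻¹ • e2) ∧ B f2 = c⁻¹ • e1 ∧ ∀ w, InW s e1 e2 f1 f2 w → B w = A w := by
  let B : V →ₗ[F] V := (s.flip f1).smulRight (c • f2) - (s.flip f2).smulRight (c • f1)
    + (s.flip e1).smulRight (c⁻¹ • e2) - (s.flip e2).smulRight (c⁻¹ • e1) + A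
  have hB : ∀ v, B v = s v f1 • c • f2 - s v f2 • c • f1 + s v e1 • c⁻¹ • e2
      - s v e2 • c⁻¹ • e1 + A v := by
    intro v; simp [B]
  have b1 : B e1 = c • f2 := by
    rw [hB]; simp [hs.alt, h.e12, h.h11, h.h12, hA.ke1]
  have b2 : B e2 = -(c • f1) := by
    rw [hB]; simp [hs.alt, h.e21 hs, h.h21, h.h22, hA.ke2]
  have b3 : B f1 = -(c⁻¹ • e2) := by
    rw [hB]; simp [hs.alt, h.f12, h.k11 hs, h.k12 hs, hA.kf1]
  have b4 : B f2 = c⁻¹ • e1 := by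
    rw [hB]; simp [hs.alt, h.f21 hs, h.k21 hs, h.k22 hs, hA.kf2]
  have b5 : ∀ w, InW s e1 e2 f1 f2 w → B w = A w := by
    intro w hw
    rw [hB]; simp [hw.e1, hw.e2, hw.f1, hw.f2]
  have hAp : ∀ v, A v = A (prj s e1 e2 f1 f2 v) := by
    intro v
    conv_lhs => rw [decomp s e1 e2 f1 f2 v]
    simp [hA.ke1, hA.ke2, hA.kf1, hA.kf2]
  have r' : ∀ w, InW s e1 e2 f1 f2 w → s e1 w = 0 ∧ s e2 w = 0 ∧ s f1 w = 0 ∧ s f2 w = 0 := by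
    intro w hw
    rw [hs.anti e1, hs.anti e2, hs.anti f1, hs.anti f2, hw.e1, hw.e2, hw.f1, hw.f2]; simp
  refine ⟨B, ?_, ?_, b1, b2, b3, b4, b5⟩
  · intro v w
    have hAvw : s (A v) (A w) = s v w - s v f1 * s e1 w - s v f2 * s e2 w + s v e1 * s f1 w
        + s v e2 * s f2 w := by
      rw [hAp v, hAp w, hA.iso _ _ (prj_inW hs h v) (prj_inW hs h w)]
      have := prj_inW hs h w
      obtain ⟨q1, q2, q3, q4⟩ := r' _ this
      rw [prj_apply s e1 e2 f1 f2 v]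
      simp only [map_add, map_sub, map_smul, LinearMap.add_apply, LinearMap.sub_apply,
        LinearMap.smul_apply, smul_eq_mul, q1, q2, q3, q4]
      rw [prj_apply]
      simp only [map_add, map_sub, map_smul, smul_eq_mul, hs.anti e1 w, hs.anti e2 w,
        hs.anti f1 w, hs.anti f2 w]
      ring
    obtain ⟨q1, q2, q3, q4⟩ := r' _ (hA.r w)
    rw [hB, hB]
    simp only [map_add, map_sub, map_smul, LinearMap.add_apply, LinearMap.sub_apply,
      LinearMap.smul_apply, smul_eq_mul, hs.alt, h.e12, h.f12, h.h11, h.h12, h.h21, h.h22, h.e21 hs,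
      h.f21 hs, h.k11 hs, h.k12 hs, h.k21 hs, h.k22 hs, (hA.r v).e1, (hA.r v).e2, (hA.r v).f1,
      (hA.r v).f2, q1, q2, q3, q4, hAvw, hs.anti e1 w, hs.anti e2 w,
        hs.anti f1 w, hs.anti f2 w]
    field_simp
    ring
  · intro v
    refine ext_hyp hs h (S := B ∘ₗ B) (T := LinearMap.id) ?_ ?_ ?_ ?_ ?_ v
    · simp [b1, b4, hc]
    · simp [b2, b3, hc]
    · simp [b3, b2, hc]
    · simp [b4, b1, hc]
    · intro w hw
      simp [b5 w hw, b5 _ (hA.r w), hA.sq w hw]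

def I2 (s : V →ₗ[F] V →ₗ[F] F) (X : V →ₗ[F] V) : Prop :=
  ∃ A B : V →ₗ[F] V, SIso s A ∧ SIso s B ∧ (∀ x, A (A x) = x) ∧ (∀ x, B (B x) = x) ∧
    ∀ x, X x = A (B x)

theorem I2_conj {s : V →ₗ[F] V →ₗ[F] F} {X T G G' : V →ₗ[F] V} (hG : SIso s G) (hG' : SIso s G')
    (h1 : ∀ x, G (G' x) = x) (h2 : ∀ x, G' (G x) = x) (hT : I2 s T)
    (hX : ∀ x, X (G x) = G (T x)) : I2 s X := by
  obtain ⟨A, B, hA, hB, hAA, hBB, hAB⟩ := hT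
  refine ⟨G ∘ₗ A ∘ₗ G', G ∘ₗ B ∘ₗ G', ?_, ?_, ?_, ?_, ?_⟩
  · intro x y; simp [hG _ _, hA _ _, hG' _ _]
  · intro x y; simp [hG _ _, hB _ _, hG' _ _]
  · intro x; simp [h1, h2, hAA]
  · intro x; simp [h1, h2, hBB]
  · intro x
    have := hX (G' x)
    rw [h1] at this
    simp [this, h2, hAB]

theorem exists_diag {s : V →ₗ[F] V →ₗ[F] F} (hs : Symp s) {e1 e2 f1 f2 : V}
    (h : Hyp s e1 e2 f1 f2) {A B : V →ₗ[F] V} (hA : WInv s e1 e2 f1 f2 A)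
    (hB : WInv s e1 e2 f1 f2 B) (a : F) (ha : a ≠ 0) :
    ∃ D : V →ₗ[F] V, SIso s D ∧ I2 s D ∧ D e1 = a • e1 ∧ D e2 = a • e2 ∧ D f1 = a⁻¹ • f1 ∧
      D f2 = a⁻¹ • f2 ∧ ∀ w, InW s e1 e2 f1 f2 w → D w = A (B w) := by
  obtain ⟨K, k1, k2, k3, k4, k5, k6, k7⟩ := exists_swap hs h hA a⁻¹ (inv_ne_zero ha)
  obtain ⟨K', l1, l2, l3, l4, l5, l6, l7⟩ := exists_swap hs h hB 1 one_ne_zero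
  refine ⟨K ∘ₗ K', ?_, ⟨K, K', k1, l1, k2, l2, fun x => rfl⟩, ?_, ?_, ?_, ?_, ?_⟩
  · intro x y; simp [k1 _ _, l1 _ _]
  · simp [l3, k6]
  · simp [l4, k5]
  · simp [l5, k4]
  · simp [l6, k3]
  · intro w hw
    simp [l7 w hw, k7 _ (hB.r w)]

theorem lemC [FiniteDimensional F V] {s : V →ₗ[F] V →ₗ[F] F} (hs : Symp s) {e1 e2 f1 f2 : V}
    (h : Hyp s e1 e2 f1 f2) {A B Z : V →ₗ[F] V} (hA : WInv s e1 e2 f1 f2 A)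
    (hB : WInv s e1 e2 f1 f2 B) (hZ : SIso s Z) (c : F) (hc : c ≠ 0) (hc2 : c * c ≠ 1)
    (z1 : Z f1 = c • f1) (z2 : Z f2 = c • f2)
    (zw : ∀ w, InW s e1 e2 f1 f2 w → ∃ x y : F, Z w = A (B w) + x • f1 + y • f2)
    (hev : ∀ w, InW s e1 e2 f1 f2 w → A (B w) = c⁻¹ • w → w = 0) : I2 s Z := by
  have hci : c⁻¹ * c⁻¹ ≠ 1 := by
    intro h0; apply hc2; field_simp at h0; rw [← sq, ← h0]
  have hcc : c - c⁻¹ ≠ 0 := by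
    intro h0; apply hc2; field_simp at h0; linear_combination h0
  have zf1 : ∀ v, s (Z v) f1 = c⁻¹ * s v f1 := by
    intro v
    have := hZ v f1
    rw [z1, map_smul, smul_eq_mul] at this
    rw [← this]; field_simp
  have zf2 : ∀ v, s (Z v) f2 = c⁻¹ * s v f2 := by
    intro v
    have := hZ v f2
    rw [z2, map_smul, smul_eq_mul] at this
    rw [← this]; field_simp
  let R : Submodule F V := LinearMap.ker (s.flip f1) ⊓ LinearMap.ker (s.flip f2)
  have hR : ∀ v, v ∈ R ↔ s v f1 = 0 ∧ s v f2 = 0 := by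
    intro v; simp [R]
  let g : V →ₗ[F] V := Z - c⁻¹ • LinearMap.id
  have hg : ∀ v, g v = Z v - c⁻¹ • v := by intro v; simp [g]
  have hgR : ∀ v, g v ∈ R := by
    intro v
    rw [hR, hg]
    simp [zf1, zf2]
  let gR : R →ₗ[F] R := (g.domRestrict R).codRestrict R (fun v => hgR v)
  have hinj : Function.Injective gR := by
    rw [injective_iff_map_eq_zero]
    rintro ⟨v, hv⟩ h0
    have h1 : g v = 0 := congrArg Subtype.val h0
    rw [hR] at hv
    rw [hg] at h1
    have hd := decomp s e1 e2 f1 f2 v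
    rw [hv.1, hv.2] at hd
    obtain ⟨w, hw⟩ : ∃ w, w = prj s e1 e2 f1 f2 v := ⟨_, rfl⟩
    have hwW : InW s e1 e2 f1 f2 w := hw ▸ prj_inW hs h v
    rw [← hw] at hd
    obtain ⟨y1, hy1⟩ : ∃ y, y = s v e1 := ⟨_, rfl⟩
    obtain ⟨y2, hy2⟩ : ∃ y, y = s v e2 := ⟨_, rfl⟩
    rw [← hy1, ← hy2] at hd
    obtain ⟨x, y, hxy⟩ := zw w hwW
    rw [hd] at h1
    simp only [map_add, map_sub, map_smul, z1, z2, hxy, zero_smul, map_zero] at h1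
    have h2 : A (B w) - c⁻¹ • w = 0 := by
      refine inW_zero hs h (inW_add (hA.r _) hwW _) (x := (c - c⁻¹) * y1 - x)
        (y := (c - c⁻¹) * y2 - y) ?_
      linear_combination (norm := module) h1
    have h3 : w = 0 := hev w hwW (sub_eq_zero.1 h2)
    subst h3
    simp only [map_zero] at hxy
    have e1' : y1 = 0 := by
      have := congrArg (fun u => s u e1) h1
      have h4 := congrArg (fun u => s u e1) hxy
      simp [h.k11 hs, h.k21 hs] at this h4
      have h5 : (c - c⁻¹) * y1 = 0 := by linear_combination this + h4
      simpa [hcc] using h5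
    have e2' : y2 = 0 := by
      have := congrArg (fun u => s u e2) h1
      have h4 := congrArg (fun u => s u e2) hxy
      simp [h.k12 hs, h.k22 hs] at this h4
      have h5 : (c - c⁻¹) * y2 = 0 := by linear_combination this + h4
      simpa [hcc] using h5
    rw [e1', e2'] at hd
    simp at hd
    simp [hd]
  have hsurj : Function.Surjective gR := LinearMap.injective_iff_surjective.1 hinj
  have hex : ∀ e, ∃ u, s u f1 = 0 ∧ s u f2 = 0 ∧ Z (e - u) = c⁻¹ • (e - u) := by
    intro e
    obtain ⟨⟨u, hu⟩, hu2⟩ := hsurj ⟨g e, hgR e⟩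
    have h1 : g u = g e := congrArg Subtype.val hu2
    rw [hg, hg] at h1
    refine ⟨u, ((hR u).1 hu).1, ((hR u).1 hu).2, ?_⟩
    rw [map_sub]
    linear_combination (norm := module) -h1
  obtain ⟨u1, p1, p2, p3⟩ := hex e1
  obtain ⟨u2, q1, q2, q3⟩ := hex e2
  have h' : Hyp s (e1 - u1) (e2 - u2) f1 f2 := by
    refine ⟨?_, h.f12, ?_, ?_, ?_, ?_⟩
    · have := hZ (e1 - u1) (e2 - u2)
      rw [p3, q3, map_smul, map_smul, LinearMap.smul_apply, smul_eq_mul, smul_eq_mul] at this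
      have h5 : (c⁻¹ * c⁻¹ - 1) * s (e1 - u1) (e2 - u2) = 0 := by linear_combination this
      exact (mul_eq_zero.1 h5).resolve_left (sub_ne_zero.2 hci)
    · simp [p1, h.h11]
    · simp [p2, h.h12]
    · simp [q1, h.h21]
    · simp [q2, h.h22]
  obtain ⟨L, hL, L1, L2, L3, L4, Lw⟩ := exists_L hs h h'
  obtain ⟨L', hL', i1, i2⟩ := iso_inv hs hL
  obtain ⟨D, hD, hD2, d1, d2, d3, d4, dw⟩ := exists_diag hs h hA hB c⁻¹ (inv_ne_zero hc)
  refine I2_conj hL hL' i1 i2 hD2 ?_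
  intro x
  have hT : ∀ x, (L' ∘ₗ Z ∘ₗ L) x = D x := by
    have t1 : (L' ∘ₗ Z ∘ₗ L) e1 = c⁻¹ • e1 := by
      simp only [LinearMap.comp_apply, L1, p3, map_smul]
      rw [← L1, i2]
    have t2 : (L' ∘ₗ Z ∘ₗ L) e2 = c⁻¹ • e2 := by
      simp only [LinearMap.comp_apply, L2, q3, map_smul]
      rw [← L2, i2]
    have L3' : L' f1 = f1 := by conv_lhs => rw [← L3, i2]
    have L4' : L' f2 = f2 := by conv_lhs => rw [← L4, i2]
    have t3 : (L' ∘ₗ Z ∘ₗ L) f1 = c • f1 := by simp [L3, z1, L3']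
    have t4 : (L' ∘ₗ Z ∘ₗ L) f2 = c • f2 := by simp [L4, z2, L4']
    have hTi : SIso s (L' ∘ₗ Z ∘ₗ L) := by
      intro x y; simp [hL _ _, hL' _ _, hZ _ _]
    intro x
    refine ext_hyp hs h ?_ ?_ ?_ ?_ ?_ x
    · rw [t1, d1]
    · rw [t2, d2]
    · rw [t3, d3, inv_inv]
    · rw [t4, d4, inv_inv]
    · intro w hw
      have hTw : InW s e1 e2 f1 f2 ((L' ∘ₗ Z ∘ₗ L) w) := by
        constructor
        · have := hTi w e1
          rw [t1, hw.e1, map_smul] at this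
          simpa [hc] using this
        · have := hTi w e2
          rw [t2, hw.e2, map_smul] at this
          simpa [hc] using this
        · have := hTi w f1
          rw [t3, hw.f1, map_smul] at this
          simpa [hc] using this
        · have := hTi w f2
          rw [t4, hw.f2, map_smul] at this
          simpa [hc] using this
      rw [dw w hw]
      obtain ⟨x1, y1, r1⟩ := Lw w hw
      obtain ⟨x2, y2, r2⟩ := zw w hw
      obtain ⟨x3, y3, r3⟩ := Lw _ (hA.r (B w))
      have r4 : L' (A (B w)) = A (B w) - x3 • f1 - y3 • f2 := by
        have := i2 (A (B w))
        rw [r3] at this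
        simp only [map_add, map_smul, L3', L4'] at this
        linear_combination (norm := module) this
      have r5 : (L' ∘ₗ Z ∘ₗ L) w = A (B w) + (x2 + x1 * c - x3) • f1 + (y2 + y1 * c - y3) • f2 := by
        simp only [LinearMap.comp_apply, r1, map_add, map_smul, r2, z1, z2, L3', L4', r4]
        module
      have r6 := inW_zero hs h (inW_add hTw (hA.r (B w)) 1) (x := x2 + x1 * c - x3)
        (y := y2 + y1 * c - y3) (by rw [r5]; module)
      rw [one_smul] at r6
      exact sub_eq_zero.1 r6
  have := congrArg L (hT x)
  simpa [i1] using this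

theorem Hyp.swap {s : V →ₗ[F] V →ₗ[F] F} (hs : Symp s) {e1 e2 f1 f2 : V}
    (h : Hyp s e1 e2 f1 f2) : Hyp s f1 f2 (-e1) (-e2) := by
  constructor <;> simp [h.f12, h.e12, h.k11 hs, h.k12 hs, h.k21 hs, h.k22 hs]

theorem inW_swap {s : V →ₗ[F] V →ₗ[F] F} {e1 e2 f1 f2 v : V} :
    InW s f1 f2 (-e1) (-e2) v ↔ InW s e1 e2 f1 f2 v := by
  constructor
  · intro h
    have h1 := h.f1
    have h2 := h.f2
    simp at h1 h2
    exact ⟨h1, h2, h.e1, h.e2⟩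
  · intro h
    exact ⟨h.f1, h.f2, by simp [h.e1], by simp [h.e2]⟩

theorem WInv.swap {s : V →ₗ[F] V →ₗ[F] F} {e1 e2 f1 f2 : V} {A : V →ₗ[F] V}
    (h : WInv s e1 e2 f1 f2 A) : WInv s f1 f2 (-e1) (-e2) A := by
  refine ⟨h.kf1, h.kf2, by simp [h.ke1], by simp [h.ke2], fun v => inW_swap.2 (h.r v), ?_, ?_⟩
  · intro v w hv hw
    exact h.iso v w (inW_swap.1 hv) (inW_swap.1 hw)
  · intro v hv
    exact h.sq v (inW_swap.1 hv)

end
end SympFour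

namespace SympFour
section

def I4 {F V : Type*} [Field F] [AddCommGroup V] [Module F V] (s : V →ₗ[F] V →ₗ[F] F)
    (M : V →ₗ[F] V) : Prop := ∃ X Y : V →ₗ[F] V, I2 s X ∧ I2 s Y ∧ ∀ x, M x = X (Y x)

theorem exists_a {F V : Type*} [Field F] [Infinite F] [AddCommGroup V] [Module F V]
    [FiniteDimensional F V] (S T : V →ₗ[F] V) (d : F) (hd : d ≠ 0) :
    ∃ a : F, a ≠ 0 ∧ a * a ≠ 1 ∧ (d / a) * (d / a) ≠ 1 ∧ (∀ w, S w = a • w → w = 0) ∧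
      (∀ w, T w = (d / a)⁻¹ • w → w = 0) := by
  have f1 : Set.Finite {μ | Module.End.HasEigenvalue S μ} := Module.End.finite_hasEigenvalue S
  have f2 : Set.Finite {μ | Module.End.HasEigenvalue T μ} := Module.End.finite_hasEigenvalue T
  have f3 := f2.image (fun x => d * x)
  have f4 : Set.Finite ({0, 1, -1, d, -d} : Set F) := Set.toFinite _
  obtain ⟨a, ha⟩ := ((f1.union f3).union f4).infinite_compl.nonempty
  simp only [Set.mem_compl_iff, Set.mem_union, not_or, Set.mem_insert_iff,
    Set.mem_singleton_iff] at ha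
  obtain ⟨⟨h1, h2⟩, h3, h4, h5, h6, h7⟩ := ha
  refine ⟨a, h3, ?_, ?_, ?_, ?_⟩
  · intro h
    rcases mul_self_eq_one_iff.1 h with h | h
    · exact h4 h
    · exact h5 h
  · intro h
    rcases mul_self_eq_one_iff.1 h with h | h
    · field_simp at h; exact h6 h.symm
    · field_simp at h; apply h7; rw [h]; simp
  · intro w hw
    by_contra hw0
    exact h1 (Module.End.hasEigenvalue_of_hasEigenvector
      (Module.End.hasEigenvector_iff.2 ⟨Module.End.mem_eigenspace_iff.2 hw, hw0⟩))
  · intro w hw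
    by_contra hw0
    refine h2 ⟨(d / a)⁻¹, (Module.End.hasEigenvalue_of_hasEigenvector
      (Module.End.hasEigenvector_iff.2 ⟨Module.End.mem_eigenspace_iff.2 hw, hw0⟩)), ?_⟩
    show d * (d / a)⁻¹ = a
    field_simp

theorem step {F V : Type*} [Field F] [Infinite F] [AddCommGroup V] [Module F V]
    [FiniteDimensional F V] {s : V →ₗ[F] V →ₗ[F] F} (hs : Symp s) {M L N : V →ₗ[F] V}
    (hM : SIso s M) (hL : SIso s L)
    {e1 e2 f1 f2 : V} (h : Hyp s e1 e2 f1 f2) (d : F) (hd : d ≠ 0)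
    (hLN : ∀ x, M x = L (N x)) (L3 : L f1 = f1) (L4 : L f2 = f2)
    (Lw : ∀ w, InW s e1 e2 f1 f2 w → ∃ x y : F, L w = w + x • f1 + y • f2)
    (N1 : N e1 = d • e1) (N2 : N e2 = d • e2) {A1 A2 A3 A4 : V →ₗ[F] V}
    (hA1 : WInv s e1 e2 f1 f2 A1) (hA2 : WInv s e1 e2 f1 f2 A2)
    (hA3 : WInv s e1 e2 f1 f2 A3) (hA4 : WInv s e1 e2 f1 f2 A4)
    (Nw : ∀ w, InW s e1 e2 f1 f2 w → ∃ x y : F, N w = A1 (A2 (A3 (A4 w))) + x • e1 + y • e2) :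
    I4 s M := by
  obtain ⟨a, a0, a1, a2, a3, a4⟩ := exists_a (A1 ∘ₗ A2) (A3 ∘ₗ A4) d hd
  obtain ⟨D, hD, hD2, d1, d2, d3, d4, dw⟩ := exists_diag hs h hA1 hA2 a a0
  obtain ⟨D', hD', i1, i2⟩ := iso_inv hs hD
  have hN : SIso s N := by
    intro x y
    rw [← hL, ← hLN, ← hLN, hM]
  have hda : d / a ≠ 0 := div_ne_zero hd a0
  have d1' : D' e1 = a⁻¹ • e1 := by
    have := i2 e1
    rw [d1, map_smul] at this
    rw [← this, smul_smul, inv_mul_cancel₀ a0, one_smul, this]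
  have d2' : D' e2 = a⁻¹ • e2 := by
    have := i2 e2
    rw [d2, map_smul] at this
    rw [← this, smul_smul, inv_mul_cancel₀ a0, one_smul, this]
  refine ⟨L ∘ₗ D, D' ∘ₗ N, ?_, ?_, ?_⟩
  · refine lemC hs h hA1 hA2 ?_ a⁻¹ (inv_ne_zero a0) ?_ ?_ ?_ ?_ ?_
    · intro x y; simp [hL _ _, hD _ _]
    · intro h0; apply a1; field_simp at h0; rw [← sq, ← h0]
    · simp [d3, L3]
    · simp [d4, L4]
    · intro w hw
      obtain ⟨x, y, hxy⟩ := Lw _ (hA1.r (A2 w))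
      exact ⟨x, y, by simp [dw w hw, hxy]⟩
    · intro w hw h0
      apply a3
      simpa using h0
  · refine lemC hs (h.swap hs) hA3.swap hA4.swap ?_ (d / a) hda a2 ?_ ?_ ?_ ?_
    · intro x y; simp [hD' _ _, hN _ _]
    · simp [N1, d1', smul_smul, div_eq_mul_inv]
    · simp [N2, d2', smul_smul, div_eq_mul_inv]
    · intro w hw
      obtain ⟨x, y, hxy⟩ := Nw w (inW_swap.1 hw)
      refine ⟨-(x * a⁻¹), -(y * a⁻¹), ?_⟩
      have h1 : D' (A1 (A2 (A3 (A4 w)))) = A3 (A4 w) := by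
        rw [← dw _ (hA3.r _), i2]
      simp only [LinearMap.comp_apply, hxy, map_add, map_smul, h1, d1', d2']
      module
    · intro w hw h0
      exact a4 w h0
  · intro x
    simp [i1, hLN]

theorem main4 {F : Type*} [Field F] [Infinite F] (k : ℕ) : ∀ (V : Type*) [AddCommGroup V]
    [Module F V] [FiniteDimensional F V] (s : V →ₗ[F] V →ₗ[F] F) (M : V →ₗ[F] V),
    Symp s → SIso s M → Module.finrank F V = 4 * k → I4 s M := by
  induction k with
  | zero =>
    intro V _ _ _ s M hs hM hf
    have : Subsingleton V := Module.finrank_zero_iff.1 (by simpa using hf)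
    have h1 : I2 s LinearMap.id := ⟨LinearMap.id, LinearMap.id, fun _ _ => rfl, fun _ _ => rfl,
      fun _ => rfl, fun _ => rfl, fun _ => rfl⟩
    exact ⟨LinearMap.id, LinearMap.id, h1, h1, fun x => Subsingleton.elim _ _⟩
  | succ k ih =>
    intro V _ _ _ s M hs hM hf
    by_cases hM2 : ∀ x, M (M x) = x
    · have h1 : I2 s LinearMap.id := ⟨LinearMap.id, LinearMap.id, fun _ _ => rfl, fun _ _ => rfl,
        fun _ => rfl, fun _ => rfl, fun _ => rfl⟩
      exact ⟨M, LinearMap.id, ⟨M, LinearMap.id, hM, fun _ _ => rfl, hM2, fun _ => rfl,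
        fun _ => rfl⟩, h1, fun x => rfl⟩
    obtain ⟨e1, e2, f1, f2, d, hd, h, m11, m12, m21, m22⟩ := good hs (by omega) hM hM2
    have h' : Hyp s (d⁻¹ • M e1) (d⁻¹ • M e2) f1 f2 := by
      refine ⟨?_, h.f12, ?_, ?_, ?_, ?_⟩
      · simp [hM _ _, h.e12]
      · simp [m11, hd]
      · simp [m12]
      · simp [m21]
      · simp [m22, hd]
    obtain ⟨L, hL, L1, L2, L3, L4, Lw⟩ := exists_L hs h h'
    obtain ⟨L', hL', i1, i2⟩ := iso_inv hs hL
    let N : V →ₗ[F] V := L' ∘ₗ M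
    have hN : SIso s N := by intro x y; simp [N, hL' _ _, hM _ _]
    have N1 : N e1 = d • e1 := by
      have : M e1 = d • (L e1) := by rw [L1, smul_smul, mul_inv_cancel₀ hd, one_smul]
      simp [N, this, i2]
    have N2 : N e2 = d • e2 := by
      have : M e2 = d • (L e2) := by rw [L2, smul_smul, mul_inv_cancel₀ hd, one_smul]
      simp [N, this, i2]
    let W : Submodule F V := LinearMap.range (prj s e1 e2 f1 f2)
    have hW : ∀ v, v ∈ W → InW s e1 e2 f1 f2 v := by
      rintro v ⟨u, rfl⟩; exact prj_inW hs h u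
    have hW' : ∀ v, InW s e1 e2 f1 f2 v → v ∈ W := fun v hv => ⟨v, prj_of_inW hv⟩
    let π : V →ₗ[F] W := (prj s e1 e2 f1 f2).rangeRestrict
    have hπ : ∀ v, (π v : V) = prj s e1 e2 f1 f2 v := fun v => rfl
    have hπW : ∀ w : W, π (w : V) = w := fun w => Subtype.ext (prj_of_inW (hW _ w.2))
    let sW : W →ₗ[F] W →ₗ[F] F := s.compl₁₂ W.subtype W.subtype
    have hsW : ∀ x y : W, sW x y = s x y := fun x y => rfl
    have orth : ∀ (w : W) (v : V), s w v = s w (π v) := by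
      intro w v
      have := hW _ w.2
      rw [hπ, prj_apply]
      simp [this.e1, this.e2, this.f1, this.f2]
    have hsympW : Symp sW := by
      refine ⟨fun x => hs.alt _, ?_⟩
      intro x hx
      apply Subtype.ext
      apply hs.nd
      intro y
      rw [orth]; exact hx (π y)
    have Nw : ∀ w, InW s e1 e2 f1 f2 w →
        N w = (π (N w) : V) + s (N w) f1 • e1 + s (N w) f2 • e2 := by
      intro w hw
      have q1 : s (N w) e1 = 0 := by
        have := hN w e1
        rw [N1, hw.e1, map_smul] at this
        simpa [hd] using this
      have q2 : s (N w) e2 = 0 := by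
        have := hN w e2
        rw [N2, hw.e2, map_smul] at this
        simpa [hd] using this
      rw [hπ, prj_apply, q1, q2]; module
    let M' : W →ₗ[F] W := π ∘ₗ N ∘ₗ W.subtype
    have hM' : SIso sW M' := by
      intro x y
      have h1 := hW _ (π (N x)).2
      have h2 : s (π (N x)) (π (N y)) = s (N x) (π (N y)) := by
        have h3 := hW _ (π (N y)).2
        conv_rhs => rw [Nw x (hW _ x.2)]
        simp [hs.anti e1, hs.anti e2, h3.e1, h3.e2]
      show s (π (N x)) (π (N y)) = s x y
      rw [← orth, ← hN x y]
      have q1 : s e1 (N y) = 0 := by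
        have := hN e1 y
        rw [N1, hs.anti e1 y, (hW _ y.2).e1, map_smul] at this
        simpa [hd] using this
      have q2 : s e2 (N y) = 0 := by
        have := hN e2 y
        rw [N2, hs.anti e2 y, (hW _ y.2).e2, map_smul] at this
        simpa [hd] using this
      conv_rhs => rw [Nw x (hW _ x.2)]
      simp [q1, q2]
    have hfW : Module.finrank F W = 4 * k := by
      let Φ : V →ₗ[F] W × F × F × F × F :=
        π.prod ((s.flip f1).prod ((s.flip f2).prod ((s.flip e1).prod (s.flip e2))))
      have hΦ : ∀ v, Φ v = (π v, s v f1, s v f2, s v e1, s v e2) := fun v => rfl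
      have hbij : Function.Bijective Φ := by
        constructor
        · rw [injective_iff_map_eq_zero]
          intro v hv
          rw [hΦ] at hv
          simp only [Prod.mk_eq_zero] at hv
          obtain ⟨h0, h1, h2, h3, h4⟩ := hv
          rw [decomp s e1 e2 f1 f2 v, h1, h2, h3, h4, ← hπ, h0]
          simp
        · rintro ⟨w, a, b, c, e⟩
          have hw := hW _ w.2
          refine ⟨a • e1 + b • e2 - c • f1 - e • f2 + w, ?_⟩
          rw [hΦ]
          refine Prod.ext (Subtype.ext ?_) (Prod.ext ?_ (Prod.ext ?_ (Prod.ext ?_ ?_)))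
          · rw [hπ, prj_apply]
            simp only [map_add, map_sub, map_smul, LinearMap.add_apply, LinearMap.sub_apply,
              LinearMap.smul_apply, smul_eq_mul, hs.alt, h.e12, h.f12, h.h11, h.h12, h.h21, h.h22,
              h.e21 hs, h.f21 hs, h.k11 hs, h.k12 hs, h.k21 hs, h.k22 hs, hw.e1, hw.e2, hw.f1,
              hw.f2]
            module
          all_goals
            simp [hs.alt, h.e12, h.f12, h.h11, h.h12, h.h21, h.h22,
              h.e21 hs, h.f21 hs, h.k11 hs, h.k12 hs, h.k21 hs, h.k22 hs, hw.e1, hw.e2, hw.f1,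
              hw.f2]
      have := (LinearEquiv.ofBijective Φ hbij).finrank_eq
      simp at this
      omega
    obtain ⟨X, Y, ⟨A1, A2, a1, a2, a3, a4, a5⟩, ⟨A3, A4, b1, b2, b3, b4, b5⟩, hXY⟩ :=
      ih W sW M' hsympW hM' hfW
    have zz : ∀ {v}, prj s e1 e2 f1 f2 v = 0 → π v = 0 := fun hv => Subtype.ext hv
    have ext : ∀ A : W →ₗ[F] W, SIso sW A → (∀ x, A (A x) = x) →
        WInv s e1 e2 f1 f2 (W.subtype ∘ₗ A ∘ₗ π) := by
      intro A hA hA2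
      refine ⟨?_, ?_, ?_, ?_, fun v => hW _ (A (π v)).2, ?_, ?_⟩
      · have : π e1 = 0 := zz (by rw [prj_apply]; simp [hs.alt, h.e12, h.h11, h.h12])
        simp [this]
      · have : π e2 = 0 := zz (by rw [prj_apply]; simp [hs.alt, h.e21 hs, h.h21, h.h22])
        simp [this]
      · have : π f1 = 0 := zz (by rw [prj_apply]; simp [hs.alt, h.f12, h.k11 hs, h.k12 hs])
        simp [this]
      · have : π f2 = 0 := zz (by rw [prj_apply]; simp [hs.alt, h.f21 hs, h.k21 hs, h.k22 hs])
        simp [this]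
      · intro v w hv hw
        have := hA (π v) (π w)
        rw [hsW, hsW, hπ, hπ, prj_of_inW hv, prj_of_inW hw] at this
        exact this
      · intro v hv
        show ((A (π (A (π v) : V)) : W) : V) = v
        rw [hπW, hA2, hπ, prj_of_inW hv]
    refine step hs hM hL h d hd (N := N) (fun x => (i1 _).symm) L3 L4 Lw N1 N2 (ext A1 a1 a3)
      (ext A2 a2 a4) (ext A3 b1 b3) (ext A4 b2 b4) ?_
    intro w hw
    refine ⟨s (N w) f1, s (N w) f2, ?_⟩
    refine (Nw w hw).trans ?_
    congr 2
    have h1 := hXY ⟨w, hW' w hw⟩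
    rw [a5, b5] at h1
    have h2 : π w = ⟨w, hW' w hw⟩ := hπW ⟨w, hW' w hw⟩
    have h3 := congrArg Subtype.val h1
    simp only [LinearMap.comp_apply, Submodule.subtype_apply, hπW, h2]
    exact h3

end
end SympFour

open Matrix in
/-- If `F` is an infinite field of characteristic not 2 and `m` is a positive even
integer, then every element of the symplectic group `Sp_{2m}(F)` is a product of four
involutions of `Sp_{2m}(F)`. -/
theorem symplectic_product_of_four_involutions
    (F : Type*) [Field F] [Infinite F] (hF : ringChar F ≠ 2)
    (m : ℕ) (hm : 0 < m) (hmeven : Even m)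
    (M : Matrix (Fin m ⊕ Fin m) (Fin m ⊕ Fin m) F)
    (hM : M ∈ Matrix.symplecticGroup (Fin m) F) :
    ∃ A₁ A₂ A₃ A₄ : Matrix (Fin m ⊕ Fin m) (Fin m ⊕ Fin m) F,
      A₁ ∈ Matrix.symplecticGroup (Fin m) F ∧
      A₂ ∈ Matrix.symplecticGroup (Fin m) F ∧
      A₃ ∈ Matrix.symplecticGroup (Fin m) F ∧
      A₄ ∈ Matrix.symplecticGroup (Fin m) F ∧
      A₁ ^ 2 = 1 ∧ A₂ ^ 2 = 1 ∧ A₃ ^ 2 = 1 ∧ A₄ ^ 2 = 1 ∧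
      M = A₁ * A₂ * A₃ * A₄ := by
  let s : (Fin m ⊕ Fin m → F) →ₗ[F] (Fin m ⊕ Fin m → F) →ₗ[F] F :=
    Matrix.toLinearMap₂' F (Matrix.J (Fin m) F)
  have hsa : ∀ x y, s x y = x ⬝ᵥ (Matrix.J (Fin m) F *ᵥ y) := fun x y =>
    Matrix.toLinearMap₂'_apply' _ _ _
  have hsing : ∀ i j, s (Pi.single i 1) (Pi.single j 1) = Matrix.J (Fin m) F i j := by
    intro i j
    rw [hsa]; simp
  have hs : SympFour.Symp s := by
    constructor
    · intro x
      have h1 : s x x = - s x x := by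
        conv_lhs => rw [hsa, Matrix.dotProduct_mulVec, ← Matrix.mulVec_transpose, Matrix.J_transpose,
          dotProduct_comm, Matrix.neg_mulVec, dotProduct_neg, ← hsa]
      have h2 : (2 : F) * s x x = 0 := by linear_combination h1
      exact (mul_eq_zero.1 h2).resolve_left (Ring.two_ne_zero hF)
    · intro x hx
      have : x ᵥ* Matrix.J (Fin m) F = 0 := by
        ext i
        have := hx (Pi.single i 1)
        rw [hsa, Matrix.dotProduct_mulVec] at this
        simpa using this
      have h2 := congrArg (fun v => v ᵥ* Matrix.J (Fin m) F) this
      simp only [Matrix.vecMul_vecMul, Matrix.J_squared, Matrix.zero_vecMul] at h2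
      simpa [Matrix.vecMul_neg] using h2
  have key : ∀ A : Matrix (Fin m ⊕ Fin m) (Fin m ⊕ Fin m) F,
      A ∈ Matrix.symplecticGroup (Fin m) F ↔ SympFour.SIso s (Matrix.toLin' A) := by
    intro A
    rw [SymplecticGroup.mem_iff']
    have h1 : ∀ x y, s (Matrix.toLin' A x) (Matrix.toLin' A y) =
        x ⬝ᵥ ((Aᵀ * Matrix.J (Fin m) F * A) *ᵥ y) := by
      intro x y
      rw [hsa, Matrix.toLin'_apply, Matrix.toLin'_apply, ← Matrix.vecMul_transpose,
        ← Matrix.dotProduct_mulVec, Matrix.mulVec_mulVec, Matrix.mulVec_mulVec]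
    constructor
    · intro h x y
      rw [h1, h, hsa]
    · intro h
      ext i j
      have := h (Pi.single i 1) (Pi.single j 1)
      rw [h1, hsing] at this
      simpa using this
  obtain ⟨k, hk⟩ := hmeven
  obtain ⟨X, Y, ⟨A1, A2, a1, a2, a3, a4, a5⟩, ⟨A3, A4, b1, b2, b3, b4, b5⟩, hXY⟩ :=
    SympFour.main4 k _ s (Matrix.toLin' M) hs ((key M).1 hM) (by simp; omega)
  have hsq : ∀ A : (Fin m ⊕ Fin m → F) →ₗ[F] (Fin m ⊕ Fin m → F), (∀ x, A (A x) = x) →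
      (LinearMap.toMatrix' A) ^ 2 = 1 := by
    intro A hA
    rw [sq, ← LinearMap.toMatrix'_comp]
    have : A ∘ₗ A = LinearMap.id := LinearMap.ext hA
    rw [this, LinearMap.toMatrix'_id]
  refine ⟨LinearMap.toMatrix' A1, LinearMap.toMatrix' A2, LinearMap.toMatrix' A3,
    LinearMap.toMatrix' A4, ?_, ?_, ?_, ?_, hsq _ a3, hsq _ a4, hsq _ b3, hsq _ b4, ?_⟩
  · rw [key, Matrix.toLin'_toMatrix']; exact a1
  · rw [key, Matrix.toLin'_toMatrix']; exact a2
  · rw [key, Matrix.toLin'_toMatrix']; exact b1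
  · rw [key, Matrix.toLin'_toMatrix']; exact b2
  · apply Matrix.toLin'.injective
    rw [← LinearMap.toMatrix'_comp, ← LinearMap.toMatrix'_comp, ← LinearMap.toMatrix'_comp,
      Matrix.toLin'_toMatrix']
    apply LinearMap.ext
    intro x
    rw [hXY, a5, b5]; rfl
end

section
/- Let F be an infinite field of characteristic not 2 and let m be an odd integer with m ≥ 3. Then every element M of the symplectic group Sp_{2m}(F) is a product of five involutions of Sp_{2m}(F); that is, there exist matrices A1, ..., A5 in Sp_{2m}(F) with Ai^2 = 1 for each i and M = A1*A2*A3*A4*A5. -/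
universe u



namespace SympInv

section basic
variable {F : Type u} [Field F]

structure Sy {V : Type u} [AddCommGroup V] [Module F V] (b : V →ₗ[F] V →ₗ[F] F) : Prop where
  alt : ∀ x, b x x = 0
  nd : ∀ x, (∀ y, b x y = 0) → x = 0

def Iso {V : Type u} [AddCommGroup V] [Module F V] (b : V →ₗ[F] V →ₗ[F] F) (f : V →ₗ[F] V) : Prop :=
  ∀ x y, b (f x) (f y) = b x y

def Inv {V : Type u} [AddCommGroup V] [Module F V] (b : V →ₗ[F] V →ₗ[F] F) (f : V →ₗ[F] V) : Prop :=
  Iso b f ∧ ∀ x, f (f x) = x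

def PI {V : Type u} [AddCommGroup V] [Module F V] (b : V →ₗ[F] V →ₗ[F] F) : ℕ → (V →ₗ[F] V) → Prop
  | 0, f => f = LinearMap.id
  | k + 1, f => ∃ g h, Inv b g ∧ PI b k h ∧ f = g ∘ₗ h

variable {V : Type u} [AddCommGroup V] [Module F V] {b : V →ₗ[F] V →ₗ[F] F}
variable {V' : Type u} [AddCommGroup V'] [Module F V'] {b' : V' →ₗ[F] V' →ₗ[F] F}

theorem Sy.neg (h : Sy b) (x y : V) : b x y = - b y x := by
  have := h.alt (x + y)
  simp [h.alt] at this
  linear_combination this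

theorem Sy.nd' (h : Sy b) (x : V) (hx : ∀ y, b y x = 0) : x = 0 :=
  h.nd x fun y => by rw [h.neg, hx, neg_zero]

theorem Sy.riesz [FiniteDimensional F V] (h : Sy b) (φ : V →ₗ[F] F) : ∃ x, ∀ y, b y x = φ y := by
  have hi : Function.Injective b := by
    rw [← LinearMap.ker_eq_bot, LinearMap.ker_eq_bot']
    intro x hx
    exact h.nd x fun y => by rw [hx]; rfl
  have hs := (LinearMap.injective_iff_surjective_of_finrank_eq_finrank
    (f := b) (Subspace.dual_finrank_eq (K := F) (V := V)).symm).1 hi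
  obtain ⟨x, hx⟩ := hs (-φ)
  exact ⟨x, fun y => by rw [h.neg, hx]; simp⟩

theorem Inv.id : Inv b LinearMap.id := ⟨fun _ _ => rfl, fun _ => rfl⟩

theorem Iso.comp {f g : V →ₗ[F] V} (hf : Iso b f) (hg : Iso b g) : Iso b (f ∘ₗ g) := fun x y => by
  simp [hf (g x) (g y), hg x y]

theorem Iso.inj (h : Sy b) {f : V →ₗ[F] V} (hf : Iso b f) : Function.Injective f := by
  rw [← LinearMap.ker_eq_bot, LinearMap.ker_eq_bot']
  intro x hx
  exact h.nd x fun y => by rw [← hf, hx]; simp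

theorem PI.iso : ∀ {k : ℕ} {f : V →ₗ[F] V}, PI b k f → Iso b f
  | 0, f, h => by rw [show f = LinearMap.id from h]; exact Inv.id.1
  | k + 1, f, ⟨g, h, hg, hh, e⟩ => by rw [e]; exact hg.1.comp hh.iso

theorem PI.comp : ∀ {k l : ℕ} {f g : V →ₗ[F] V}, PI b k f → PI b l g → PI b (l + k) (f ∘ₗ g)
  | 0, l, f, g, h, h' => by rw [show f = LinearMap.id from h]; exact h'
  | k + 1, l, f, g, ⟨a, c, hg, hh, e⟩, h' => ⟨a, c ∘ₗ g, hg, hh.comp h', by rw [e]; rfl⟩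

theorem PI.split : ∀ {k l : ℕ} {f : V →ₗ[F] V}, PI b (l + k) f →
    ∃ g h, PI b k g ∧ PI b l h ∧ f = g ∘ₗ h
  | 0, l, f, h => ⟨LinearMap.id, f, rfl, h, rfl⟩
  | k + 1, l, f, ⟨a, c, hg, hh, e⟩ => by
    obtain ⟨g, h, h1, h2, h3⟩ := PI.split hh
    exact ⟨a ∘ₗ g, h, ⟨a, g, hg, h1, rfl⟩, h2, by rw [e, h3]; rfl⟩

theorem Inv.pi {f : V →ₗ[F] V} (h : Inv b f) : PI b 1 f := ⟨f, LinearMap.id, h, rfl, rfl⟩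

theorem PI.one (k : ℕ) : PI b k LinearMap.id := by
  induction k with
  | zero => rfl
  | succ k ih => exact ⟨_, _, Inv.id, ih, rfl⟩

theorem PI.mono {k l : ℕ} (hkl : k ≤ l) {f : V →ₗ[F] V} (h : PI b k f) : PI b l f := by
  obtain ⟨d, rfl⟩ := Nat.exists_eq_add_of_le hkl
  have := (PI.one (b := b) d).comp h
  exact this

theorem PI.equiv (e : V' ≃ₗ[F] V) (he : ∀ x y, b (e x) (e y) = b' x y) :
    ∀ {k : ℕ} {f' : V' →ₗ[F] V'} {f : V →ₗ[F] V}, (∀ x, f (e x) = e (f' x)) → PI b' k f' → PI b k f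
  | 0, f', f, h, hf => by
    have : f' = LinearMap.id := hf
    subst this
    show f = LinearMap.id
    ext x
    have := h (e.symm x)
    simpa using this
  | k + 1, f', f, h, ⟨g, c, hg, hc, e'⟩ => by
    refine ⟨e.toLinearMap ∘ₗ g ∘ₗ e.symm.toLinearMap, e.toLinearMap ∘ₗ c ∘ₗ e.symm.toLinearMap,
      ⟨?_, ?_⟩, PI.equiv e he (fun x => by simp) hc, ?_⟩
    · intro x y
      simp [he, hg.1 _ _]
      rw [← he]; simp
    · intro x; simp [hg.2]
    · ext x
      have := h (e.symm x)
      simpa [e'] using this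

def bp (b : V →ₗ[F] V →ₗ[F] F) (b' : V' →ₗ[F] V' →ₗ[F] F) : (V × V') →ₗ[F] (V × V') →ₗ[F] F :=
  b.compl₁₂ (LinearMap.fst F V V') (LinearMap.fst F V V') +
    b'.compl₁₂ (LinearMap.snd F V V') (LinearMap.snd F V V')

@[simp] theorem bp_apply (x y : V × V') : bp b b' x y = b x.1 y.1 + b' x.2 y.2 := rfl

theorem PI.prod : ∀ {k : ℕ} {f : V →ₗ[F] V} {f' : V' →ₗ[F] V'},
    PI b k f → PI b' k f' → PI (bp b b') k (f.prodMap f')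
  | 0, f, f', h, h' => by
    rw [show f = LinearMap.id from h, show f' = LinearMap.id from h']
    exact LinearMap.prodMap_id
  | k + 1, f, f', ⟨g, c, hg, hc, e⟩, ⟨g', c', hg', hc', e'⟩ => by
    refine ⟨g.prodMap g', c.prodMap c', ⟨?_, ?_⟩, hc.prod hc', ?_⟩
    · intro x y; simp [hg.1 _ _, hg'.1 _ _]
    · intro x; simp [hg.2, hg'.2]
    · subst e e'; rfl

def om (F : Type u) [Field F] (n : ℕ) : ((Fin n → F) × (Fin n → F)) →ₗ[F] ((Fin n → F) × (Fin n → F)) →ₗ[F] F :=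
  LinearMap.mk₂ F (fun x y => x.1 ⬝ᵥ y.2 - x.2 ⬝ᵥ y.1)
    (by intros; simp [add_dotProduct]; ring) (by intros; simp; ring)
    (by intros; simp [dotProduct_add]; ring) (by intros; simp; ring)

@[simp] theorem om_apply (n : ℕ) (x y : (Fin n → F) × (Fin n → F)) :
    om F n x y = x.1 ⬝ᵥ y.2 - x.2 ⬝ᵥ y.1 := rfl

structure Dec (b : V →ₗ[F] V →ₗ[F] F) (b' : V' →ₗ[F] V' →ₗ[F] F) {n : ℕ} (e f : Fin n → V)
    (j : V' →ₗ[F] V) : Prop where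
  ee : ∀ i k, b (e i) (e k) = 0
  ff : ∀ i k, b (f i) (f k) = 0
  ef : ∀ i k, b (e i) (f k) = if i = k then 1 else 0
  ej : ∀ i v, b (e i) (j v) = 0
  fj : ∀ i v, b (f i) (j v) = 0
  jj : ∀ v w, b (j v) (j w) = b' v w

variable {n : ℕ} {e f : Fin n → V} {j : V' →ₗ[F] V}

def Phi (e f : Fin n → V) (j : V' →ₗ[F] V) : ((Fin n → F) × (Fin n → F)) × V' →ₗ[F] V :=
  ((Fintype.linearCombination F e).coprod (Fintype.linearCombination F f)).coprod j

theorem Phi_apply (x : ((Fin n → F) × (Fin n → F)) × V') :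
    Phi e f j x = (∑ i, x.1.1 i • e i) + (∑ i, x.1.2 i • f i) + j x.2 := by
  simp [Phi, Fintype.linearCombination_apply]

theorem Dec.fe (h : Dec b b' e f j) (hb : Sy b) (i k : Fin n) :
    b (f i) (e k) = if i = k then -1 else 0 := by
  rw [hb.neg, h.ef]; by_cases hh : i = k <;> simp [hh, eq_comm]

theorem Dec.je (h : Dec b b' e f j) (hb : Sy b) (i : Fin n) (v : V') : b (j v) (e i) = 0 := by
  rw [hb.neg, h.ej, neg_zero]
theorem Dec.jf (h : Dec b b' e f j) (hb : Sy b) (i : Fin n) (v : V') : b (j v) (f i) = 0 := by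
  rw [hb.neg, h.fj, neg_zero]

theorem Dec.iso (h : Dec b b' e f j) (hb : Sy b) (x y : ((Fin n → F) × (Fin n → F)) × V') :
    b (Phi e f j x) (Phi e f j y) = bp (om F n) b' x y := by
  simp [Phi_apply, h.ee, h.ff, h.ef, h.ej, h.fj, h.jj, h.fe hb, h.je hb, h.jf hb, dotProduct]
  simp [sub_eq_add_neg, mul_comm]

theorem om_nd (n : ℕ) (x : (Fin n → F) × (Fin n → F)) (h : ∀ y, om F n x y = 0) : x = 0 := by
  ext i
  · have := h (0, Pi.single i 1); simpa using this
  · have := h (Pi.single i 1, 0); simpa using this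

theorem om_sy (n : ℕ) : Sy (om F n) := ⟨fun x => by simp [dotProduct_comm], om_nd n⟩

theorem Dec.phi_inj (h : Dec b b' e f j) (hb : Sy b) (hb' : Sy b') :
    Function.Injective (Phi e f j) := by
  rw [← LinearMap.ker_eq_bot, LinearMap.ker_eq_bot']
  intro x hx
  have h1 : ∀ y, bp (om F n) b' x y = 0 := fun y => by rw [← h.iso hb, hx]; simp
  ext1
  · apply om_nd; intro y; simpa using h1 (y, 0)
  · apply hb'.nd; intro y; simpa using h1 (0, y)

theorem Dec.equiv [FiniteDimensional F V] [FiniteDimensional F V']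
    (h : Dec b b' e f j) (hb : Sy b) (hb' : Sy b')
    (hd : Module.finrank F V = 2 * n + Module.finrank F V') :
    ∃ Φ : (((Fin n → F) × (Fin n → F)) × V') ≃ₗ[F] V, ∀ x, Φ x = Phi e f j x :=
  ⟨LinearMap.linearEquivOfInjective (Phi e f j) (h.phi_inj hb hb') (by simp [hd]; ring),
    fun x => rfl⟩

/-- existence of a complement -/
theorem exists_dec [FiniteDimensional F V] (hb : Sy b) (ee : ∀ i k, b (e i) (e k) = 0)
    (ff : ∀ i k, b (f i) (f k) = 0) (ef : ∀ i k, b (e i) (f k) = if i = k then 1 else 0) :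
    ∃ (W : Submodule F V) (c : W →ₗ[F] W →ₗ[F] F), Sy c ∧ Dec b c e f W.subtype ∧
      Module.finrank F V = 2 * n + Module.finrank F W := by
  let W : Submodule F V := 
    { carrier := {x | ∀ i, b (e i) x = 0 ∧ b (f i) x = 0}
      add_mem' := fun {x y} hx hy i => by simp [hx i, hy i]
      zero_mem' := fun i => by simp
      smul_mem' := fun c x hx i => by simp [hx i] }
  let c : W →ₗ[F] W →ₗ[F] F := b.compl₁₂ W.subtype W.subtype
  have hW : ∀ x : W, ∀ i, b (e i) x = 0 ∧ b (f i) x = 0 := fun x => x.2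
  have hD : Dec b c e f W.subtype := ⟨ee, ff, ef, fun i v => (hW v i).1, fun i v => (hW v i).2,
    fun _ _ => rfl⟩
  have fe := hD.fe hb
  have key : ∀ x : V, ∃ w : W, x = (∑ i, b x (f i) • e i) + (∑ i, b (e i) x • f i) + w := by
    intro x
    refine ⟨⟨x - (∑ i, b x (f i) • e i) - (∑ i, b (e i) x • f i), ?_⟩, ?_⟩
    · intro k
      simp [ee, ff, ef, fe]
      rw [hb.neg]; simp
    · simp
  have hc : Sy c := by
    refine ⟨fun x => hb.alt _, fun x hx => ?_⟩
    have : (x : V) = 0 := by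
      apply hb.nd
      intro y
      obtain ⟨w, hw⟩ := key y
      rw [hw]
      have := hx w
      simp only [map_add, map_sum, map_smul]
      have h1 := hD.je hb (v := x)
      have h2 := hD.jf hb (v := x)
      simp at h1 h2
      simp [h1, h2]
      exact this
    exact_mod_cast this
  refine ⟨W, c, hc, hD, ?_⟩
  have hs : Function.Surjective (Phi e f W.subtype) := by
    intro x
    obtain ⟨w, hw⟩ := key x
    exact ⟨((fun i => b x (f i), fun i => b (e i) x), w), by rw [Phi_apply]; exact hw.symm⟩
  have := (LinearEquiv.ofBijective _ ⟨hD.phi_inj hb hc, hs⟩).finrank_eq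
  rw [← this]; simp; ring

/-- diagonal principle -/
theorem Dec.pi [FiniteDimensional F V] [FiniteDimensional F V']
    (h : Dec b b' e f j) (hb : Sy b) (hb' : Sy b')
    (hd : Module.finrank F V = 2 * n + Module.finrank F V') {k : ℕ}
    {R : V →ₗ[F] V} {D : _} {R1 : V' →ₗ[F] V'}
    (hR : ∀ x v, R (Phi e f j (x, v)) = Phi e f j (D x, R1 v))
    (hD : PI (om F n) k D) (hR1 : PI b' k R1) : PI b k R := by
  obtain ⟨Φ, hΦ⟩ := h.equiv hb hb' hd
  refine PI.equiv (b' := bp (om F n) b') Φ (fun x y => by rw [hΦ, hΦ, h.iso hb]) ?_ (hD.prod hR1)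
  rintro ⟨x, v⟩
  rw [hΦ, hΦ, hR]; rfl

end basic
end SympInv



namespace SympInv

section two
variable {F : Type u} [Field F]
variable {V : Type u} [AddCommGroup V] [Module F V] {b : V →ₗ[F] V →ₗ[F] F}
variable {V' : Type u} [AddCommGroup V'] [Module F V'] {b' : V' →ₗ[F] V' →ₗ[F] F}

def sw (s : F) : ((Fin 2 → F) × (Fin 2 → F)) →ₗ[F] ((Fin 2 → F) × (Fin 2 → F)) where
  toFun x := (![s * x.2 1, - (s * x.2 0)], ![-(s⁻¹ * x.1 1), s⁻¹ * x.1 0])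
  map_add' x y := by
    ext i <;> fin_cases i <;> simp <;> ring
  map_smul' c x := by
    ext i <;> fin_cases i <;> simp <;> ring

theorem sw_inv {s : F} (hs : s ≠ 0) : Inv (om F 2) (sw s) := by
  constructor
  · intro x y
    simp [sw, dotProduct, Fin.sum_univ_two]
    field_simp
    ring
  · intro x
    ext i <;> fin_cases i <;> simp [sw, hs]

def Ds (s : F) (n : ℕ) : ((Fin n → F) × (Fin n → F)) →ₗ[F] ((Fin n → F) × (Fin n → F)) :=
  (s • LinearMap.id).prodMap (s⁻¹ • LinearMap.id)

theorem Ds_pi {s : F} (hs : s ≠ 0) : PI (om F 2) 2 (Ds s 2) := by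
  refine ⟨sw s, sw 1, sw_inv hs, (sw_inv one_ne_zero).pi, ?_⟩
  refine LinearMap.ext fun x => ?_
  ext i <;> fin_cases i <;> simp [sw, Ds]

variable {n : ℕ} {e f : Fin n → V} {j : V' →ₗ[F] V}

theorem Dec.span [FiniteDimensional F V] [FiniteDimensional F V']
    (h : Dec b b' e f j) (hb : Sy b) (hb' : Sy b')
    (hd : Module.finrank F V = 2 * n + Module.finrank F V') (x : V) :
    ∃ v, x = (∑ i, b x (f i) • e i) + (∑ i, b (e i) x • f i) + j v := by
  obtain ⟨Φ, hΦ⟩ := h.equiv hb hb' hd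
  obtain ⟨⟨⟨p, q⟩, v⟩, rfl⟩ := Φ.surjective x
  refine ⟨v, ?_⟩
  rw [hΦ, Phi_apply]
  simp [h.ee, h.ff, h.ef, h.ej, h.jf hb]

/-- triangular isometries are split -/
theorem triT [FiniteDimensional F V] [FiniteDimensional F V']
    {e f : Fin 2 → V}
    (h : Dec b b' e f j) (hb : Sy b) (hb' : Sy b')
    (hd : Module.finrank F V = 2 * 2 + Module.finrank F V')
    {R : V →ₗ[F] V} (hR : Iso b R) {R1 : V' →ₗ[F] V'} {s : F} (hs0 : s ≠ 0) (hs : s ^ 2 ≠ 1)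
    (hRe : ∀ i, R (e i) = s • e i)
    (hRj : ∀ v, ∃ p : Fin 2 → F, R (j v) = j (R1 v) + ∑ i, p i • e i)
    (hev : ¬ Module.End.HasEigenvalue R1 s⁻¹) {k : ℕ} (hk : 2 ≤ k) (hR1 : PI b' k R1) :
    PI b k R := by
  have hsurj : Function.Surjective (R1 - s⁻¹ • (LinearMap.id : V' →ₗ[F] V')) := by
    apply LinearMap.surjective_of_injective
    rw [← LinearMap.ker_eq_bot, LinearMap.ker_eq_bot']
    intro x hx
    by_contra hne
    apply hev
    refine Module.End.hasEigenvalue_of_hasEigenvector (x := x) ?_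
    rw [Module.End.hasEigenvector_iff, Module.End.mem_eigenspace_iff]
    refine ⟨?_, hne⟩
    simp at hx
    exact sub_eq_zero.1 hx
  have hss : s - s⁻¹ ≠ 0 := by
    intro h0
    apply hs
    field_simp at h0
    linear_combination h0
  have key : ∀ i, ∃ w, (∀ k, b (e k) w = if k = i then 1 else 0) ∧ R w = s⁻¹ • w := by
    intro i
    obtain ⟨v', hv'⟩ := h.span hb hb' hd (R (f i) - s⁻¹ • f i)
    have h0 : ∀ k, b (e k) (R (f i) - s⁻¹ • f i) = 0 := by
      intro k
      have h1 := hR (e k) (f i)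
      rw [hRe] at h1
      simp at h1
      simp [← h1, hs0]
    simp only [h0, zero_smul, Finset.sum_const_zero, add_zero] at hv'
    obtain ⟨v, hv⟩ := hsurj v'
    simp at hv
    obtain ⟨p, hp⟩ := hRj v
    refine ⟨f i - j v - (s - s⁻¹)⁻¹ • (∑ k, (b (R (f i) - s⁻¹ • f i) (f k) - p k) • e k), ?_, ?_⟩
    · intro k
      simp [h.ee, h.ef, h.ej]
    · have hv2 : R (f i) = s⁻¹ • f i + (∑ k, b (R (f i) - s⁻¹ • f i) (f k) • e k) + j v' := by
        rw [add_assoc, ← hv']; abel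
      set c := fun k => b (R (f i) - s⁻¹ • f i) (f k) with hc
      have hc' : ∀ k, b (R (f i) - s⁻¹ • f i) (f k) = c k := fun _ => rfl
      simp only [hc'] at hv2 ⊢
      rw [map_sub, map_sub, hv2, hp, map_smul, map_sum]
      simp only [map_smul, hRe, ← hv, map_sub, Fin.sum_univ_two]
      match_scalars <;> field_simp [hss] <;> ring_nf
  choose f2 hf2 hRf2 using key
  have ff2 : ∀ i k, b (f2 i) (f2 k) = 0 := by
    intro i k
    have h1 := hR (f2 i) (f2 k)
    rw [hRf2, hRf2] at h1
    simp at h1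
    field_simp at h1
    have : (s^2 - 1) * b (f2 i) (f2 k) = 0 := by linear_combination -h1
    rcases mul_eq_zero.1 this with h | h
    · exact absurd (sub_eq_zero.1 h) hs
    · exact h
  let j2 : V' →ₗ[F] V := j - ∑ k, (b.flip (f2 k) ∘ₗ j).smulRight (e k)
  have hj2 : ∀ v, j2 v = j v - ∑ k, b (j v) (f2 k) • e k := fun v => by simp [j2]
  have fe2 : ∀ i k, b (f2 k) (e i) = if i = k then -1 else 0 := by
    intro i k; rw [hb.neg, hf2]; by_cases hh : i = k <;> simp [hh, eq_comm]
  have h2 : Dec b b' e f2 j2 := by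
    refine ⟨h.ee, ff2, fun i k => hf2 k i, fun i v => ?_, fun i v => ?_, fun v w => ?_⟩
    · rw [hj2]; simp [h.ej, h.ee]
    · rw [hj2, map_sub, hb.neg _ (j v)]; fin_cases i <;> simp [fe2]
    · rw [hj2, hj2]; simp [h.ej, h.ee, h.je hb, h.jj]
  refine h2.pi hb hb' hd (D := Ds s 2) (R1 := R1) ?_ ((Ds_pi hs0).mono hk) hR1
  have hRj2 : ∀ v, R (j2 v) = j2 (R1 v) := by
    intro v
    obtain ⟨p, hp⟩ := hRj v
    have h3 : ∀ k, b (R (j2 v)) (f2 k) = 0 := by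
      intro k
      have h1 := hR (j2 v) (f2 k)
      rw [h2.jf hb, hRf2] at h1
      simpa [hs0] using h1
    have h4 : ∃ c : Fin 2 → F, R (j2 v) = j (R1 v) + ∑ k, c k • e k := by
      refine ⟨fun k => p k - s * b (j v) (f2 k), ?_⟩
      rw [hj2, map_sub, hp]
      simp only [map_add, map_smul, hRe, Fin.sum_univ_two]
      module
    obtain ⟨c, hc⟩ := h4
    have h5 : ∀ k, c k = - b (j (R1 v)) (f2 k) := by
      intro k
      have := h3 k
      rw [hc] at this
      fin_cases k <;> simp [hf2] at this ⊢ <;> linear_combination this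
    rw [hc, hj2]
    simp [h5, sub_eq_add_neg]
  intro x v
  rw [Phi_apply, Phi_apply]
  simp only [map_add, map_sum, map_smul, hRe, hRf2, hRj2]
  simp [Ds, smul_smul, mul_comm]

end two
end SympInv



namespace SympInv

section three
variable {F : Type u} [Field F]
variable {V : Type u} [AddCommGroup V] [Module F V] {b : V →ₗ[F] V →ₗ[F] F}

theorem exists_avoid [Infinite F] {S : Set F} (hS : S.Finite) : ∃ t, t ∉ S := by
  obtain ⟨t, ht⟩ := hS.infinite_compl.nonempty
  exact ⟨t, ht⟩

theorem finite_sq : Set.Finite {t : F | t ^ 2 = 1} := by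
  apply Set.Finite.subset (Set.toFinite ({1, -1} : Set F))
  intro t ht
  have ht : t ^ 2 = 1 := ht
  rw [pow_two, mul_self_eq_one_iff] at ht
  simpa using ht
  
theorem step [Infinite F] [FiniteDimensional F V] (hb : Sy b) {e f : Fin 2 → V}
    (ee : ∀ i k, b (e i) (e k) = 0)
    (ff : ∀ i k, b (f i) (f k) = 0) (ef : ∀ i k, b (e i) (f k) = if i = k then 1 else 0)
    {M : V →ₗ[F] V} (hM : Iso b M) {c : F} (hc : c ≠ 0)
    (hMef : ∀ i k, b (M (e i)) (f k) = if i = k then c else 0) {k : ℕ} (hk : 4 ≤ k)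
    (IH : ∀ (W : Submodule F V) (c' : W →ₗ[F] W →ₗ[F] F), Sy c' →
      Module.finrank F V = 2 * 2 + Module.finrank F W → ∀ g, Iso c' g → PI c' k g) : PI b k M := by
  obtain ⟨W, c', hc', hD, hd⟩ := exists_dec hb ee ff ef
  set j := W.subtype with hj
  let j2 : W →ₗ[F] V := j + ∑ k, (c⁻¹ • (b.flip (M (e k)) ∘ₗ j)).smulRight (f k)
  have hj2 : ∀ v, j2 v = j v + ∑ k, (c⁻¹ * b (j v) (M (e k))) • f k := fun v => by simp [j2]
  have hfM : ∀ i k, b (f k) (M (e i)) = if i = k then -c else 0 := by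
    intro i k; rw [hb.neg, hMef]; by_cases hh : i = k <;> simp [hh]
  have hjM : ∀ k v, b (j2 v) (M (e k)) = 0 := by
    intro k v
    rw [hj2]
    fin_cases k <;> simp [hfM] <;> field_simp <;> ring
  have hD2 : Dec b c' (fun i => c⁻¹ • M (e i)) f j2 := by
    refine ⟨fun i k => ?_, ff, fun i k => ?_, fun i v => ?_, fun i v => ?_, fun v w => ?_⟩
    · simp [hM _ _, ee]
    · by_cases hh : i = k <;> simp [hMef, hh, hc]
    · simp only [map_smul, LinearMap.smul_apply]; rw [hb.neg, hjM]; simp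
    · rw [hj2]; simp [ff, hD.fj]
    · rw [hj2, hj2]; simp [ff, hD.fj, hD.jf hb, hD.jj]
  obtain ⟨Φ, hΦ⟩ := hD.equiv hb hc' hd
  obtain ⟨Φ2, hΦ2⟩ := hD2.equiv hb hc' hd
  -- the compression
  let M' : W →ₗ[F] W := LinearMap.snd F _ _ ∘ₗ Φ2.symm.toLinearMap ∘ₗ M ∘ₗ j
  have hM' : ∀ v, ∃ p : Fin 2 → F, M (j v) = (∑ i, p i • M (e i)) + j2 (M' v) := by
    intro v
    have h1 : M (j v) = Phi (fun i => c⁻¹ • M (e i)) f j2 (Φ2.symm (M (j v))) := by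
      rw [← hΦ2]; simp
    rw [Phi_apply] at h1
    set x := Φ2.symm (M (j v)) with hx
    have h2 : ∀ i, x.1.2 i = 0 := by
      intro i
      have h3 : b (M (e i)) (M (j v)) = 0 := by rw [hM, hD.ej]
      rw [h1] at h3
      simp [hM _ _, ee, hMef] at h3
      rw [hb.neg, hjM] at h3
      fin_cases i <;> simpa [hc] using h3
    simp only [h2, zero_smul, Finset.sum_const_zero, add_zero] at h1
    refine ⟨fun i => x.1.1 i * c⁻¹, ?_⟩
    rw [h1]
    simp [smul_smul]
    rfl
  have hMM : ∀ i v, b (M (e i)) (j2 v) = 0 := fun i v => by rw [hb.neg, hjM, neg_zero]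
  have hM'iso : Iso c' M' := by
    intro v w
    have h1 := hM (j v) (j w)
    obtain ⟨p, hp⟩ := hM' v
    obtain ⟨q, hq⟩ := hM' w
    rw [hp, hq] at h1
    simp [hM _ _, ee, hjM, hMM, hD2.jj, hD.jj] at h1
    exact h1
  obtain ⟨l, rfl⟩ := Nat.exists_eq_add_of_le' hk
  have hpi := IH W c' hc' hd M' hM'iso
  rw [show l + 4 = (l + 2) + 2 by ring] at hpi ⊢
  obtain ⟨N1, R1, hN1, hR1, hNR⟩ := hpi.split
  -- choice of t
  have hfin : Set.Finite ({0} ∪ {t : F | t ^ 2 = 1} ∪ {t | Module.End.HasEigenvalue N1 t} ∪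
      ((fun x => c * x) '' {t : F | t ^ 2 = 1}) ∪
      ((fun x => c * x) '' {t | Module.End.HasEigenvalue R1 t})) := by
    refine ((((Set.finite_singleton _).union finite_sq).union ?_).union (finite_sq.image _)).union
      (Set.Finite.image _ ?_)
    · exact Module.End.finite_hasEigenvalue N1
    · exact Module.End.finite_hasEigenvalue R1
  obtain ⟨t, ht⟩ := exists_avoid hfin
  simp only [Set.mem_union, not_or, Set.mem_singleton_iff, Set.mem_image, Set.mem_ofPred_eq] at ht
  obtain ⟨⟨⟨⟨ht0, ht1⟩, htN⟩, htc⟩, htR⟩ := ht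
  have hsq : (c / t) ^ 2 ≠ 1 := by
    intro h
    apply htc
    refine ⟨t / c, ?_, by field_simp⟩
    have : t / c = (c / t)⁻¹ := by simp
    rw [this, inv_pow, h, inv_one]
  have hR1e : ¬ Module.End.HasEigenvalue R1 (c / t)⁻¹ := by
    intro h
    apply htR
    exact ⟨_, h, by field_simp⟩
  let N : V →ₗ[F] V := Φ2.toLinearMap ∘ₗ ((Ds t 2).prodMap N1) ∘ₗ Φ.symm.toLinearMap
  have hN : ∀ (p q : Fin 2 → F) (v : W), N (∑ i, p i • e i + ∑ i, q i • f i + j v) =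
      ∑ i, (t * c⁻¹ * p i) • M (e i) + ∑ i, (t⁻¹ * q i) • f i + j2 (N1 v) := by
    intro p q v
    have : (∑ i, p i • e i + ∑ i, q i • f i + j v) = Φ ((p, q), v) := by rw [hΦ, Phi_apply]
    rw [this]
    simp only [N, LinearMap.comp_apply, LinearEquiv.coe_coe, LinearEquiv.symm_apply_apply]
    rw [hΦ2, Phi_apply]
    simp [Ds, smul_smul, mul_assoc, mul_comm, mul_left_comm]
  have hNiso : Iso b N := by
    intro x y
    obtain ⟨⟨⟨p, q⟩, v⟩, rfl⟩ := Φ.surjective x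
    obtain ⟨⟨⟨p', q'⟩, v'⟩, rfl⟩ := Φ.surjective y
    simp only [N, LinearMap.comp_apply, LinearEquiv.coe_coe, LinearEquiv.symm_apply_apply]
    rw [hΦ2, hΦ2, hΦ, hΦ, hD2.iso hb, hD.iso hb]
    simp [Ds, hN1.iso _ _, ht0]
  have hNe : ∀ i, N (e i) = (t * c⁻¹) • M (e i) := by
    intro i
    have := hN (Pi.single i 1) 0 0
    simpa [Pi.single_apply] using this
  have hNf : ∀ i, N (f i) = t⁻¹ • f i := by
    intro i
    have := hN 0 (Pi.single i 1) 0
    simpa [Pi.single_apply] using this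
  have hNj : ∀ v, N (j v) = j2 (N1 v) := by
    intro v
    have := hN 0 0 v
    simpa using this
  let Ne := LinearEquiv.ofInjectiveEndo N (hNiso.inj hb)
  have hNeN : ∀ x, Ne x = N x := fun x => rfl
  let R : V →ₗ[F] V := Ne.symm.toLinearMap ∘ₗ M
  have hNR' : ∀ x, N (R x) = M x := by
    intro x; rw [← hNeN]; simp [R]
  have hRu : ∀ x y, N y = M x → R x = y := by
    intro x y h
    apply hNiso.inj hb
    rw [hNR', h]
  have hRiso : Iso b R := by
    intro x y
    rw [← hNiso, hNR', hNR', hM]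
  have hMR : M = N ∘ₗ R := by ext x; simp [hNR']
  rw [hMR]
  refine PI.comp ?_ ?_
  · -- N
    have hD3 : Dec b c' f (fun i => - e i) j := by
      refine ⟨ff, fun i k => by simp [ee], fun i k => ?_, hD.fj, fun i v => by simp [hD.ej], hD.jj⟩
      rw [map_neg, hD.fe hb]; by_cases hh : i = k <;> simp [hh]
    refine triT hD3 hb hc' hd hNiso (R1 := N1) (s := t⁻¹) (inv_ne_zero ht0) ?_ hNf ?_ ?_ le_rfl hN1
    · rw [inv_pow]; intro h; exact ht1 (inv_eq_one.1 h)
    · intro v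
      exact ⟨_, by rw [hNj, hj2]⟩
    · rwa [inv_inv]
  · refine triT hD hb hc' hd hRiso (R1 := R1) (s := c / t) (div_ne_zero hc ht0) hsq ?_ ?_ hR1e
      (by omega) hR1
    · intro i
      apply hRu
      rw [map_smul, hNe, smul_smul]
      field_simp
      simp
    · intro v
      obtain ⟨p, hp⟩ := hM' v
      refine ⟨fun i => c / t * p i, ?_⟩
      apply hRu
      rw [hp, map_add, hNj, map_sum, hNR, add_comm]
      simp only [map_smul, hNe, smul_smul]
      congr 1
      refine Finset.sum_congr rfl fun i _ => ?_
      congr 1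
      field_simp

end three
end SympInv



namespace SympInv

section four
variable {F : Type u} [Field F]
variable {V : Type u} [AddCommGroup V] [Module F V] {b : V →ₗ[F] V →ₗ[F] F}

theorem exists_perp [FiniteDimensional F V] {n : ℕ} (φ : Fin n → V →ₗ[F] F)
    (hn : n < Module.finrank F V) : ∃ y, y ≠ 0 ∧ ∀ i, φ i y = 0 := by
  have h := LinearMap.ker_ne_bot_of_finrank_lt (f := LinearMap.pi φ) (by simpa using hn)
  obtain ⟨y, hy, hy0⟩ := (Submodule.ne_bot_iff _).1 h
  refine ⟨y, hy0, fun i => ?_⟩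
  have := congrFun (LinearMap.mem_ker.1 hy) i
  simpa using this

theorem exists_q (hb : Sy b) {M : V →ₗ[F] V} (hM : Iso b M) :
    Inv b M ∨ ∃ x, b x (M x) ≠ 0 := by
  by_contra! hcon
  obtain ⟨h1, h2⟩ := hcon
  apply h1
  refine ⟨hM, fun x => ?_⟩
  have h3 : ∀ x y, b (M x) y = b x (M y) := by
    intro x y
    have := h2 (x + y)
    simp [h2] at this
    rw [hb.neg (M x) y]
    linear_combination -this
  rw [← sub_eq_zero]
  apply hb.nd
  intro z
  rw [map_sub, LinearMap.sub_apply, h3, hM, sub_self]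

theorem quad [FiniteDimensional F V] (hb : Sy b) (hd : 4 ≤ Module.finrank F V)
    {M : V →ₗ[F] V} (hM : Iso b M) : Inv b M ∨ ∃ (e f : Fin 2 → V) (c : F), c ≠ 0 ∧
      (∀ i k, b (e i) (e k) = 0) ∧ (∀ i k, b (f i) (f k) = 0) ∧
      (∀ i k, b (e i) (f k) = if i = k then 1 else 0) ∧
      (∀ i k, b (M (e i)) (f k) = if i = k then c else 0) := by
  rcases exists_q hb hM with h | ⟨x, hx⟩
  · exact Or.inl h
  right
  obtain ⟨y, hy0, hy⟩ := exists_perp (F := F) (V := V)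
    ![b x, b (M x), b x ∘ₗ M] (by omega)
  have y1 : b x y = 0 := by simpa using hy 0
  have y2 : b (M x) y = 0 := by simpa using hy 1
  have y3 : b x (M y) = 0 := by simpa using hy 2
  have y4 : b y x = 0 := by rw [hb.neg, y1, neg_zero]
  have y5 : b y (M x) = 0 := by rw [hb.neg, y2, neg_zero]
  have y6 : b (M y) x = 0 := by rw [hb.neg, y3, neg_zero]
  have hx' : b (M x) x = - b x (M x) := hb.neg _ _
  have hind : ∀ c : F, y ∈ Submodule.span F {x, M x, M y - c • y} → ∃ γ : F, y = γ • (M y - c • y) := by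
    intro c hc
    obtain ⟨α, β, γ, h⟩ := Submodule.mem_span_triple.1 hc
    have hβ : β = 0 := by
      have := congrArg (b x) h
      simp [hb.alt, y1, y3, hx] at this
      exact this
    have hα : α = 0 := by
      have := congrArg (b (M x)) h
      simp [hb.alt, y1, y2, hM _ _, hx', hx] at this
      exact this
    subst hα hβ
    exact ⟨γ, by simpa using h.symm⟩
  have hphi : ∃ c : F, c ≠ 0 ∧ y ∉ Submodule.span F {x, M x, M y - c • y} := by
    by_cases h : ∃ c : F, M y = c • y
    · obtain ⟨c, hc⟩ := h
      refine ⟨c, ?_, fun hm => ?_⟩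
      · rintro rfl
        rw [zero_smul] at hc
        exact hy0 (hM.inj hb (by rw [hc, map_zero]))
      · obtain ⟨γ, hγ⟩ := hind c hm
        rw [hc, sub_self, smul_zero] at hγ
        exact hy0 hγ
    · refine ⟨1, one_ne_zero, fun hm => h ?_⟩
      obtain ⟨γ, hγ⟩ := hind 1 hm
      have hγ0 : γ ≠ 0 := by
        rintro rfl
        rw [zero_smul] at hγ
        exact hy0 hγ
      refine ⟨γ⁻¹ + 1, ?_⟩
      have : γ⁻¹ • y = M y - y := by
        conv_lhs => rw [hγ]
        rw [smul_smul, inv_mul_cancel₀ hγ0]; simp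
      rw [add_smul, this]; simp
  obtain ⟨c, hc, hmem⟩ := hphi
  obtain ⟨φ, hφ, hle⟩ := Submodule.exists_le_ker_of_notMem hmem
  have p1 : φ x = 0 := hle (Submodule.subset_span (by simp))
  have p2 : φ (M x) = 0 := hle (Submodule.subset_span (by simp))
  have p3 : φ (M y - c • y) = 0 := hle (Submodule.subset_span (by simp))
  have p3 : φ (M y) = c * φ y := by
    rw [map_sub, map_smul] at p3; exact sub_eq_zero.1 p3
  obtain ⟨f2, hf2⟩ := hb.riesz ((φ y)⁻¹ • φ)
  have q1 : b x f2 = 0 := by rw [hf2]; simp [p1]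
  have q2 : b (M x) f2 = 0 := by rw [hf2]; simp [p2]
  have q3 : b y f2 = 1 := by rw [hf2]; simp [hφ]
  have q4 : b (M y) f2 = c := by rw [hf2]; simp [p3]; field_simp
  have q5 : b f2 x = 0 := by rw [hb.neg, q1, neg_zero]
  have q6 : b f2 (M x) = 0 := by rw [hb.neg, q2, neg_zero]
  refine ⟨![x, y], ![(b x (M x))⁻¹ • (M x - c • x), f2], c, hc, ?_, ?_, ?_, ?_⟩
  · intro i k; fin_cases i <;> fin_cases k <;> simp [hb.alt, y1, y4]
  · intro i k; fin_cases i <;> fin_cases k <;> simp [hb.alt, hx', q1, q2, q5, q6]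
  · intro i k; fin_cases i <;> fin_cases k <;> simp [hb.alt, q1, q3, hx, y4, y5]
  · intro i k
    fin_cases i <;> fin_cases k <;> simp [hb.alt, q2, q4, hx', hM _ _, y4, y6]
    field_simp

theorem induct [Infinite F] {k d : ℕ} (hk : 4 ≤ k)
    (hbase : ∀ (V : Type u) [AddCommGroup V] [Module F V] [FiniteDimensional F V]
      (b : V →ₗ[F] V →ₗ[F] F) (M : V →ₗ[F] V), Sy b → Module.finrank F V = d → Iso b M → PI b k M)
    (n : ℕ) : ∀ (V : Type u) [AddCommGroup V] [Module F V] [FiniteDimensional F V]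
      (b : V →ₗ[F] V →ₗ[F] F) (M : V →ₗ[F] V), Sy b → Module.finrank F V = 4 * n + d →
      Iso b M → PI b k M := by
  induction n with
  | zero => intro V _ _ _ b M hb hd hM; exact hbase V b M hb (by omega) hM
  | succ n ih =>
    intro V _ _ _ b M hb hd hM
    rcases quad hb (by omega) hM with h | ⟨e, f, c, hc, ee, ff, ef, hMef⟩
    · exact h.pi.mono (by omega)
    · exact step hb ee ff ef hM hc hMef hk
        fun W c' hc' hdW g hg => ih W c' g hc' (by omega) hg

theorem even_thm [Infinite F] (n : ℕ) : ∀ (V : Type u) [AddCommGroup V] [Module F V]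
      [FiniteDimensional F V] (b : V →ₗ[F] V →ₗ[F] F) (M : V →ₗ[F] V), Sy b →
      Module.finrank F V = 4 * n → Iso b M → PI b 4 M := by
  refine induct (d := 0) le_rfl ?_ n
  intro V _ _ _ b M hb hd hM
  have := Module.finrank_zero_iff.1 hd
  have : M = LinearMap.id := LinearMap.ext fun x => Subsingleton.elim _ _
  rw [this]
  exact PI.one 4

end four
end SympInv



namespace SympInv

section five
variable {F : Type u} [Field F]
variable {V : Type u} [AddCommGroup V] [Module F V] {b : V →ₗ[F] V →ₗ[F] F}

theorem lemD1 (hb : Sy b) (h2 : (2 : F) ≠ 0) {M : V →ₗ[F] V} (hM : Iso b M) {x y : V}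
    (qx : b x (M x) = 0) (qy : b y (M y) = 0) (qxy : b x (M y) + b y (M x) = 0)
    (hs : b x y + b x (M y) ≠ 0) : ∃ i, Inv b i ∧ i (M x) = x ∧ i (M y) = y := by
  set s := b x y + b x (M y) with hsd
  set u := M x + x with hu
  set v := M y + y with hv
  have h1 : b (M x) y = b x (M y) := by rw [hb.neg]; linear_combination -qxy
  have h1' : b (M y) x = - b x (M y) := by rw [hb.neg]
  have h1'' : b y x = - b x y := by rw [hb.neg]
  have qx' : b (M x) x = 0 := by rw [hb.neg, qx, neg_zero]
  have qy' : b (M y) y = 0 := by rw [hb.neg, qy, neg_zero]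
  have huv : b u v = 2 * s := by
    simp only [hu, hv, map_add, LinearMap.add_apply, hM _ _, h1, hsd]; ring
  have hvu : b v u = -(2 * s) := by rw [hb.neg, huv]
  let i : V →ₗ[F] V := (b.flip v).smulRight (s⁻¹ • u) - (b.flip u).smulRight (s⁻¹ • v) - LinearMap.id
  have hi : ∀ z, i z = (s⁻¹ * b z v) • u - (s⁻¹ * b z u) • v - z := by
    intro z; simp [i, smul_smul, mul_comm]
  refine ⟨i, ⟨?_, ?_⟩, ?_, ?_⟩
  · intro z w
    rw [hi, hi]
    simp only [map_sub, map_smul, LinearMap.sub_apply, LinearMap.smul_apply, hb.alt, huv, hvu,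
      smul_eq_mul, hb.neg u w, hb.neg v w]
    field_simp
    ring
  · intro z
    rw [hi (i z), hi z]
    simp only [map_sub, map_smul, LinearMap.sub_apply, LinearMap.smul_apply, hb.alt, huv, hvu,
      smul_eq_mul]
    match_scalars <;> field_simp <;> ring
  · have e1 : b (M x) u = 0 := by simp [hu, qx', hb.alt]
    have e2 : b (M x) v = s := by simp [hv, hM _ _, h1, hsd]
    rw [hi, e1, e2, inv_mul_cancel₀ hs]; simp [hu]
  · have e1 : b (M y) v = 0 := by simp [hv, qy', hb.alt]
    have e2 : b (M y) u = -s := by simp [hu, hM _ _, h1', h1'', hsd]; ring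
    rw [hi, e1, e2, mul_neg, inv_mul_cancel₀ hs]; simp [hv]

theorem lemD2 (hb : Sy b) (h2 : (2 : F) ≠ 0) {M : V →ₗ[F] V} (hM : Iso b M) {x y : V}
    (qx : b x (M x) = 0) (qy : b y (M y) = 0) (qxy : b x (M y) + b y (M x) = 0)
    (hxy : b x y ≠ 0) : ∃ i, Inv b i ∧ i (M x) = x ∧ i (M y) = y := by
  by_cases hs : b x y + b x (M y) = 0
  · obtain ⟨i, hi, h3, h4⟩ := lemD1 (b := b) hb h2 (M := -M) (x := x) (y := y)
      (fun z w => by simp [hM _ _]) (by simp [qx]) (by simp [qy])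
      (by simp; linear_combination -qxy) (by
        intro h
        simp at h
        have : 2 * b x y = 0 := by linear_combination h + hs
        rcases mul_eq_zero.1 this with h | h
        · exact h2 h
        · exact hxy h)
    refine ⟨-i, ⟨fun z w => by simp [hi.1 _ _], fun z => by simp [hi.2]⟩, ?_, ?_⟩
    · simpa using h3
    · simpa using h4
  · exact lemD1 hb h2 hM qx qy qxy hs

theorem lemD [Infinite F] [FiniteDimensional F V] (hb : Sy b) (h2 : (2 : F) ≠ 0) 
    (hd : Module.finrank F V = 6) {M : V →ₗ[F] V} (hM : Iso b M) {x y : V}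
    (qx : b x (M x) = 0) (qy : b y (M y) = 0) (qxy : b x (M y) + b y (M x) = 0)
    (hxy : b x y ≠ 0) : PI b 5 M := by
  obtain ⟨i, hi, hix, hiy⟩ := lemD2 hb h2 hM qx qy qxy hxy
  refine ⟨i, i ∘ₗ M, hi, ?_, by ext z; simp [hi.2]⟩
  set R := i ∘ₗ M with hRdef
  have hR : Iso b R := hi.1.comp hM
  have hRx : R x = x := hix
  have hRy : R y = (y : V) := hiy
  obtain ⟨W, c, hc, hD, hdW⟩ := exists_dec (n := 1) (e := fun _ => x) (f := fun _ => (b x y)⁻¹ • y) hb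
    (fun _ _ => hb.alt _) (fun _ _ => by simp [hb.alt]) (fun i k => by
      rw [Subsingleton.elim i k]; simp [hxy])
  obtain ⟨Φ, hΦ⟩ := hD.equiv hb hc hdW
  let R1 : W →ₗ[F] W := LinearMap.snd F _ _ ∘ₗ Φ.symm.toLinearMap ∘ₗ R ∘ₗ W.subtype
  have hR1 : ∀ v, R (W.subtype v) = W.subtype (R1 v) := by
    intro v
    obtain ⟨w, hw⟩ := hD.span hb hc hdW (R (W.subtype v))
    have e1 : b x (R (W.subtype v)) = 0 := by
      conv_lhs => rw [← hRx]
      rw [hR]; exact hD.ej 0 v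
    have e2 : b (R (W.subtype v)) ((b x y)⁻¹ • y) = 0 := by
      have : R ((b x y)⁻¹ • y) = (b x y)⁻¹ • y := by rw [map_smul, hRy]
      conv_lhs => rw [← this]
      rw [hR]; exact hD.jf hb 0 v
    simp only [e1, e2, zero_smul, Finset.sum_const_zero, zero_add] at hw
    have e3 : R (W.subtype v) = Φ (0, w) := by rw [hΦ, Phi_apply, hw]; simp
    have e4 : R1 v = w := by simp only [R1, LinearMap.comp_apply, LinearEquiv.coe_coe, e3]; simp
    rw [hw, e4]
  refine hD.pi hb hc hdW (D := LinearMap.id) (R1 := R1) ?_ (PI.one 4) ?_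
  · intro z v
    rw [Phi_apply, Phi_apply]
    simp only [map_add, map_sum, map_smul, hRx, hRy, hR1]
    rfl
  · refine even_thm 1 W c R1 hc (by omega) ?_
    intro v w
    rw [← hD.jj, ← hD.jj, ← hR1, ← hR1, hR]

end five
end SympInv



namespace SympInv

section six
variable {F : Type u} [Field F]
variable {V : Type u} [AddCommGroup V] [Module F V] {b : V →ₗ[F] V →ₗ[F] F}

def hyp {n : ℕ} (g : Matrix (Fin n) (Fin n) F) :
    ((Fin n → F) × (Fin n → F)) →ₗ[F] ((Fin n → F) × (Fin n → F)) :=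
  g.mulVecLin.prodMap g.transpose.mulVecLin

theorem hyp_inv {n : ℕ} {g : Matrix (Fin n) (Fin n) F} (hg : g * g = 1) : Inv (om F n) (hyp g) := by
  have hg' : g.transpose * g.transpose = 1 := by
    rw [← Matrix.transpose_mul, hg, Matrix.transpose_one]
  have key : ∀ x y : Fin n → F, g.mulVec x ⬝ᵥ g.transpose.mulVec y = x ⬝ᵥ y := by
    intro x y
    rw [Matrix.dotProduct_mulVec, Matrix.vecMul_transpose, Matrix.mulVec_mulVec, hg,
      Matrix.one_mulVec]
  constructor
  · intro x y
    simp only [hyp, om_apply, LinearMap.prodMap_apply, Matrix.mulVecLin_apply]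
    rw [key, dotProduct_comm (g.transpose.mulVec x.2), key, dotProduct_comm y.1]
  · intro x
    ext i <;> simp [hyp, Matrix.mulVec_mulVec, hg, hg']

theorem exists_dual [FiniteDimensional F V] (hb : Sy b) (h2 : (2 : F) ≠ 0) {n : ℕ} {e : Fin n → V}
    (he : LinearIndependent F e) (ee : ∀ i k, b (e i) (e k) = 0) :
    ∃ f : Fin n → V, (∀ i k, b (f i) (f k) = 0) ∧
      (∀ i k, b (e i) (f k) = if i = k then 1 else 0) := by
  obtain ⟨g, hg⟩ := LinearMap.exists_leftInverse_of_injective (Fintype.linearCombination F e)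
    (LinearMap.ker_eq_bot.2 (linearIndependent_iff_injective_fintypeLinearCombination.1 he))
  have hge : ∀ i, g (e i) = Pi.single i 1 := by
    intro i
    have := LinearMap.congr_fun hg (Pi.single i 1)
    simpa [Fintype.linearCombination_apply_single] using this
  have := fun j => hb.riesz (LinearMap.proj j ∘ₗ g)
  choose f hf using this
  have ef : ∀ i k, b (e i) (f k) = if i = k then 1 else 0 := by
    intro i k; rw [hf]; simp [hge, Pi.single_apply, eq_comm]
  have fe : ∀ i k, b (f i) (e k) = if i = k then -1 else 0 := by
    intro i k; rw [hb.neg, ef]; by_cases hh : i = k <;> simp [hh, eq_comm]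
  refine ⟨fun j => f j - ∑ k, (2⁻¹ * b (f j) (f k)) • e k, ?_, ?_⟩
  · intro i k
    simp [ee, ef, fe]
    rw [hb.neg (f k) (f i)]
    field_simp
    ring
  · intro i k; simp [ee, ef]

theorem lagr [FiniteDimensional F V] (hb : Sy b) {n : ℕ} {e f : Fin n → V}
    (ee : ∀ i k, b (e i) (e k) = 0) (ff : ∀ i k, b (f i) (f k) = 0)
    (ef : ∀ i k, b (e i) (f k) = if i = k then 1 else 0) (hd : Module.finrank F V = 2 * n) (x : V) :
    x = (∑ i, b x (f i) • e i) + (∑ i, b (e i) x • f i) := by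
  obtain ⟨W, c, hc, hD, hdW⟩ := exists_dec hb ee ff ef
  obtain ⟨v, hv⟩ := hD.span hb hc hdW x
  have : Subsingleton W := Module.finrank_zero_iff.1 (by omega : Module.finrank F W = 0)
  rw [Subsingleton.elim v 0, map_zero, add_zero] at hv
  exact hv

theorem lagr_pi [FiniteDimensional F V] (hb : Sy b) {n : ℕ} {e f : Fin n → V}
    (ee : ∀ i k, b (e i) (e k) = 0) (ff : ∀ i k, b (f i) (f k) = 0)
    (ef : ∀ i k, b (e i) (f k) = if i = k then 1 else 0) (hd : Module.finrank F V = 2 * n)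
    {R : V →ₗ[F] V} {k : ℕ} {D : _} (hD : PI (om F n) k D)
    (hRe : ∀ i, R (e i) = ∑ k, (D (Pi.single i 1, 0)).1 k • e k + ∑ k, (D (Pi.single i 1, 0)).2 k • f k)
    (hRf : ∀ i, R (f i) = ∑ k, (D (0, Pi.single i 1)).1 k • e k + ∑ k, (D (0, Pi.single i 1)).2 k • f k) :
    PI b k R := by
  obtain ⟨W, c, hc, hDec, hdW⟩ := exists_dec hb ee ff ef
  have : Subsingleton W := Module.finrank_zero_iff.1 (by omega : Module.finrank F W = 0)
  refine hDec.pi hb hc hdW (D := D) (R1 := LinearMap.id) ?_ hD (PI.one k)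
  intro x v
  rw [Subsingleton.elim v 0]
  have : (R ∘ₗ Phi e f W.subtype ∘ₗ LinearMap.inl F _ W) = Phi e f W.subtype ∘ₗ LinearMap.inl F _ W ∘ₗ D := by
    apply LinearMap.prod_ext
    · apply LinearMap.pi_ext'
      intro i
      ext
      simp [Phi_apply, hRe, Pi.single_apply]
    · apply LinearMap.pi_ext'
      intro i
      ext
      simp [Phi_apply, hRf, Pi.single_apply]
  exact LinearMap.congr_fun this x

theorem lemT3 [FiniteDimensional F V] (hb : Sy b) (h2 : (2 : F) ≠ 0)
    (hd : Module.finrank F V = 6) {R : V →ₗ[F] V} (hR : Iso b R) {v : Fin 3 → V}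
    (hv : LinearIndependent F v) (vv : ∀ i k, b (v i) (v k) = 0) {T E : F}
    (hR0 : R (v 0) = v 1) (hR1 : R (v 1) = v 2) (hR2 : R (v 2) = v 0 - E • v 1 + T • v 2)
    (hET : T - E ≠ 0) (hET2 : T + E + 2 ≠ 0) : PI b 3 R := by
  obtain ⟨f, ff, ef⟩ := exists_dual hb h2 hv vv
  have hsp := lagr hb vv ff ef (by omega)
  -- the shift rules
  have s1 : ∀ z, b (v 1) (R z) = b (v 0) z := fun z => by rw [← hR0, hR]
  have s2 : ∀ z, b (v 2) (R z) = b (v 1) z := fun z => by rw [← hR1, hR]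
  have s0 : ∀ z, b (v 0) (R z) = b (v 2) z + E * b (v 0) z - T * b (v 1) z := fun z => by
    have h := hR (v 2) z
    rw [hR2] at h
    simp [s1, s2] at h
    linear_combination h
  set t := R (R (R (f 2))) - E • R (R (f 2)) + T • R (f 2) - f 2 with ht
  have t0 : b (v 0) t = 0 := by
    simp [ht, s0, s1, s2, ef]
  have t1 : b (v 1) t = 0 := by
    simp [ht, s0, s1, s2, ef]
  have t2 : b (v 2) t = 0 := by
    simp [ht, s0, s1, s2, ef]
  have hts := hsp t
  simp only [Fin.sum_univ_three, t0, t1, t2, zero_smul, add_zero] at hts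
  set a0 := b t (f 0)
  set a1 := b t (f 1)
  set a2 := b t (f 2)
  set y := v 2 - (T + 1) • v 1 + (E + T + 1) • v 0 with hy
  set l := ((T - E) * (T + E + 2))⁻¹ • ((a1 + E * a0) • y + (a2 - T * a0) • R y + a0 • R (R y)) with hl
  have hpl : R (R (R l)) - E • R (R l) + T • R l - l = t := by
    rw [hts, hl, hy]
    simp only [map_smul, map_add, map_sub, hR0, hR1, hR2]
    match_scalars <;> field_simp <;> ring
  have bl : ∀ i, b (v i) l = 0 := by
    intro i
    rw [hl, hy]
    simp only [map_smul, map_add, map_sub, hR0, hR1, hR2, vv]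
    simp
  set w := f 2 - l with hw
  have bw0 : b (v 0) w = 0 := by rw [hw, map_sub, bl, ef]; simp
  have bw1 : b (v 1) w = 0 := by rw [hw, map_sub, bl, ef]; simp
  have bw2 : b (v 2) w = 1 := by rw [hw, map_sub, bl, ef]; simp
  have hpw : R (R (R w)) - E • R (R w) + T • R w = w := by
    rw [← sub_eq_zero, ← sub_eq_zero.2 hpl.symm, hw, ht]
    simp only [map_sub]
    module
  clear_value w
  set w1 := R (R w) - E • R w with hw1
  have k0 : R (R w) = E • R w + w1 := by rw [hw1]; abel
  have k1 : R w1 = -(T • R w) + w := by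
    apply eq_neg_add_of_add_eq
    rw [hw1, map_sub, map_smul, add_comm]
    exact hpw
  have i0 := hR (R w) w1
  have i1 := hR (R w) w
  have i2 := hR w1 w
  rw [k0, k1] at i0
  rw [k0] at i1
  rw [k1] at i2
  simp [hb.alt] at i0 i1 i2
  rw [hb.neg w1 (R w)] at i0 i1
  rw [hb.neg w (R w)] at i2
  have hα : b (R w) w1 = 0 := by
    have : (T - E) * b (R w) w1 = 0 := by
      linear_combination i0 + E * i1 - i1 + i2
    exact (mul_eq_zero.1 this).resolve_left hET
  have hβ : b (R w) w = 0 := by rw [← i1, hα, neg_zero]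
  have hγ : b w1 w = 0 := by rw [← i2, hβ, neg_zero]
  have hα' : b w1 (R w) = 0 := by rw [hb.neg, hα, neg_zero]
  have hβ' : b w (R w) = 0 := by rw [hb.neg, hβ, neg_zero]
  have hγ' : b w w1 = 0 := by rw [hb.neg, hγ, neg_zero]
  have hD : PI (om F 3) 3 (hyp (!![-1,0,0;E,1,0;-T,0,1] : Matrix (Fin 3) (Fin 3) F) ∘ₗ
      (hyp !![0,0,1;0,1,0;1,0,0] ∘ₗ hyp !![0,1,0;1,0,0;0,0,-1])) := by
    refine ⟨_, _, hyp_inv ?_, ⟨_, _, hyp_inv ?_, (hyp_inv ?_).pi, rfl⟩, rfl⟩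
    all_goals
      ext i j; fin_cases i <;> fin_cases j <;> simp [Matrix.mul_apply, Fin.sum_univ_three]
  refine lagr_pi hb (e := v) (f := ![R w, w1, w]) vv ?_ ?_ (by omega) hD ?_ ?_
  · intro i k
    fin_cases i <;> fin_cases k <;> simp [hb.alt, hα, hβ, hγ, hα', hβ', hγ']
  · intro i k
    fin_cases i <;> fin_cases k <;> simp [hw1, s0, s1, s2, bw0, bw1, bw2]
  · intro i
    fin_cases i <;> simp [hR0, hR1, hR2, hyp, Fin.sum_univ_three, Matrix.mulVec, dotProduct, Pi.single_apply]
    abel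
  · intro i
    fin_cases i <;> simp [k0, k1, hyp, Fin.sum_univ_three, Matrix.mulVec, dotProduct, Pi.single_apply]

end six
end SympInv



namespace SympInv

section seven
variable {F : Type u} [Field F]
variable {V : Type u} [AddCommGroup V] [Module F V] {b : V →ₗ[F] V →ₗ[F] F}

def nj (h s : F) : ((Fin 3 → F) × (Fin 3 → F)) →ₗ[F] ((Fin 3 → F) × (Fin 3 → F)) where
  toFun x := (![x.1 0, -(h⁻¹ * x.2 2), -(h * s⁻¹ * x.1 1) + h⁻¹ * x.2 1],
    ![x.2 0, h * x.1 2 - h * s⁻¹ * x.2 2, -(h * x.1 1)])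
  map_add' x y := by ext i <;> fin_cases i <;> simp <;> ring
  map_smul' c x := by ext i <;> fin_cases i <;> simp <;> ring

def ni (κ s : F) : ((Fin 3 → F) × (Fin 3 → F)) →ₗ[F] ((Fin 3 → F) × (Fin 3 → F)) where
  toFun x := (![-(κ⁻¹ * x.2 2) + s * κ⁻¹ * x.1 2, x.1 1, κ⁻¹ * x.2 0],
    ![κ * x.1 2, x.2 1, -(κ * x.1 0) + s * κ⁻¹ * x.2 0])
  map_add' x y := by ext i <;> fin_cases i <;> simp <;> ring
  map_smul' c x := by ext i <;> fin_cases i <;> simp <;> ring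

theorem nj_inv {h s : F} (hh : h ≠ 0) (hs : s ≠ 0) : Inv (om F 3) (nj h s) := by
  constructor
  · intro x y
    simp [nj, dotProduct, Fin.sum_univ_three]
    field_simp
    ring
  · intro x
    ext i <;> fin_cases i <;> simp [nj] <;> field_simp <;> ring

theorem ni_inv {κ s : F} (hh : κ ≠ 0) : Inv (om F 3) (ni κ s) := by
  constructor
  · intro x y
    simp [ni, dotProduct, Fin.sum_univ_three]
    field_simp
    ring
  · intro x
    ext i <;> fin_cases i <;> simp [ni] <;> field_simp <;> ring

theorem exN [FiniteDimensional F V] (hb : Sy b) {e f : Fin 3 → V}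
    (ee : ∀ i k, b (e i) (e k) = 0) (ff : ∀ i k, b (f i) (f k) = 0)
    (ef : ∀ i k, b (e i) (f k) = if i = k then 1 else 0) (hd : Module.finrank F V = 6)
    {h c : F} (hh : h ≠ 0) (hc : c ≠ 0) :
    ∃ N, PI b 2 N ∧ N (e 0) = c • f 2 ∧ N (e 1) = f 0 ∧ N (e 2) = h • f 1 := by
  obtain ⟨W, c', hc', hD, hdW⟩ := exists_dec hb ee ff ef
  obtain ⟨Φ, hΦ⟩ := hD.equiv hb hc' hdW
  set D := ni (-c) (h * c) ∘ₗ nj h (h * c) with hDd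
  let N : V →ₗ[F] V := Φ.toLinearMap ∘ₗ (D.prodMap LinearMap.id) ∘ₗ Φ.symm.toLinearMap
  have hN : ∀ x v, N (Phi e f W.subtype (x, v)) = Phi e f W.subtype (D x, v) := by
    intro x v
    rw [← hΦ, ← hΦ]
    simp [N]
  have hNe : ∀ i, N (e i) = Phi e f W.subtype (D (Pi.single i 1, 0), 0) := by
    intro i
    rw [← hN]; congr 1
    simp [Phi_apply, Pi.single_apply]
  refine ⟨N, ?_, ?_, ?_, ?_⟩
  · refine hD.pi hb hc' hdW (D := D) (R1 := LinearMap.id) hN ?_ (PI.one 2)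
    exact ⟨_, _, ni_inv (neg_ne_zero.2 hc), (nj_inv hh (mul_ne_zero hh hc)).pi, rfl⟩
  · rw [hNe, Phi_apply]
    simp [hDd, ni, nj, Fin.sum_univ_three]
  · rw [hNe, Phi_apply]
    simp [hDd, ni, nj, Fin.sum_univ_three]
    match_scalars <;> field_simp <;> ring
  · rw [hNe, Phi_apply]
    simp [hDd, ni, nj, Fin.sum_univ_three]

theorem exf (hb : Sy b) {M : V →ₗ[F] V} (hM : Iso b M) {n : ℕ}
    {e : Fin n → V} (ee : ∀ i k, b (e i) (e k) = 0) (G : Matrix (Fin n) (Fin n) F)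
    (hG : ∀ i k, b (e i) (M (e k)) = G i k) (hdet : IsUnit G.det) :
    ∃ f : Fin n → V, (∀ i k, b (f i) (f k) = 0) ∧
      (∀ i k, b (e i) (f k) = if i = k then 1 else 0) ∧ ∀ k, M (e k) = ∑ i, G i k • f i := by
  refine ⟨fun i => ∑ l, G⁻¹ l i • M (e l), ?_, ?_, ?_⟩
  · intro i k; simp [hM _ _, ee]
  · intro i k
    have : (G * G⁻¹) i k = (1 : Matrix (Fin n) (Fin n) F) i k := by rw [Matrix.mul_nonsing_inv _ hdet]
    rw [Matrix.mul_apply, Matrix.one_apply] at this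
    rw [← this]
    simp [hG, mul_comm]
  · intro k
    have : ∀ l, ∑ i, G⁻¹ l i * G i k = if l = k then 1 else 0 := by
      intro l
      rw [← Matrix.mul_apply, Matrix.nonsing_inv_mul _ hdet, Matrix.one_apply]
    simp only [Finset.smul_sum, smul_smul]
    rw [Finset.sum_comm]
    simp only [← Finset.sum_smul]
    simp only [mul_comm (G _ k), this]
    simp

theorem finite_quad (p q : F) : Set.Finite {t : F | t ^ 2 + p * t + q = 0} := by
  rcases Set.eq_empty_or_nonempty {t : F | t ^ 2 + p * t + q = 0} with h | ⟨r, hr⟩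
  · rw [h]; exact Set.finite_empty
  · apply Set.Finite.subset (Set.toFinite ({r, -p - r} : Set F))
    intro t ht
    have hr : r ^ 2 + p * r + q = 0 := hr
    have ht : t ^ 2 + p * t + q = 0 := ht
    have : (t - r) * (t - (-p - r)) = 0 := by linear_combination ht - hr
    rcases mul_eq_zero.1 this with h | h
    · left; exact sub_eq_zero.1 h
    · right; exact sub_eq_zero.1 h

theorem finite_lin {p : F} (hp : p ≠ 0) (q : F) : Set.Finite {t : F | p * t + q = 0} := by
  apply Set.Finite.subset (Set.toFinite ({-q / p} : Set F))
  intro t ht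
  have ht : p * t + q = 0 := ht
  rw [Set.mem_singleton_iff]
  field_simp
  linear_combination ht

theorem exW {M : V →ₗ[F] V} 
    (hno : ∀ x y, b x (M x) = 0 → b y (M y) = 0 → b x (M y) + b y (M x) = 0 → b x y = 0)
    {W : Submodule F V} {c : W →ₗ[F] W →ₗ[F] F} (hc : Sy c)
    {n : ℕ} {e f : Fin n → V} (hD : Dec b c e f W.subtype) (hW : 0 < Module.finrank F W) :
    ∃ z : W, b z (M z) ≠ 0 := by
  by_contra! hcon
  have := Module.nontrivial_of_finrank_pos hW
  obtain ⟨x, hx⟩ := exists_ne (0 : W)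
  apply hx
  apply hc.nd
  intro y
  rw [← hD.jj]
  apply hno
  · exact hcon x
  · exact hcon y
  · have := hcon (x + y)
    simp [hcon] at this
    change b x (M y) + b y (M x) = 0
    linear_combination this

end seven
end SympInv



namespace SympInv

section eight
variable {F : Type u} [Field F]
variable {V : Type u} [AddCommGroup V] [Module F V] {b : V →ₗ[F] V →ₗ[F] F}

theorem hess [Infinite F] [FiniteDimensional F V] (hb : Sy b) (h2 : (2 : F) ≠ 0)
    (hd : Module.finrank F V = 6) {M : V →ₗ[F] V} (hM : Iso b M) {x y z : V}
    (xy : b x y = 0) (xz : b x z = 0) (yz : b y z = 0)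
    (yx : b y (M x) = 0) (zx : b z (M x) = 0) (zy : b z (M y) = 0)
    {α β γ δ ε ζ : F} (hα : b x (M x) = α) (hβ : b x (M y) = β) (hγ : b x (M z) = γ)
    (hδ : b y (M y) = δ) (hε : b y (M z) = ε) (hζ : b z (M z) = ζ)
    (α0 : α ≠ 0) (δ0 : δ ≠ 0) (ζ0 : ζ ≠ 0) : PI b 5 M := by
  obtain ⟨h, hh⟩ := exists_avoid (((Set.finite_singleton (0 : F)).union
    (finite_quad (-ε) (δ * (α * δ * ζ)))).union (finite_quad ε (-(δ * (α * δ * ζ)))))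
  simp only [Set.mem_union, not_or, Set.mem_singleton_iff, Set.mem_ofPred_eq] at hh
  obtain ⟨⟨h0, h3⟩, h4⟩ := hh
  set c := α * δ * ζ / h with hc
  have D0 : α * δ * ζ ≠ 0 := mul_ne_zero (mul_ne_zero α0 δ0) ζ0
  have c0 : c ≠ 0 := div_ne_zero D0 h0
  have l1 : α / c - α * ε / (c * h) + α * δ / h ≠ 0 := by
    intro hz
    apply h3
    rw [hc] at hz
    field_simp at hz
    linear_combination hz
  have l2 : α / c + α * ε / (c * h) - α * δ / h ≠ 0 := by
    intro hz
    apply h4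
    rw [hc] at hz
    field_simp at hz
    linear_combination hz
  obtain ⟨k, hk⟩ := exists_avoid ((finite_lin l1 (β + ε / h - (β * ε / h - γ * δ / h))).union
    (finite_lin l2 (β + ε / h + (β * ε / h - γ * δ / h) + 2)))
  simp only [Set.mem_union, not_or, Set.mem_ofPred_eq] at hk
  obtain ⟨k1, k2⟩ := hk
  set T := k * α / c + β + ε / h with hT
  set E := k * α * ε / (c * h) + β * ε / h - (γ + k * α) * δ / h with hE
  have hTE : T - E ≠ 0 := by
    intro hz; apply k1; rw [← hz, hT, hE]; ring
  have hTE2 : T + E + 2 ≠ 0 := by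
    intro hz; apply k2; rw [← hz, hT, hE]; ring
  have yx' : b y x = 0 := by rw [hb.neg, xy, neg_zero]
  have zx' : b z x = 0 := by rw [hb.neg, xz, neg_zero]
  have zy' : b z y = 0 := by rw [hb.neg, yz, neg_zero]
  have ee : ∀ i j, b ((![x, y, z + k • x] : Fin 3 → V) i) ((![x, y, z + k • x] : Fin 3 → V) j) = 0 := by
    intro i j
    fin_cases i <;> fin_cases j <;> simp [hb.alt, xy, xz, yz, yx', zx', zy']
  set e : Fin 3 → V := ![x, y, z + k • x] with he
  obtain ⟨f, ff, ef, hMe⟩ := exf hb hM ee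
    (!![α, β, γ + k * α; 0, δ, ε; k * α, k * β, ζ + k * γ + k ^ 2 * α] : Matrix (Fin 3) (Fin 3) F) (by
      intro i j
      fin_cases i <;> fin_cases j <;> simp [he, hα, hβ, hγ, hδ, hε, hζ, yx, zx, zy]
      ring) (by
      rw [Matrix.det_fin_three]
      simp
      convert D0 using 1
      ring)
  obtain ⟨N, hN, N0, N1, N2⟩ := exN hb ee ff ef hd h0 c0
  have hNiso := hN.iso
  let Ne := LinearEquiv.ofInjectiveEndo N (hNiso.inj hb)
  have hNeN : ∀ x, Ne x = N x := fun x => rfl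
  let R : V →ₗ[F] V := Ne.symm.toLinearMap ∘ₗ M
  have hNR' : ∀ x, N (R x) = M x := by
    intro x; rw [← hNeN]; simp [R]
  have hRu : ∀ x y, N y = M x → R x = y := by
    intro x y h
    apply hNiso.inj hb
    rw [hNR', h]
  have hRiso : Iso b R := by
    intro x y
    rw [← hNiso, hNR', hNR', hM]
  have hMR : M = N ∘ₗ R := by ext x; simp [hNR']
  rw [hMR]
  refine PI.comp (l := 3) (k := 2) hN ?_
  have R0 : R (e 0) = (k * α / c) • e 0 + α • e 1 := by
    apply hRu
    rw [hMe]
    simp [N0, N1, Fin.sum_univ_three]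
    match_scalars <;> field_simp
  have R1 : R (e 1) = (k * β / c) • e 0 + β • e 1 + (δ / h) • e 2 := by
    apply hRu
    rw [hMe]
    simp [N0, N1, N2, Fin.sum_univ_three]
    match_scalars <;> field_simp
  have R2 : R (e 2) = ((ζ + k * γ + k ^ 2 * α) / c) • e 0 + (γ + k * α) • e 1 + (ε / h) • e 2 := by
    apply hRu
    rw [hMe]
    simp [N0, N1, N2, Fin.sum_univ_three]
    match_scalars <;> field_simp
  clear_value e
  have v1 := R0
  have v2 : R (R (e 0)) = ((k * α / c) * (k * α / c) + α * (k * β / c)) • e 0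
      + ((k * α / c) * α + α * β) • e 1 + (α * (δ / h)) • e 2 := by
    rw [R0]; simp only [map_add, map_smul, R0, R1]
    module
  have v3 : R (R (R (e 0))) = e 0 - E • R (e 0) + T • R (R (e 0)) := by
    rw [v2, v1]; simp only [map_add, map_smul, R0, R1, R2]
    rw [hT, hE, hc]
    match_scalars <;> field_simp <;> ring
  refine lemT3 hb h2 hd hRiso (v := ![e 0, R (e 0), R (R (e 0))]) (T := T) (E := E) ?_ ?_ rfl rfl
    v3 hTE hTE2
  · rw [Fintype.linearIndependent_iff]
    intro g hg
    simp only [Fin.sum_univ_three] at hg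
    simp [R0, R1] at hg
    have p0 := congrArg (fun w => b w (f 0)) hg
    have p1 := congrArg (fun w => b w (f 1)) hg
    have p2 := congrArg (fun w => b w (f 2)) hg
    simp [ef] at p0 p1 p2
    have g2 : g 2 = 0 := by simpa [α0, δ0, h0] using p2
    have g1 : g 1 = 0 := by simpa [g2, α0] using p1
    have g0 : g 0 = 0 := by simpa [g2, g1] using p0
    intro i
    fin_cases i <;> assumption
  · intro i j
    fin_cases i <;> fin_cases j <;> simp [R0, R1, ee]

theorem base [Infinite F] (h2 : (2 : F) ≠ 0) (V : Type u) [AddCommGroup V] [Module F V]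
    [FiniteDimensional F V] (b : V →ₗ[F] V →ₗ[F] F) (M : V →ₗ[F] V) (hb : Sy b)
    (hd : Module.finrank F V = 6) (hM : Iso b M) : PI b 5 M := by
  by_cases hno : ∀ x y, b x (M x) = 0 → b y (M y) = 0 → b x (M y) + b y (M x) = 0 → b x y = 0
  swap
  · push Not at hno
    obtain ⟨x, y, q1, q2, q3, q4⟩ := hno
    exact lemD hb h2 hd hM q1 q2 q3 q4
  rcases exists_q hb hM with h | ⟨x, hx⟩
  · exact h.pi.mono (by norm_num)
  obtain ⟨W, c, hc, hD, hdW⟩ := exists_dec (n := 1) (e := fun _ => x)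
    (f := fun _ => (b x (M x))⁻¹ • M x) hb
    (fun _ _ => hb.alt _) (fun _ _ => by simp [hb.alt]) (fun i k => by
      rw [Subsingleton.elim i k]; simp [hx])
  obtain ⟨y, hy⟩ := exW hno hc hD (by omega)
  have xy : b x y = 0 := hD.ej 0 y
  have yx : b y (M x) = 0 := by
    have := hD.jf hb 0 y
    simpa [hx] using this
  have yx' : b y x = 0 := by rw [hb.neg, xy, neg_zero]
  have ee : ∀ i j, b ((![x, y] : Fin 2 → V) i) ((![x, y] : Fin 2 → V) j) = 0 := by
    intro i j
    fin_cases i <;> fin_cases j <;> simp [hb.alt, xy, yx']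
  obtain ⟨f, ff, ef, hMe⟩ := exf hb hM ee
    (!![b x (M x), b x (M y); 0, b y (M y)] : Matrix (Fin 2) (Fin 2) F) (by
      intro i j
      fin_cases i <;> fin_cases j <;> simp [yx]) (by
      rw [Matrix.det_fin_two]
      simp [hx, hy])
  obtain ⟨W', c', hc', hD', hdW'⟩ := exists_dec hb ee ff ef
  obtain ⟨z, hz⟩ := exW hno hc' hD' (by omega)
  have xz : b x z = 0 := hD'.ej 0 z
  have yz : b y z = 0 := hD'.ej 1 z
  have z0 : b z (f 0) = 0 := hD'.jf hb 0 z
  have z1 : b z (f 1) = 0 := hD'.jf hb 1 z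
  have zx : b z (M x) = 0 := by
    have := hMe 0
    simp [Fin.sum_univ_two] at this
    rw [this]; simp [z0]
  have zy : b z (M y) = 0 := by
    have := hMe 1
    simp [Fin.sum_univ_two] at this
    rw [this]; simp [z0, z1]
  exact hess hb h2 hd hM xy xz yz yx zx zy rfl rfl rfl rfl rfl rfl hx hy hz

theorem odd_thm [Infinite F] (h2 : (2 : F) ≠ 0) (n : ℕ) (V : Type u) [AddCommGroup V] [Module F V]
    [FiniteDimensional F V] (b : V →ₗ[F] V →ₗ[F] F) (M : V →ₗ[F] V) (hb : Sy b)
    (hd : Module.finrank F V = 4 * n + 6) (hM : Iso b M) : PI b 5 M :=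
  induct (by norm_num) (base h2) n V b M hb hd hM

theorem PI.mat {ι : Type} [Fintype ι] [DecidableEq ι] {b : (ι → F) →ₗ[F] (ι → F) →ₗ[F] F}
    {J : Matrix ι ι F} (hJ : ∀ x y, b x y = x ⬝ᵥ J.mulVec y) {f : (ι → F) →ₗ[F] (ι → F)}
    (hf : Inv b f) : (LinearMap.toMatrix' f).transpose * J * LinearMap.toMatrix' f = J ∧
      LinearMap.toMatrix' f ^ 2 = 1 := by
  constructor
  · ext i j
    have := hf.1 (Pi.single i 1) (Pi.single j 1)
    rw [hJ, hJ] at this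
    conv_rhs at this => rw [Matrix.mulVec_single_one, single_one_dotProduct]
    rw [← LinearMap.toMatrix'_mulVec, ← LinearMap.toMatrix'_mulVec] at this
    rw [← Matrix.vecMul_transpose, Matrix.dotProduct_mulVec, Matrix.vecMul_vecMul,
      Matrix.dotProduct_mulVec, Matrix.vecMul_vecMul, ← Matrix.dotProduct_mulVec,
      Matrix.mulVec_single_one, single_one_dotProduct] at this
    exact this
  · rw [pow_two, ← LinearMap.toMatrix'_comp, ← LinearMap.toMatrix'_id]
    congr 1
    exact LinearMap.ext hf.2

end eight
end SympInv


theorem symplectic_product_of_five_involutions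
    (F : Type*) [Field F] [Infinite F] (hF : ringChar F ≠ 2)
    (m : ℕ) (hm : 3 ≤ m) (hmodd : Odd m)
    (M : Matrix (Fin m ⊕ Fin m) (Fin m ⊕ Fin m) F)
    (hM : M ∈ Matrix.symplecticGroup (Fin m) F) :
    ∃ A₁ A₂ A₃ A₄ A₅ : Matrix (Fin m ⊕ Fin m) (Fin m ⊕ Fin m) F,
      A₁ ∈ Matrix.symplecticGroup (Fin m) F ∧
      A₂ ∈ Matrix.symplecticGroup (Fin m) F ∧
      A₃ ∈ Matrix.symplecticGroup (Fin m) F ∧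
      A₄ ∈ Matrix.symplecticGroup (Fin m) F ∧
      A₅ ∈ Matrix.symplecticGroup (Fin m) F ∧
      A₁ ^ 2 = 1 ∧ A₂ ^ 2 = 1 ∧ A₃ ^ 2 = 1 ∧ A₄ ^ 2 = 1 ∧ A₅ ^ 2 = 1 ∧
      M = A₁ * A₂ * A₃ * A₄ * A₅ := by
  have h2 : (2 : F) ≠ 0 := Ring.two_ne_zero hF
  let b : (Fin m ⊕ Fin m → F) →ₗ[F] (Fin m ⊕ Fin m → F) →ₗ[F] F := Matrix.toLinearMap₂' F (Matrix.J (Fin m) F)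
  have hJ : ∀ x y, b x y = x ⬝ᵥ (Matrix.J (Fin m) F).mulVec y := fun x y =>
    Matrix.toLinearMap₂'_apply' _ _ _
  have hb : SympInv.Sy b := by
    refine ⟨fun x => ?_, fun x hx => ?_⟩
    · have h1 : b x x = - b x x := by
        conv_lhs => rw [hJ, Matrix.dotProduct_mulVec, ← Matrix.mulVec_transpose, Matrix.J_transpose,
          Matrix.neg_mulVec, neg_dotProduct, dotProduct_comm]
        rw [hJ]
      have : 2 * b x x = 0 := by linear_combination h1
      exact (mul_eq_zero.1 this).resolve_left h2
    · have h1 : ∀ y, Matrix.vecMul x (Matrix.J (Fin m) F) ⬝ᵥ y = 0 := fun y => by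
        rw [← Matrix.dotProduct_mulVec, ← hJ, hx]
      have h3 : Matrix.vecMul x (Matrix.J (Fin m) F) = 0 := dotProduct_eq_zero _ h1
      have h4 : Matrix.vecMul (Matrix.vecMul x (Matrix.J (Fin m) F)) (Matrix.J (Fin m) F) = 0 := by
        rw [h3, Matrix.zero_vecMul]
      rw [Matrix.vecMul_vecMul, Matrix.J_squared] at h4
      simpa [Matrix.vecMul_neg] using h4
  have hMiso : SympInv.Iso b M.mulVecLin := by
    intro x y
    rw [SymplecticGroup.mem_iff'] at hM
    rw [hJ, hJ, Matrix.mulVecLin_apply, Matrix.mulVecLin_apply, ← Matrix.vecMul_transpose,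
      ← Matrix.dotProduct_mulVec, Matrix.mulVec_mulVec, Matrix.mulVec_mulVec, hM]
  obtain ⟨n, hn⟩ := hmodd
  have hpi := SympInv.odd_thm h2 (n - 1) _ b M.mulVecLin hb (by simp; omega) hMiso
  obtain ⟨g1, k1, i1, ⟨g2, k2, i2, ⟨g3, k3, i3, ⟨g4, k4, i4, ⟨g5, k5, i5, hk5, e5⟩, e4⟩, e3⟩, e2⟩, e1⟩ := hpi
  have hk5 : k5 = LinearMap.id := hk5
  have hmem : ∀ {f}, SympInv.Inv b f → LinearMap.toMatrix' f ∈ Matrix.symplecticGroup (Fin m) F :=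
    fun hf => SymplecticGroup.mem_iff'.2 (SympInv.PI.mat hJ hf).1
  refine ⟨_, _, _, _, _, hmem i1, hmem i2, hmem i3, hmem i4, hmem i5, (SympInv.PI.mat hJ i1).2,
    (SympInv.PI.mat hJ i2).2, (SympInv.PI.mat hJ i3).2, (SympInv.PI.mat hJ i4).2,
    (SympInv.PI.mat hJ i5).2, ?_⟩
  calc M = LinearMap.toMatrix' M.mulVecLin := (LinearMap.toMatrix'_toLin' M).symm
    _ = _ := by
      rw [e1, e2, e3, e4, e5, hk5]
      simp only [LinearMap.toMatrix'_comp, LinearMap.toMatrix'_id, mul_one, mul_assoc]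
end

section
/- Let F be a field of characteristic not 2 and let m be an integer with m ≥ 2. Then there exists an element M of the symplectic group Sp_{2m}(F) that is not a product of three involutions of Sp_{2m}(F): there do not exist A1, A2, A3 in Sp_{2m}(F) with Ai^2 = 1 for each i and M = A1*A2*A3. -/
open Matrix in
theorem three_inv_aux {F : Type*} [Field F] {V : Type*} [AddCommGroup V] [Module F V]
    (h2 : (2 : F) ≠ 0) (B : V →ₗ[F] V →ₗ[F] F) (hB : ∀ x, B x x = 0)
    (hnd : ∀ x, (∀ y, B x y = 0) → x = 0)
    (a b s : V →ₗ[F] V) (ha : ∀ x, a (a x) = x) (hb : ∀ x, b (b x) = x) (hs : ∀ x, s (s x) = x)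
    (pa : ∀ x y, B (a x) (a y) = B x y) (ps : ∀ x y, B (s x) (s y) = B x y)
    (u : V) (ht : ∀ x, a (b (s x)) = x + B u x • u) : u + s u = 0 := by
  by_contra hf
  have hanti : ∀ x y, B x y = - B y x := by
    intro x y
    have h := hB (x + y)
    simp only [map_add, LinearMap.add_apply, hB] at h
    linear_combination h
  have sa : ∀ x y, B (s x) y = B x (s y) := fun x y => by rw [← ps x (s y), hs]
  have aa : ∀ x y, B (a x) y = B x (a y) := fun x y => by rw [← pa x (a y), ha]
  have hN : ∀ x, b x = a (s x) + B u (s x) • a u := by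
    intro x
    have h := ht (s x)
    rw [hs] at h
    rw [← ha (b x), h, map_add, map_smul]
  have hN' : ∀ x, b (a x) = s x - B u x • s u := by
    intro x
    have h := ht (x - B u x • u)
    have h3 : a (b (s (x - B u x • u))) = x := by
      rw [h]; simp [hB]
    have h4 : s (x - B u x • u) = b (a x) := by
      rw [← hb (s (x - B u x • u)), ← ha (b (s _)), h3]
    rw [← h4, map_sub, map_smul]
  have E1 : ∀ x, a (s x) + B u (s x) • a u = s (a x) - B u (a x) • s u := by
    intro x
    rw [← hN, ← hN', ha]
  have E2 : ∀ x, a (s x) - B u x • a (s u) = s (a x) + B u (s (a x)) • u := by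
    intro x
    have h := congrArg a (hN (a x))
    rw [hN'] at h
    simpa [ha] using h
  have hus : B u (s u) = 0 := by
    have h1 := sa u u
    have h2' := hanti (s u) u
    have : (2 : F) * B u (s u) = 0 := by linear_combination h2' - h1
    exact (mul_eq_zero.mp this).resolve_left h2
  obtain ⟨y, hy⟩ : ∃ y, B (u + s u) y ≠ 0 := by
    by_contra! h
    exact hf (hnd _ h)
  set w := y + s y with hw
  have hsw : s w = w := by rw [hw, map_add, hs, add_comm]
  have hc : B u w ≠ 0 := by
    have : B u w = B (u + s u) y := by simp [hw, sa]
    rwa [this]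
  set f := u + s u with hfd
  have hsf : s f = f := by rw [hfd, map_add, hs, add_comm]
  clear_value w f
  have E4 : B u w • a f = -(B u (a w)) • s u - B u (s (a w)) • u := by
    have e1 := E1 w
    have e2 := E2 w
    rw [hsw] at e1 e2
    rw [hfd, map_add, smul_add]
    linear_combination (norm := module) e1 - e2
  have huf : B u f = 0 := by simp [hfd, hB, hus]
  have huaf : B u (a f) = 0 := by
    have h := congrArg (B u) E4
    simp only [map_sub, map_smul, hus, hB, smul_eq_mul, mul_zero, sub_zero] at h
    exact (mul_eq_zero.mp h).resolve_left hc
  have hsaf : s (a f) = a f := by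
    have h := E1 f
    rw [hsf, huf, huaf] at h
    simpa using h.symm
  have E5 : (2 * B u w) • a f = (-(B u (a w)) - B u (s (a w))) • f := by
    have h := congrArg s E4
    simp only [map_sub, map_smul, hs, hsaf] at h
    have h5 : (-(B u (a w)) - B u (s (a w))) • f = (-(B u (a w)) - B u (s (a w))) • (u + s u) := by
      rw [← hfd]
    rw [h5]
    linear_combination (norm := module) E4 + h
  have E6 : -(B u (a w)) - B u (s (a w)) = - B (a f) w := by
    rw [aa, hfd, map_add, LinearMap.add_apply, sa]; ring
  have hfw : B f w = 2 * B u w := by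
    rw [hfd, map_add, LinearMap.add_apply, sa, hsw]; ring
  have E7 := congrArg (fun z => B z w) E5
  simp only [map_smul, LinearMap.smul_apply, smul_eq_mul, E6, hfw] at E7
  have h8 : B (a f) w = 0 := by
    have : (2 * 2 * B u w) * B (a f) w = 0 := by linear_combination E7
    exact (mul_eq_zero.mp this).resolve_left (mul_ne_zero (mul_ne_zero h2 h2) hc)
  rw [E6, h8, neg_zero, zero_smul] at E5
  have h9 : a f = 0 := (smul_eq_zero.mp E5).resolve_left (mul_ne_zero h2 hc)
  exact hf (by rw [← ha f, h9, map_zero])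

/-- If `F` is a field of characteristic not 2 and `m ≥ 2`, then there exists an element
of the symplectic group `Sp_{2m}(F)` that is not a product of three involutions of
`Sp_{2m}(F)`. -/
theorem exists_symplectic_not_product_of_three_involutions
    (F : Type*) [Field F] (hF : ringChar F ≠ 2)
    (m : ℕ) (hm : 2 ≤ m) :
    ∃ M ∈ Matrix.symplecticGroup (Fin m) F,
      ¬ ∃ A₁ A₂ A₃ : Matrix (Fin m ⊕ Fin m) (Fin m ⊕ Fin m) F,
        A₁ ∈ Matrix.symplecticGroup (Fin m) F ∧
        A₂ ∈ Matrix.symplecticGroup (Fin m) F ∧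
        A₃ ∈ Matrix.symplecticGroup (Fin m) F ∧
        A₁ ^ 2 = 1 ∧ A₂ ^ 2 = 1 ∧ A₃ ^ 2 = 1 ∧
        M = A₁ * A₂ * A₃ := by
  have h2 : (2 : F) ≠ 0 := Ring.two_ne_zero hF
  set J := Matrix.J (Fin m) F with hJ
  have hJt : J.transpose = -J := Matrix.J_transpose _ _
  have hJJ : J * J = -1 := Matrix.J_squared _ _
  let B : (Fin m ⊕ Fin m → F) →ₗ[F] (Fin m ⊕ Fin m → F) →ₗ[F] F := Matrix.toLinearMap₂' F J
  have hBd : ∀ x y, B x y = x ⬝ᵥ (J.mulVec y) := fun x y => Matrix.toLinearMap₂'_apply' J x y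
  have hanti : ∀ x y, B x y = - B y x := by
    intro x y
    rw [hBd, hBd, Matrix.dotProduct_mulVec, ← Matrix.mulVec_transpose, hJt, Matrix.neg_mulVec,
      neg_dotProduct, dotProduct_comm]
  have hB : ∀ x, B x x = 0 := by
    intro x
    have : (2 : F) * B x x = 0 := by linear_combination hanti x x
    exact (mul_eq_zero.mp this).resolve_left h2
  have hnd : ∀ x, (∀ y, B x y = 0) → x = 0 := by
    intro x h
    refine dotProduct_eq_zero x fun y => ?_
    have := h (-(J.mulVec y))
    rw [hBd, Matrix.mulVec_neg, Matrix.mulVec_mulVec, hJJ] at this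
    simpa [Matrix.neg_mulVec] using this
  have hpres : ∀ A ∈ Matrix.symplecticGroup (Fin m) F, ∀ x y,
      B (A.mulVecLin x) (A.mulVecLin y) = B x y := by
    intro A hA x y
    rw [SymplecticGroup.mem_iff', ← hJ] at hA
    rw [hBd, hBd, Matrix.mulVecLin_apply, Matrix.mulVecLin_apply]
    conv_rhs => rw [← hA, ← Matrix.mulVec_mulVec, ← Matrix.mulVec_mulVec,
      Matrix.dotProduct_mulVec x, Matrix.vecMul_transpose]
  have hinv : ∀ A : Matrix (Fin m ⊕ Fin m) (Fin m ⊕ Fin m) F, A ^ 2 = 1 →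
      ∀ x, A.mulVecLin (A.mulVecLin x) = x := by
    intro A hA x
    rw [Matrix.mulVecLin_apply, Matrix.mulVecLin_apply, Matrix.mulVec_mulVec, ← sq, hA,
      Matrix.one_mulVec]
  let u : Fin m ⊕ Fin m → F := fun _ => 1
  have hu : u ≠ 0 := fun h => one_ne_zero (congrFun h (Sum.inl ⟨0, by omega⟩))
  let M := 1 + Matrix.vecMulVec u (Matrix.vecMul u J)
  have hM : ∀ x, M.mulVec x = x + B u x • u := by
    intro x
    simp only [M]
    rw [Matrix.add_mulVec, Matrix.one_mulVec, Matrix.vecMulVec_mulVec, hBd,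
      Matrix.dotProduct_mulVec]
    simp
  refine ⟨M, ?_, ?_⟩
  · rw [SymplecticGroup.mem_iff', ← hJ]
    apply (Matrix.toLinearMap₂' F : Matrix (Fin m ⊕ Fin m) (Fin m ⊕ Fin m) F ≃ₗ[F]
      ((Fin m ⊕ Fin m → F) →ₗ[F] (Fin m ⊕ Fin m → F) →ₗ[F] F)).injective
    refine LinearMap.ext fun x => LinearMap.ext fun y => ?_
    rw [Matrix.toLinearMap₂'_apply', ← Matrix.mulVec_mulVec, ← Matrix.mulVec_mulVec,
      Matrix.dotProduct_mulVec, Matrix.vecMul_transpose, ← hBd, hM, hM]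
    change _ = B x y
    simp only [map_add, map_smul, LinearMap.add_apply, LinearMap.smul_apply, smul_eq_mul, hB]
    rw [hanti x u]; ring
  · rintro ⟨A, C, S, hA, hC, hS, iA, iC, iS, h⟩
    have key : ∀ x, A.mulVec (C.mulVec (S.mulVec x)) = x + B u x • u := by
      intro x
      rw [← hM, h, Matrix.mulVec_mulVec, Matrix.mulVec_mulVec]
    have h1 := three_inv_aux h2 B hB hnd A.mulVecLin C.mulVecLin S.mulVecLin (hinv _ iA)
      (hinv _ iC) (hinv _ iS) (hpres _ hA) (hpres _ hS) u key
    have h3 := three_inv_aux h2 B hB hnd (-A).mulVecLin C.mulVecLin (-S).mulVecLin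
      (hinv _ (by rwa [neg_sq])) (hinv _ iC) (hinv _ (by rwa [neg_sq]))
      (hpres _ (SymplecticGroup.neg_mem hA)) (hpres _ (SymplecticGroup.neg_mem hS)) u
      (fun x => by
        rw [← key]
        simp [Matrix.neg_mulVec, Matrix.mulVec_neg])
    simp only [Matrix.mulVecLin_apply, Matrix.neg_mulVec] at h1 h3
    have h4 : (2 : F) • u = 0 := by
      rw [two_smul]
      linear_combination (norm := module) h1 + h3
    exact hu ((smul_eq_zero.mp h4).resolve_left h2)
end

section
/- Let F be a field of characteristic not 2, let a ∈ F with a ≠ 2 and a ≠ -2, and set p = X^2 + a*X + 1 (a monic palindromial of degree 2 with no root in {1, -1}). Let m ≥ 2 and let M be an element of the symplectic group Sp_{2m}(F) whose minimal polynomial equals (X - 1)*p and such that the kernel of p(M) (the matrix obtained by evaluating p at M) has dimension 2 over F. Then M is not a product of three involutions of Sp_{2m}(F). -/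
open Polynomial

lemma skew_aux {K n : Type*} [Field K] [Fintype n] [DecidableEq n] (h2 : (2 : K) ≠ 0)
    (hn : Even (Fintype.card n)) (A : Matrix n n K) (hA : A.transpose = -A)
    (v : n → K) (hv : v ≠ 0) (hAv : A.mulVec v = 0)
    (hk : ∀ y, A.mulVec y = 0 → ∃ c : K, y = c • v) : False := by
  obtain ⟨i, hi⟩ := Function.ne_iff.mp hv
  let w : n → K := Pi.single i 1
  let Q : Matrix (n ⊕ Unit) (n ⊕ Unit) K :=
    Matrix.fromBlocks A (Matrix.replicateCol Unit w) (-(Matrix.replicateRow Unit w)) 0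
  have hQ : Q.transpose = -Q := by
    simp only [Q, Matrix.fromBlocks_transpose, Matrix.fromBlocks_neg, hA]
    simp
  have hdet : Q.det = 0 := by
    have h1 : Q.det = -Q.det := by
      conv_lhs => rw [← Matrix.det_transpose, hQ, Matrix.det_neg]
      have : Odd (Fintype.card (n ⊕ Unit)) := by simpa using hn.add_one
      rw [this.neg_one_pow]; ring
    have h3 : (2 : K) * Q.det = 0 := by linear_combination h1
    exact (mul_eq_zero.mp h3).resolve_left h2
  obtain ⟨z, hz, hQz⟩ := Matrix.exists_mulVec_eq_zero_iff.mpr hdet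
  set y : n → K := fun j => z (Sum.inl j) with hy
  set s : K := z (Sum.inr ()) with hs
  have e1 : A.mulVec y + s • w = 0 := by
    funext j
    have := congrFun hQz (Sum.inl j)
    simp only [Q, Matrix.mulVec, dotProduct, Fintype.sum_sum_type, Matrix.fromBlocks_apply₁₁,
      Matrix.fromBlocks_apply₁₂] at this
    simp [Matrix.mulVec, dotProduct] at this ⊢
    linear_combination this
  have e2 : y i = 0 := by
    have := congrFun hQz (Sum.inr ())
    simp only [Q, Matrix.mulVec, dotProduct, Fintype.sum_sum_type, Matrix.fromBlocks_apply₂₁,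
      Matrix.fromBlocks_apply₂₂] at this
    simpa [w, Pi.single_apply] using this
  have hs0 : s = 0 := by
    have h1 : dotProduct v (A.mulVec y) = 0 := by
      rw [Matrix.dotProduct_mulVec, ← Matrix.mulVec_transpose, hA, Matrix.neg_mulVec, hAv]; simp
    have h3 : dotProduct v (A.mulVec y + s • w) = 0 := by rw [e1]; simp
    rw [dotProduct_add, h1] at h3
    simp [w] at h3
    exact h3.resolve_right hi
  have e3 : A.mulVec y = 0 := by simpa [hs0] using e1
  obtain ⟨c, hc⟩ := hk y e3
  have hc0 : c = 0 := by
    rw [hc] at e2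
    simpa [show v i ≠ 0 from hi] using e2
  apply hz
  funext j
  rcases j with j | j
  · have := congrFun hc j
    simpa [hc0, hy] using this
  · simpa [hs] using hs0

lemma ker_aux {K V : Type*} [Field K] [AddCommGroup V] [Module K V]
    (h2 : (2 : K) ≠ 0) (ω : V →ₗ[K] V →ₗ[K] K) (hω : ∀ u v, ω u v = - ω v u)
    (hnd : ∀ u, (∀ v, ω v u = 0) → u = 0)
    (M S : V →ₗ[K] V) (hM : ∀ u v, ω (M u) (M v) = ω u v)
    (hS : ∀ u v, ω (S u) v = ω u (S v)) (hS2 : ∀ u, S (S u) = u)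
    (l r : K) (hlr : l * r = 1) (hl1 : l ≠ 1) (hl2 : l ≠ -1)
    (e f : V) (he : e ≠ 0) (hf : f ≠ 0) (hMe : M e = l • e) (hMf : M f = r • f)
    (hsp : ∀ v, ∃ α β : K, M v - v = α • e + β • f)
    (hx : ∀ t : K, ∃ x : K, x ^ 2 - 1 = (l - 1) * (t * x + 1) ∧ x ^ 2 ≠ 1) :
    ∃ (x : K) (v : V), v ≠ 0 ∧ M (S v) = x • v ∧ ∀ y, M (S y) = x • y → ∃ c : K, y = c • v := by
  have halt : ∀ u, ω u u = 0 := fun u => by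
    have := hω u u
    have h3 : (2 : K) * ω u u = 0 := by linear_combination this
    exact (mul_eq_zero.mp h3).resolve_left h2
  have hl0 : l ≠ 0 := left_ne_zero_of_mul_eq_one hlr
  have hr0 : r ≠ 0 := right_ne_zero_of_mul_eq_one hlr
  have hr1 : r ≠ 1 := by rintro rfl; apply hl1; simpa using hlr
  have hne : l ≠ r := by
    rintro rfl
    have : (l - 1) * (l + 1) = 0 := by linear_combination hlr
    rcases mul_eq_zero.mp this with h | h
    · exact hl1 (by linear_combination h)
    · exact hl2 (by linear_combination h)
  have hMf' : ∀ v, ω (M v) f = l * ω v f := fun v => by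
    have := hM v f
    rw [hMf] at this
    simp at this
    linear_combination l * this - ω (M v) f * hlr
  have hMe' : ∀ v, ω (M v) e = r * ω v e := fun v => by
    have := hM v e
    rw [hMe] at this
    simp at this
    linear_combination r * this - ω (M v) e * hlr
  have cf : ∀ v (α β : K), M v - v = α • e + β • f → (l - 1) * ω v f = α * ω e f := fun v α β h => by
    have h3 := congrArg (fun z => ω z f) h
    simp [hMf', halt] at h3
    linear_combination h3
  have ce : ∀ v (α β : K), M v - v = α • e + β • f → (r - 1) * ω v e = - β * ω e f := fun v α β h => by
    have h3 := congrArg (fun z => ω z e) h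
    simp [hMe', halt] at h3
    linear_combination h3 + β * hω f e
  have hd : ω e f ≠ 0 := fun h0 => by
    apply hf
    apply hnd
    intro v
    obtain ⟨α, β, h⟩ := hsp v
    have := cf v α β h
    rw [h0, mul_zero] at this
    exact (mul_eq_zero.mp this).resolve_left (sub_ne_zero.mpr hl1)
  have hSalt : ∀ u, ω (S u) u = 0 := fun u => by
    have h3 : (2 : K) * ω (S u) u = 0 := by linear_combination hS u u + hω u (S u)
    exact (mul_eq_zero.mp h3).resolve_left h2
  obtain ⟨t, ht⟩ : ∃ t, ω (S e) f = t * ω e f := ⟨ω (S e) f / ω e f, by field_simp⟩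
  have ht' : ω (S f) e = - t * ω e f := by
    rw [hS, hω, ht]; ring
  obtain ⟨x, hx1, hx2⟩ := hx t
  have hx3 : x ^ 2 - 1 ≠ 0 := sub_ne_zero.mpr hx2
  have htx : t * x + 1 ≠ 0 := fun h => hx3 (by rw [hx1, h, mul_zero])
  -- general formula for the kernel
  have key : ∀ y, M (S y) = x • y → ∀ α β : K, M (S y) - S y = α • e + β • f →
      (x ^ 2 - 1) • y = α • (x • e + S e) + β • (x • f + S f) := by
    intro y hy α β h
    rw [hy] at h
    have h' := congrArg S h
    simp only [map_sub, map_smul, map_add, hS2] at h'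
    have : (x ^ 2 - 1) • y = x • (x • y - S y) + (x • S y - y) := by module
    rw [this, h, h']; module
  refine ⟨x, x • e + S e, ?_, ?_, ?_⟩
  · intro h0
    have h' := congrArg S h0
    simp only [map_smul, map_add, hS2, map_zero] at h'
    have : (x ^ 2 - 1) • e = 0 := by
      have : (x ^ 2 - 1) • e = x • (x • e + S e) - (x • S e + e) := by module
      rw [this, h0, h']; simp
    exact (smul_ne_zero hx3 he) this
  · have hSv : S (x • e + S e) = x • S e + e := by simp [hS2]
    rw [hSv]
    obtain ⟨α, β, h⟩ := hsp (x • S e + e)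
    have h1 := cf _ _ _ h
    have h3 := ce _ _ _ h
    simp [ht, hSalt, halt, hd] at h1 h3
    have hα : α = x ^ 2 - 1 := by
      apply mul_right_cancel₀ hd
      rw [hx1]; linear_combination -h1
    rw [sub_eq_iff_eq_add] at h
    rw [h, h3, hα]; module
  · intro y hy
    obtain ⟨α, β, h⟩ := hsp (S y)
    have k := key y hy α β h
    have h1 := ce _ _ _ h
    have k' := congrArg (fun z => ω (S z) e) k
    simp [hS2, hSalt, halt, ht', hω f e] at k'
    have hβ : β = 0 := by
      by_contra hb
      have h3 : (l - r) * (t * x + 1) * β * ω e f = 0 := by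
        have : (r-1) * ((x^2-1) * ω (S y) e) = (r - 1) * (- β * (t * x + 1) * ω e f) := by
          rw [k']; ring
        rw [hx1] at this
        linear_combination (-1) * this + (l-1) * (t*x+1) * h1
      simp [sub_eq_zero, hne, htx, hb, hd] at h3
    refine ⟨(x ^ 2 - 1)⁻¹ * α, ?_⟩
    rw [hβ, zero_smul, add_zero] at k
    rw [mul_smul, ← k, smul_smul, inv_mul_cancel₀ hx3, one_smul]

lemma quad_aux {K : Type*} [Field K] [IsAlgClosed K] (h2 : (2 : K) ≠ 0) (b c : K) :
    ∃ x : K, x ^ 2 + b * x + c = 0 := by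
  obtain ⟨s, hs⟩ := IsAlgClosed.exists_pow_nat_eq (b ^ 2 - 4 * c) (n := 2) (by norm_num)
  refine ⟨(s - b) / 2, ?_⟩
  field_simp
  linear_combination hs

lemma x_aux {K : Type*} [Field K] [IsAlgClosed K] (h2 : (2 : K) ≠ 0) (l : K)
    (hl1 : l ≠ 1) (hl2 : l ≠ -1) (t : K) :
    ∃ x : K, x ^ 2 - 1 = (l - 1) * (t * x + 1) ∧ x ^ 2 ≠ 1 := by
  have hl : l ^ 2 ≠ 1 := by
    intro h; rcases (sq_eq_sq_iff_eq_or_eq_neg.mp (h.trans (one_pow 2).symm)) with h | h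
    · exact hl1 h
    · exact hl2 h
  by_cases h1 : t = 1
  · exact ⟨l, by rw [h1]; ring, hl⟩
  by_cases h1' : t = -1
  · exact ⟨-l, by rw [h1']; ring, by simpa using hl⟩
  obtain ⟨x, hx⟩ := quad_aux h2 (-((l - 1) * t)) (-l)
  refine ⟨x, by linear_combination hx, ?_⟩
  intro h
  rcases (sq_eq_sq_iff_eq_or_eq_neg.mp (h.trans (one_pow 2).symm)) with rfl | rfl
  · have : (l - 1) * (t + 1) = 0 := by linear_combination -hx
    rcases mul_eq_zero.mp this with h | h
    · exact hl1 (by linear_combination h)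
    · exact h1' (by linear_combination h)
  · have : (l - 1) * (t - 1) = 0 := by linear_combination hx
    rcases mul_eq_zero.mp this with h | h
    · exact hl1 (by linear_combination h)
    · exact h1 (by linear_combination h)

lemma factor_aux {F n : Type*} [Field F] [Fintype n] [DecidableEq n] (M P : Matrix n n F)
    (h : P * (M - 1) = 0)
    (hker : Module.finrank F (LinearMap.ker (Matrix.mulVecLin P)) = 2) :
    ∃ (B : Matrix n (Fin 2) F) (C : Matrix (Fin 2) n F), M - 1 = B * C := by
  let b := Module.finBasisOfFinrankEq F _ hker
  have hmem : ∀ j, (M - 1).col j ∈ LinearMap.ker (Matrix.mulVecLin P) := by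
    intro j
    rw [LinearMap.mem_ker, Matrix.mulVecLin_apply]
    funext i
    exact congrFun (congrFun h i) j
  refine ⟨Matrix.of fun i k => (b k).1 i, Matrix.of fun k j => b.repr ⟨_, hmem j⟩ k, ?_⟩
  ext i j
  have := congrArg (fun z => z.1 i) (b.sum_repr ⟨_, hmem j⟩)
  simp only [Fin.sum_univ_two, Submodule.coe_add, Submodule.coe_smul, Pi.add_apply,
    Pi.smul_apply, smul_eq_mul, Matrix.col_apply] at this
  rw [← this, Matrix.mul_apply, Fin.sum_univ_two]
  simp only [Matrix.of_apply]
  ring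

lemma eig_aux {F K n : Type*} [Field F] [Field K] [Algebra F K] [Fintype n] [DecidableEq n]
    (M : Matrix n n F) (l : K) (h : aeval l (minpoly F M) = 0) :
    ∃ e : n → K, e ≠ 0 ∧ (M.map (algebraMap F K)).mulVec e = l • e := by
  obtain ⟨q, hq⟩ := Matrix.minpoly_dvd_charpoly M
  have h1 : ((M.map (algebraMap F K)).charpoly).eval l = 0 := by
    rw [Matrix.charpoly_map, eval_map_algebraMap, hq, map_mul, h, zero_mul]
  rw [Matrix.eval_charpoly] at h1
  obtain ⟨e, he, h3⟩ := Matrix.exists_mulVec_eq_zero_iff.mpr h1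
  refine ⟨e, he, ?_⟩
  rw [Matrix.sub_mulVec, sub_eq_zero] at h3
  rw [← h3]
  simp [Matrix.scalar_apply, ← Matrix.smul_one_eq_diagonal, Matrix.smul_mulVec]

lemma span_aux {K V : Type*} [Field K] [AddCommGroup V] [Module K V] (M : V →ₗ[K] V)
    (l r : K) (hne : l ≠ r) (hl1 : l ≠ 1) (hr1 : r ≠ 1)
    (e f b c : V) (he : e ≠ 0) (hf : f ≠ 0) (hMe : M e = l • e) (hMf : M f = r • f)
    (hsp : ∀ v, M v - v ∈ Submodule.span K {b, c}) :
    ∀ v, ∃ α β : K, M v - v = α • e + β • f := by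
  have hes : ∀ (g : V) (s : K), s ≠ 1 → M g = s • g → g ∈ Submodule.span K {b, c} := by
    intro g s hs hg
    have h1 := hsp g
    rw [hg] at h1
    have h3 := Submodule.smul_mem _ (s - 1)⁻¹ h1
    have : (s - 1)⁻¹ • (s • g - g) = g := by
      have h4 : s • g - g = (s - 1) • g := by module
      rw [h4, smul_smul, inv_mul_cancel₀ (sub_ne_zero.mpr hs), one_smul]
    rwa [this] at h3
  have hind : LinearIndependent K ![e, f] := by
    rw [LinearIndependent.pair_iff]
    intro s t h
    have h' := congrArg M h
    simp only [map_add, map_smul, hMe, hMf, map_zero] at h'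
    have h3 : ((l - r) * s) • e = 0 := by
      have : ((l - r) * s) • e = (s • l • e + t • r • f) - r • (s • e + t • f) := by module
      rw [this, h, h']; simp
    have hs : s = 0 := by
      simpa [he, sub_eq_zero, hne] using h3
    refine ⟨hs, ?_⟩
    simpa [hs, hf] using h
  have hle : Submodule.span K {e, f} ≤ Submodule.span K {b, c} := by
    rw [Submodule.span_le]
    rintro g (rfl | rfl)
    · exact hes _ l hl1 hMe
    · exact hes _ r hr1 hMf
  have h1 : Module.finrank K (Submodule.span K {e, f}) = 2 := by
    have := finrank_span_eq_card hind
    rw [Matrix.range_cons_cons_empty] at this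
    simpa using this
  have h3 : Module.finrank K (Submodule.span K {b, c}) ≤ 2 := by
    classical
    have := finrank_span_finset_le_card (R := K) ({b, c} : Finset V)
    simp at this
    exact this.trans Finset.card_le_two
  have : FiniteDimensional K (Submodule.span K {b, c}) :=
    FiniteDimensional.span_of_finite K (by simp)
  have heq := Submodule.eq_of_le_of_finrank_le hle (by rw [h1]; exact h3)
  intro v
  have := hsp v
  rw [← heq, Submodule.mem_span_pair] at this
  obtain ⟨α, β, h⟩ := this
  exact ⟨α, β, h.symm⟩

lemma invol_aux {K n : Type*} [Field K] [Fintype n] [DecidableEq n] (J A : Matrix n n K)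
    (h : A.transpose * J * A = J) (h2 : A ^ 2 = 1) : A.transpose * J = J * A := by
  calc A.transpose * J = A.transpose * J * A ^ 2 := by rw [h2, mul_one]
    _ = A.transpose * J * A * A := by rw [sq, ← mul_assoc]
    _ = J * A := by rw [h]

lemma final_aux {K n : Type*} [Field K] [IsAlgClosed K] [Fintype n] [DecidableEq n]
    (h2 : (2 : K) ≠ 0) (hn : Even (Fintype.card n)) (J M A₁ A₂ A₃ : Matrix n n K)
    (hJ : J.transpose = -J) (hJ2 : J * J = -1)
    (hM : M.transpose * J * M = J) (h1 : A₁.transpose * J * A₁ = J)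
    (h2' : A₂.transpose * J * A₂ = J) (h3 : A₃.transpose * J * A₃ = J)
    (i1 : A₁ ^ 2 = 1) (i2 : A₂ ^ 2 = 1) (i3 : A₃ ^ 2 = 1) (hMA : M = A₁ * A₂ * A₃)
    (l r : K) (hlr : l * r = 1) (hl1 : l ≠ 1) (hl2 : l ≠ -1)
    (e f : n → K) (he : e ≠ 0) (hf : f ≠ 0) (hMe : M.mulVec e = l • e) (hMf : M.mulVec f = r • f)
    (hsp : ∀ v, ∃ α β : K, M.mulVec v - v = α • e + β • f) : False := by
  let ω : (n → K) →ₗ[K] (n → K) →ₗ[K] K := Matrix.toLinearMap₂' K J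
  have hω : ∀ u v, ω u v = dotProduct u (J.mulVec v) := fun u v =>
    Matrix.toLinearMap₂'_apply' J u v
  have tr : ∀ (A : Matrix n n K) u v, ω (A.mulVec u) v = dotProduct u ((A.transpose * J).mulVec v) := by
    intro A u v
    rw [hω, ← Matrix.mulVec_mulVec, Matrix.dotProduct_mulVec u, Matrix.vecMul_transpose]
  obtain ⟨x, v, hv, hv1, hv2⟩ := ker_aux h2 ω
    (fun u v => by
      rw [hω, hω, Matrix.dotProduct_mulVec, ← Matrix.mulVec_transpose, hJ, Matrix.neg_mulVec,
        neg_dotProduct, dotProduct_comm])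
    (fun u h => by
      have h0 : J.mulVec u = 0 := by
        apply dotProduct_eq_zero
        intro w
        rw [dotProduct_comm, ← hω, h]
      have h4 : (J * J).mulVec u = 0 := by rw [← Matrix.mulVec_mulVec, h0, Matrix.mulVec_zero]
      rw [hJ2, Matrix.neg_mulVec, Matrix.one_mulVec] at h4
      exact neg_eq_zero.mp h4)
    M.mulVecLin A₃.mulVecLin
    (fun u v => by
      rw [Matrix.mulVecLin_apply, Matrix.mulVecLin_apply, tr, Matrix.mulVec_mulVec, hM, hω])
    (fun u v => by
      rw [Matrix.mulVecLin_apply, Matrix.mulVecLin_apply, tr, invol_aux J A₃ h3 i3, hω,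
        Matrix.mulVec_mulVec])
    (fun u => by
      rw [Matrix.mulVecLin_apply, Matrix.mulVecLin_apply, Matrix.mulVec_mulVec, ← sq, i3,
        Matrix.one_mulVec])
    l r hlr hl1 hl2 e f he hf hMe hMf hsp (x_aux h2 l hl1 hl2)
  simp only [Matrix.mulVecLin_apply, Matrix.mulVec_mulVec] at hv1 hv2
  have hN : M * A₃ = A₁ * A₂ := by
    rw [hMA, mul_assoc, ← sq, i3, mul_one]
  have hE : A₂ - x • A₁ = A₁ * (M * A₃ - x • 1) := by
    rw [hN, mul_sub, ← mul_assoc, ← sq, i1]; simp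
  have hE' : M * A₃ - x • 1 = -(A₁ * J * (J * (A₂ - x • A₁))) := by
    rw [mul_assoc A₁ J, ← mul_assoc J J, hJ2, hE, neg_one_mul, mul_neg, neg_neg, ← mul_assoc A₁,
      ← sq, i1, one_mul]
  refine skew_aux h2 hn (J * (A₂ - x • A₁)) ?_ v hv ?_ ?_
  · have a1 := invol_aux J A₁ h1 i1
    have a2 := invol_aux J A₂ h2' i2
    rw [Matrix.transpose_mul, hJ, Matrix.transpose_sub, Matrix.transpose_smul, mul_neg, sub_mul,
      smul_mul_assoc, a1, a2, mul_sub, mul_smul_comm]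
  · rw [hE, ← Matrix.mulVec_mulVec, ← Matrix.mulVec_mulVec, Matrix.sub_mulVec, hv1]
    simp [Matrix.smul_mulVec]
  · intro y hy
    apply hv2
    have : (M * A₃ - x • (1 : Matrix n n K)).mulVec y = 0 := by
      rw [hE', Matrix.neg_mulVec, ← Matrix.mulVec_mulVec, hy]; simp
    rw [Matrix.sub_mulVec, sub_eq_zero] at this
    rw [this]; simp [Matrix.smul_mulVec]

/-- Let `F` be a field of characteristic not 2, let `a ∈ F` with `a ≠ ±2`, and set
`p = X² + aX + 1` (a monic palindromial of degree 2 with no root in `{1, -1}`).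
If `M ∈ Sp_{2m}(F)` (with `m ≥ 2`) has minimal polynomial `(X - 1)·p` and the kernel of
`p(M)` has dimension 2 over `F`, then `M` is not a product of three involutions of
`Sp_{2m}(F)`. -/
theorem not_product_of_three_involutions_of_minpoly
    (F : Type*) [Field F] (hF : ringChar F ≠ 2)
    (a : F) (ha : a ≠ 2) (ha' : a ≠ -2)
    (m : ℕ) (hm : 2 ≤ m)
    (M : Matrix (Fin m ⊕ Fin m) (Fin m ⊕ Fin m) F)
    (hM : M ∈ Matrix.symplecticGroup (Fin m) F)
    (hmin : minpoly F M = (X - 1) * (X ^ 2 + C a * X + 1))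
    (hker : Module.finrank F
        (LinearMap.ker (Matrix.mulVecLin (aeval M (X ^ 2 + C a * X + 1)))) = 2) :
    ¬ ∃ A₁ A₂ A₃ : Matrix (Fin m ⊕ Fin m) (Fin m ⊕ Fin m) F,
        A₁ ∈ Matrix.symplecticGroup (Fin m) F ∧
        A₂ ∈ Matrix.symplecticGroup (Fin m) F ∧
        A₃ ∈ Matrix.symplecticGroup (Fin m) F ∧
        A₁ ^ 2 = 1 ∧ A₂ ^ 2 = 1 ∧ A₃ ^ 2 = 1 ∧
        M = A₁ * A₂ * A₃ := by

  rintro ⟨A₁, A₂, A₃, s1, s2, s3, i1, i2, i3, hMA⟩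
  let K := AlgebraicClosure F
  let φ := algebraMap F K
  have hφ : Function.Injective φ := φ.injective
  have h2F : (2 : F) ≠ 0 := Ring.two_ne_zero hF
  have h2 : (2 : K) ≠ 0 := by
    have := (map_ne_zero φ).mpr h2F
    rwa [map_ofNat] at this
  have hmem : ∀ A ∈ Matrix.symplecticGroup (Fin m) F,
      (A.map φ).transpose * Matrix.J (Fin m) K * A.map φ = Matrix.J (Fin m) K := by
    intro A hA
    have := congrArg (fun B => B.map φ) (SymplecticGroup.mem_iff'.mp hA)
    simpa [Matrix.map_mul, Matrix.transpose_map] using this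
  have hinv : ∀ A : Matrix (Fin m ⊕ Fin m) (Fin m ⊕ Fin m) F, A ^ 2 = 1 → (A.map φ) ^ 2 = 1 := by
    intro A hA
    have := congrArg (fun B => B.map φ) hA
    simpa [sq, Matrix.map_mul] using this
  obtain ⟨l, hl⟩ := quad_aux h2 (φ a) 1
  have hl0 : l ≠ 0 := by rintro rfl; simp at hl
  have ha1 : φ a + 2 ≠ 0 := by
    intro h
    apply ha'
    apply hφ
    rw [map_neg, map_ofNat]
    linear_combination h
  have ha2 : φ a - 2 ≠ 0 := by
    intro h
    apply ha
    apply hφ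
    rw [map_ofNat]
    linear_combination h
  have hl1 : l ≠ 1 := by
    rintro rfl
    apply ha1; linear_combination hl
  have hl2 : l ≠ -1 := by
    rintro rfl
    apply ha2; linear_combination -hl
  have hlr : l * l⁻¹ = 1 := mul_inv_cancel₀ hl0
  have hr : (l⁻¹) ^ 2 + φ a * l⁻¹ + 1 = 0 := by
    linear_combination (l⁻¹) ^ 2 * hl - (l * l⁻¹ + 1 + φ a * l⁻¹) * hlr
  have hroot : ∀ s : K, s ^ 2 + φ a * s + 1 = 0 → aeval s (minpoly F M) = 0 := by
    intro s hs
    rw [hmin, map_mul]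
    have : aeval s (X ^ 2 + C a * X + 1 : F[X]) = 0 := by
      simpa [φ] using hs
    rw [this, mul_zero]
  obtain ⟨e, he, hMe⟩ := eig_aux M l (hroot l hl)
  obtain ⟨f, hf, hMf⟩ := eig_aux M l⁻¹ (hroot _ hr)
  have hP : aeval M (X ^ 2 + C a * X + 1) * (M - 1) = 0 := by
    have := minpoly.aeval F M
    rw [hmin, mul_comm, map_mul] at this
    simpa using this
  obtain ⟨B, D, hBD⟩ := factor_aux M _ hP hker
  have hBD' : M.map φ - 1 = B.map φ * D.map φ := by
    have := congrArg (fun B => B.map φ) hBD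
    simpa [Matrix.map_mul, Matrix.map_sub] using this
  have hne : l ≠ l⁻¹ := by
    intro h
    have h3 : (l - 1) * (l + 1) = 0 := by
      rw [← h] at hlr
      linear_combination hlr
    rcases mul_eq_zero.mp h3 with h | h
    · exact hl1 (by linear_combination h)
    · exact hl2 (by linear_combination h)
  refine final_aux h2 (by simp) (Matrix.J (Fin m) K) (M.map φ) (A₁.map φ) (A₂.map φ) (A₃.map φ)
    (Matrix.J_transpose _ _) (Matrix.J_squared _ _) (hmem _ hM) (hmem _ s1) (hmem _ s2) (hmem _ s3)
    (hinv _ i1) (hinv _ i2) (hinv _ i3) (by rw [hMA]; simp [Matrix.map_mul])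
    l l⁻¹ hlr hl1 hl2 e f he hf hMe hMf
    (span_aux (M.map φ).mulVecLin l l⁻¹ hne hl1 (by simpa using hl1) e f
      ((B.map φ).col 0) ((B.map φ).col 1) he hf hMe hMf ?_)
  intro v
  have h1 : (M.map φ).mulVecLin v - v = (B.map φ).mulVec ((D.map φ).mulVec v) := by
    rw [Matrix.mulVec_mulVec, ← hBD', Matrix.sub_mulVec, Matrix.one_mulVec, Matrix.mulVecLin_apply]
  rw [h1, Submodule.mem_span_pair]
  refine ⟨(D.map φ).mulVec v 0, (D.map φ).mulVec v 1, ?_⟩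
  funext i
  generalize (D.map φ).mulVec v = w
  simp [Matrix.mulVec, dotProduct, Fin.sum_univ_two, mul_comm]
end
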